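/- Let p ∈ (2,3]. Let (d_n)_{n∈ℤ} be an ℝ^d-valued stationary sequence of martingale differences with respect to (ℱ_n)_{n∈ℤ} with E|d_0|_d^p < ∞, satisfying conditions (C1) and (C2). Let Σ = E(d_0 d_0^t) and let G_Σ be an ℝ^d-valued centered Gaussian random variable with covariance Σ. Then W_1(P_{n^{−1/2} M_n}, P_{G_Σ}) ≤ C n^{(2−p)/2} if p ∈ (2,3), and W_1(P_{n^{−1/2} M_n}, P_{G_Σ}) ≤ C n^{−1/2} log n if p = 3, where C is a positive constant depending on (p,d) but not on n. -/

import Mathlib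

open MeasureTheory ProbabilityTheory Filter Asymptotics
open scoped ENNReal NNReal Topology

noncomputable section

/-- Standard normal cumulative distribution function Φ. -/
def stdNormalCDF (x : ℝ) : ℝ := ((gaussianReal 0 1) (Set.Iic x)).toReal

/-- Generalized inverse Φ⁻¹. -/
def stdNormalCDFInv (y : ℝ) : ℝ := sInf {x : ℝ | y ≤ stdNormalCDF x}

/-- Quantile function of `|X|`: the cadlag inverse of the tail function `x ↦ ℙ(|X| > x)`. -/
def absQuantile {Ω : Type*} [MeasurableSpace Ω] (P : Measure Ω) (X : Ω → ℝ) (u : ℝ) : ℝ :=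
  sInf {x : ℝ | (P {ω | x < |X ω|}).toReal ≤ u}

/-- The envelope norm `‖X‖_{1,Φ,p} = ∫₀¹ (1 ∨ Φ⁻¹(1-u/2))^{p-2} Q_X(u) du`. -/
def envNorm {Ω : Type*} [MeasurableSpace Ω] (P : Measure Ω) (p : ℝ) (X : Ω → ℝ) : ℝ≥0∞ :=
  ∫⁻ u in Set.Ioo (0:ℝ) 1,
    ENNReal.ofReal ((max 1 (stdNormalCDFInv (1 - u/2))) ^ (p - 2) * absQuantile P X u)

/-- `γ` is the centered Gaussian law on `ℝ^D` with covariance matrix `S`. -/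
def IsCenteredGaussianCov (D : ℕ) (S : Matrix (Fin D) (Fin D) ℝ)
    (γ : Measure (EuclideanSpace ℝ (Fin D))) : Prop :=
  IsProbabilityMeasure γ ∧
    ∀ t : Fin D → ℝ,
      Measure.map (fun x => ∑ i, t i * x i) γ =
        gaussianReal 0 (Real.toNNReal (∑ i, ∑ j, t i * S i j * t j))

/-- Partial sums `M_n = ∑_{k=1}^n d_k`. -/
def partialSum {Ω : Type*} {D : ℕ} (d : ℤ → Ω → EuclideanSpace ℝ (Fin D)) (n : ℕ) (ω : Ω) :
    EuclideanSpace ℝ (Fin D) :=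
  ∑ k ∈ Finset.Icc (1 : ℤ) (n : ℤ), d k ω

/-- The Wasserstein-1 type distance `W₁(μ,ν) = sup_{g 1-Lipschitz} (μ(g) - ν(g))`. -/
def W1dist {E : Type*} [MeasurableSpace E] [PseudoMetricSpace E] (μ ν : Measure E) : ℝ :=
  ⨆ g : {g : E → ℝ // LipschitzWith 1 g}, (∫ x, g.1 x ∂μ - ∫ x, g.1 x ∂ν)

/-- The quadratic form with coefficients `H` evaluated at `h`. -/
def quadVal {D : ℕ} (H : Fin D → Fin D → ℝ) (h : EuclideanSpace ℝ (Fin D)) : ℝ :=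
  ∑ i, ∑ j, H i j * (h i * h j)

/-- `F` has, at every point, a second order expansion with gradient `G`, Hessian `H`, and a
remainder of order `p` controlled by `w`. -/
structure HasTaylor {D : ℕ} (p w : ℝ) (F : EuclideanSpace ℝ (Fin D) → ℝ)
    (G : EuclideanSpace ℝ (Fin D) → Fin D → ℝ)
    (H : EuclideanSpace ℝ (Fin D) → Fin D → Fin D → ℝ) : Prop where
  nonneg : 0 ≤ w
  measF : Measurable F
  measG : Measurable G
  measH : Measurable H
  symm : ∀ x i j, H x i j = H x j i
  bound : ∀ x h, |F (x + h) - F x - ∑ i, G x i * h i - 1 / 2 * quadVal (H x) h| ≤ w * ‖h‖ ^ p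

section quadVal

variable {D : ℕ} (H : Fin D → Fin D → ℝ) (u v : EuclideanSpace ℝ (Fin D))

lemma quadVal_smul (c : ℝ) : quadVal H (c • u) = c ^ 2 * quadVal H u := by
  simp only [quadVal, Finset.mul_sum, PiLp.smul_apply, smul_eq_mul]
  exact Finset.sum_congr rfl fun i _ => Finset.sum_congr rfl fun j _ => by ring

lemma quadVal_parallelogram :
    quadVal H (u + v) + quadVal H (u - v) = 2 * quadVal H u + 2 * quadVal H v := by
  simp only [quadVal, Finset.mul_sum, ← Finset.sum_add_distrib, PiLp.add_apply, PiLp.sub_apply]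
  exact Finset.sum_congr rfl fun i _ => Finset.sum_congr rfl fun j _ => by ring

lemma quadVal_polarization (hH : ∀ i j, H i j = H j i) (i j : Fin D) :
    quadVal H (EuclideanSpace.single i 1 + EuclideanSpace.single j 1)
      - quadVal H (EuclideanSpace.single i 1) - quadVal H (EuclideanSpace.single j 1)
      = 2 * H i j := by
  have h : quadVal H (EuclideanSpace.single i 1 + EuclideanSpace.single j 1)
      - quadVal H (EuclideanSpace.single i 1) - quadVal H (EuclideanSpace.single j 1)
      = ∑ a, ∑ b, (H a b * ((if a = i then 1 else 0) * (if b = j then 1 else 0))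
        + H a b * ((if a = j then 1 else 0) * (if b = i then 1 else 0))) := by
    simp only [quadVal, ← Finset.sum_sub_distrib, PiLp.add_apply, PiLp.single_apply]
    exact Finset.sum_congr rfl fun a _ => Finset.sum_congr rfl fun b _ => by ring
  rw [h]
  simp only [Finset.sum_add_distrib]
  simp [hH j i, two_mul]

lemma abs_quadVal_le {K : ℝ} (hK : ∀ i j, |H i j| ≤ K) : |quadVal H u| ≤ D ^ 2 * K * ‖u‖ ^ 2 := by
  have hc : ∀ i, |u i| ≤ ‖u‖ := fun i => by
    simpa using PiLp.norm_apply_le u i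
  calc |quadVal H u| ≤ ∑ i : Fin D, ∑ j : Fin D, K * (‖u‖ * ‖u‖) := by
        refine (Finset.abs_sum_le_sum_abs _ _).trans (Finset.sum_le_sum fun i _ => ?_)
        refine (Finset.abs_sum_le_sum_abs _ _).trans (Finset.sum_le_sum fun j _ => ?_)
        rw [abs_mul, abs_mul]
        have := (abs_nonneg _).trans (hK i j)
        have := hK i j
        have := hc i
        have := hc j
        gcongr
    _ = _ := by simp; ring

end quadVal

namespace HasTaylor

variable {D : ℕ} {p w w' : ℝ} {F : EuclideanSpace ℝ (Fin D) → ℝ}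
  {G G' : EuclideanSpace ℝ (Fin D) → Fin D → ℝ}
  {H H' : EuclideanSpace ℝ (Fin D) → Fin D → Fin D → ℝ}

lemma abs_second_difference_le (hT : HasTaylor p w F G H) (x h u : EuclideanSpace ℝ (Fin D)) :
    |F (x + h + u) + F (x + h - u) - 2 * F (x + h) - quadVal (H x) u|
      ≤ w * (‖h + u‖ ^ p + ‖h - u‖ ^ p + 2 * ‖h‖ ^ p) := by
  have h1 := hT.bound x (h + u)
  have h2 := hT.bound x (h - u)
  have h3 := hT.bound x h
  have hq := quadVal_parallelogram (H x) h u
  have e1 : ∑ i, G x i * (h + u) i = ∑ i, G x i * h i + ∑ i, G x i * u i := by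
    simp [mul_add, Finset.sum_add_distrib]
  have e2 : ∑ i, G x i * (h - u) i = ∑ i, G x i * h i - ∑ i, G x i * u i := by
    simp [mul_sub, Finset.sum_sub_distrib]
  rw [e1, ← add_assoc] at h1
  rw [e2, ← add_sub_assoc] at h2
  rw [abs_le] at *
  constructor <;> linarith [h1.1, h1.2, h2.1, h2.2, h3.1, h3.2]

lemma abs_quadVal_sub_le (hT : HasTaylor p w F G H) (hp : 2 < p) (hp3 : p ≤ 3)
    (x h u : EuclideanSpace ℝ (Fin D)) (hu : ‖u‖ ≤ 2 * ‖h‖) :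
    |quadVal (H (x + h)) u - quadVal (H x) u| ≤ 162 * w * ‖h‖ ^ p := by
  have h1 := hT.abs_second_difference_le x h u
  have h2 := hT.abs_second_difference_le (x + h) 0 u
  simp only [add_zero, zero_add, zero_sub, norm_neg, norm_zero] at h2
  rw [Real.zero_rpow (by linarith)] at h2
  have hw := hT.nonneg
  have key : ∀ z : EuclideanSpace ℝ (Fin D), ‖z‖ ≤ 3 * ‖h‖ → ‖z‖ ^ p ≤ 27 * ‖h‖ ^ p := by
    intro z hz
    calc ‖z‖ ^ p ≤ (3 * ‖h‖) ^ p := by gcongr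
      _ = 3 ^ p * ‖h‖ ^ p := Real.mul_rpow (by norm_num) (norm_nonneg _)
      _ ≤ 3 ^ (3 : ℝ) * ‖h‖ ^ p := by gcongr; norm_num
      _ = 27 * ‖h‖ ^ p := by norm_num
  have hn := norm_nonneg h
  have a1 := key (h + u) ((norm_add_le _ _).trans (by linarith))
  have a2 := key (h - u) ((norm_sub_le _ _).trans (by linarith))
  have a3 := key u (by linarith)
  have a4 := key h (by linarith)
  have a5 : 0 ≤ ‖h‖ ^ p := by positivity
  have b1 : w * (‖h + u‖ ^ p + ‖h - u‖ ^ p + 2 * ‖h‖ ^ p) ≤ w * (108 * ‖h‖ ^ p) := by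
    gcongr; linarith
  have b2 : w * (‖u‖ ^ p + ‖u‖ ^ p + 2 * 0) ≤ w * (54 * ‖h‖ ^ p) := by
    gcongr; linarith
  rw [abs_le] at *
  constructor <;> linarith [h1.1, h1.2, h2.1, h2.2]

lemma abs_hessian_sub_le (hT : HasTaylor p w F G H) (hp : 2 < p) (hp3 : p ≤ 3)
    (x y : EuclideanSpace ℝ (Fin D)) (i j : Fin D) :
    |H x i j - H y i j| ≤ 243 * w * ‖x - y‖ ^ (p - 2) := by
  by_cases hxy : x = y
  · subst hxy
    simp only [sub_self, abs_zero]
    have := hT.nonneg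
    positivity
  obtain ⟨h, rfl⟩ : ∃ h, x = y + h := ⟨x - y, by simp⟩
  have hh : 0 < ‖h‖ := by
    rw [norm_pos_iff]
    rintro rfl
    simp at hxy
  have main : ∀ e : EuclideanSpace ℝ (Fin D), ‖e‖ ≤ 2 →
      |quadVal (H (y + h)) e - quadVal (H y) e| ≤ 162 * w * ‖h‖ ^ (p - 2) := by
    intro e he
    have := hT.abs_quadVal_sub_le hp hp3 y h (‖h‖ • e) (by
      rw [norm_smul, norm_norm, mul_comm]; gcongr)
    rw [quadVal_smul, quadVal_smul, ← mul_sub, abs_mul, abs_of_nonneg (by positivity)] at this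
    have e1 : ‖h‖ ^ p = ‖h‖ ^ 2 * ‖h‖ ^ (p - 2) := by
      rw [← Real.rpow_natCast, ← Real.rpow_add hh]; norm_num
    rw [e1] at this
    refine le_of_mul_le_mul_left (this.trans (le_of_eq (by ring))) (by positivity : 0 < ‖h‖ ^ 2)
  have n1 : ∀ i : Fin D, ‖EuclideanSpace.single i (1 : ℝ)‖ = 1 := by simp
  have m1 := main (EuclideanSpace.single i 1) (by rw [n1]; norm_num)
  have m2 := main (EuclideanSpace.single j 1) (by rw [n1]; norm_num)
  have m3 := main (EuclideanSpace.single i 1 + EuclideanSpace.single j 1)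
    ((norm_add_le _ _).trans (by rw [n1, n1]; norm_num))
  have q1 := quadVal_polarization (H (y + h)) (hT.symm _) i j
  have q2 := quadVal_polarization (H y) (hT.symm _) i j
  rw [add_sub_cancel_left]
  rw [abs_le] at *
  constructor <;> linarith [m1.1, m1.2, m2.1, m2.2, m3.1, m3.2]

lemma hessian_unique (hT : HasTaylor p w F G H) (hT' : HasTaylor p w' F G' H') (hp : 2 < p) :
    H = H' := by
  have main : ∀ x e, quadVal (H x) e = quadVal (H' x) e := by
    intro x e
    have hb : ∀ τ : ℝ, 0 < τ → |quadVal (H x) e - quadVal (H' x) e|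
        ≤ 2 * (w + w') * ‖e‖ ^ p * τ ^ (p - 2) := by
      intro τ hτ
      have h1 := hT.abs_second_difference_le x 0 (τ • e)
      have h2 := hT'.abs_second_difference_le x 0 (τ • e)
      simp only [add_zero, zero_add, zero_sub, norm_neg, norm_zero, quadVal_smul] at h1 h2
      rw [Real.zero_rpow (by linarith), norm_smul, Real.norm_of_nonneg hτ.le,
        Real.mul_rpow hτ.le (norm_nonneg _)] at h1 h2
      have e1 : τ ^ p = τ ^ 2 * τ ^ (p - 2) := by
        rw [← Real.rpow_natCast, ← Real.rpow_add hτ]; norm_num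
      rw [e1] at h1 h2
      have : τ ^ 2 * |quadVal (H x) e - quadVal (H' x) e|
          ≤ τ ^ 2 * (2 * (w + w') * ‖e‖ ^ p * τ ^ (p - 2)) := by
        rw [← abs_of_pos (by positivity : 0 < τ ^ 2), ← abs_mul,
          abs_of_pos (by positivity : 0 < τ ^ 2)]
        rw [abs_le] at *
        constructor <;> linarith [h1.1, h1.2, h2.1, h2.2]
      exact le_of_mul_le_mul_left this (by positivity)
    have hlim : Tendsto (fun τ : ℝ => 2 * (w + w') * ‖e‖ ^ p * τ ^ (p - 2)) (𝓝[>] 0) (𝓝 0) := by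
      have : Tendsto (fun τ : ℝ => 2 * (w + w') * ‖e‖ ^ p * τ ^ (p - 2)) (𝓝 0)
          (𝓝 (2 * (w + w') * ‖e‖ ^ p * 0 ^ (p - 2))) :=
        ((Real.continuousAt_rpow_const 0 (p - 2) (Or.inr (by linarith))).tendsto).const_mul _
      rw [Real.zero_rpow (by linarith), mul_zero] at this
      exact this.mono_left nhdsWithin_le_nhds
    have := ge_of_tendsto hlim (eventually_nhdsWithin_of_forall hb)
    exact sub_eq_zero.1 (abs_eq_zero.1 (le_antisymm this (abs_nonneg _)))
  funext x i j
  have q1 := quadVal_polarization (H x) (hT.symm _) i j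
  have q2 := quadVal_polarization (H' x) (hT'.symm _) i j
  rw [main, main, main] at q1
  linarith

lemma exists_hessian_growth (hT : HasTaylor p w F G H) (hp : 2 < p) (hp3 : p ≤ 3) :
    ∃ K, 0 ≤ K ∧ ∀ x i j, |H x i j| ≤ K * (1 + ‖x‖) ^ (p - 2) := by
  refine ⟨∑ i, ∑ j, |H 0 i j| + 243 * w, ?_, fun x i j => ?_⟩
  · have := hT.nonneg
    positivity
  have h1 := hT.abs_hessian_sub_le hp hp3 x 0 i j
  rw [sub_zero] at h1
  have hw := hT.nonneg
  have h2 : |H 0 i j| ≤ ∑ i, ∑ j, |H 0 i j| :=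
    (Finset.single_le_sum (f := fun j => |H 0 i j|) (fun j _ => abs_nonneg _)
      (Finset.mem_univ j)).trans
    (Finset.single_le_sum (f := fun i => ∑ j, |H 0 i j|)
      (fun i _ => Finset.sum_nonneg fun j _ => abs_nonneg _) (Finset.mem_univ i))
  have h3 : (1 : ℝ) ≤ (1 + ‖x‖) ^ (p - 2) :=
    Real.one_le_rpow (by linarith [norm_nonneg x]) (by linarith)
  have h4 : ‖x‖ ^ (p - 2) ≤ (1 + ‖x‖) ^ (p - 2) := by
    gcongr
    linarith
  calc |H x i j| ≤ |H 0 i j| + |H x i j - H 0 i j| := by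
        have := abs_add_le (H 0 i j) (H x i j - H 0 i j)
        simpa using this
    _ ≤ (∑ i, ∑ j, |H 0 i j|) * 1 + 243 * w * (1 + ‖x‖) ^ (p - 2) := by
        rw [mul_one]
        gcongr
        exact h1.trans (by gcongr)
    _ ≤ (∑ i, ∑ j, |H 0 i j|) * (1 + ‖x‖) ^ (p - 2) + 243 * w * (1 + ‖x‖) ^ (p - 2) := by
        gcongr
    _ = _ := by ring

lemma exists_growth (hT : HasTaylor p w F G H) (hp : 2 < p) (hp3 : p ≤ 3) :
    ∃ K, 0 ≤ K ∧ (∀ x, |F x| ≤ K * (1 + ‖x‖) ^ p) ∧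
      (∀ x i, |G x i| ≤ K * (1 + ‖x‖) ^ (p - 1)) ∧
      ∀ x i j, |H x i j| ≤ K * (1 + ‖x‖) ^ (p - 2) := by
  obtain ⟨K₁, hK₁, hH⟩ := hT.exists_hessian_growth hp hp3
  have hw := hT.nonneg
  set A := ∑ i, |G 0 i| with hA
  have hA0 : 0 ≤ A := Finset.sum_nonneg fun i _ => abs_nonneg _
  set K₂ := |F 0| + A + D ^ 2 * K₁ + w with hK₂
  have hK₂0 : 0 ≤ K₂ := by positivity
  have hF : ∀ x, |F x| ≤ K₂ * (1 + ‖x‖) ^ p := by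
    intro x
    have hx := norm_nonneg x
    have h1 := hT.bound 0 x
    rw [zero_add] at h1
    have hb : ∀ q : ℝ, 0 ≤ q → q ≤ p → (1 + ‖x‖) ^ q ≤ (1 + ‖x‖) ^ p := fun q _ hq =>
      Real.rpow_le_rpow_of_exponent_le (by linarith) hq
    have hG : |∑ i, G 0 i * x i| ≤ A * (1 + ‖x‖) ^ p := by
      refine (Finset.abs_sum_le_sum_abs _ _).trans ?_
      rw [hA, Finset.sum_mul]
      refine Finset.sum_le_sum fun i _ => ?_
      rw [abs_mul]
      gcongr
      have h2 := hb 1 (by norm_num) (by linarith)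
      rw [Real.rpow_one] at h2
      have h3 : |x i| ≤ ‖x‖ := by simpa using PiLp.norm_apply_le x i
      linarith
    have hQ : |quadVal (H 0) x| ≤ D ^ 2 * K₁ * (1 + ‖x‖) ^ p := by
      refine (abs_quadVal_le (H 0) x (K := K₁) (fun i j => by simpa using hH 0 i j)).trans ?_
      gcongr
      have h2 := hb 2 (by norm_num) (by linarith)
      rw [Real.rpow_two] at h2
      nlinarith
    have h5 : ‖x‖ ^ p ≤ (1 + ‖x‖) ^ p := by gcongr; linarith
    have h6 : w * ‖x‖ ^ p ≤ w * (1 + ‖x‖) ^ p := by gcongr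
    have h7 := hb 0 le_rfl (by linarith)
    rw [Real.rpow_zero] at h7
    have h8 : |F 0| ≤ |F 0| * (1 + ‖x‖) ^ p := le_mul_of_one_le_right (abs_nonneg _) h7
    have h9 : 0 ≤ |quadVal (H 0) x| := abs_nonneg _
    have e : F x = (F x - F 0 - ∑ i, G 0 i * x i - 1 / 2 * quadVal (H 0) x) + F 0
      + ∑ i, G 0 i * x i + 1 / 2 * quadVal (H 0) x := by ring
    have h10 : |F x| ≤ |F x - F 0 - ∑ i, G 0 i * x i - 1 / 2 * quadVal (H 0) x| + |F 0|
        + |∑ i, G 0 i * x i| + |1 / 2 * quadVal (H 0) x| := by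
      conv_lhs => rw [e]
      exact (abs_add_le _ _).trans (add_le_add_left ((abs_add_le _ _).trans
        (add_le_add_left (abs_add_le _ _) _)) _)
    rw [abs_mul, abs_of_pos (by norm_num : (0 : ℝ) < 1 / 2)] at h10
    rw [hK₂]
    linarith
  have hG : ∀ x i, |G x i| ≤ (K₂ * (2 ^ p + 1) + D ^ 2 * K₁ + w) * (1 + ‖x‖) ^ (p - 1) := by
    intro x i
    have hx := norm_nonneg x
    set ρ := 1 + ‖x‖ with hρ
    have hρ1 : 1 ≤ ρ := by linarith
    have hρ0 : 0 < ρ := by linarith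
    set h := ρ • EuclideanSpace.single i (1 : ℝ) with hh
    have hhn : ‖h‖ = ρ := by simp [hh, norm_smul, abs_of_pos hρ0]
    have h1 := hT.bound x h
    have e1 : ∑ j, G x j * h j = ρ * G x i := by
      simp [hh, mul_comm]
    have hQ := abs_quadVal_le (H x) h (hH x)
    rw [e1, hhn] at h1
    rw [hhn] at hQ
    have e2 : ρ ^ (p - 2) * ρ ^ 2 = ρ ^ p := by
      rw [← Real.rpow_natCast, ← Real.rpow_add hρ0]; norm_num
    have e3 : D ^ 2 * (K₁ * ρ ^ (p - 2)) * ρ ^ 2 = D ^ 2 * K₁ * ρ ^ p := by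
      rw [← e2]; ring
    have e4 : ρ * ρ ^ (p - 1) = ρ ^ p := by
      nth_rewrite 1 [← Real.rpow_one ρ]
      rw [← Real.rpow_add hρ0]; norm_num
    rw [e3] at hQ
    have hF1 := hF x
    have hF2 : |F (x + h)| ≤ K₂ * 2 ^ p * ρ ^ p := by
      refine (hF (x + h)).trans ?_
      rw [mul_assoc, ← Real.mul_rpow (by norm_num) hρ0.le]
      gcongr
      have := norm_add_le x h
      rw [hhn] at this
      linarith
    have h9 : 0 ≤ |quadVal (H x) h| := abs_nonneg _
    have : ρ * |G x i| ≤ ρ * ((K₂ * (2 ^ p + 1) + D ^ 2 * K₁ + w) * ρ ^ (p - 1)) := by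
      have e5 : ρ * ((K₂ * (2 ^ p + 1) + D ^ 2 * K₁ + w) * ρ ^ (p - 1))
        = (K₂ * (2 ^ p + 1) + D ^ 2 * K₁ + w) * (ρ * ρ ^ (p - 1)) := by ring
      rw [e5, e4]
      rw [← abs_of_pos hρ0, ← abs_mul, abs_of_pos hρ0]
      rw [abs_le] at h1 hQ hF1 hF2 ⊢
      have : (0:ℝ) ≤ D ^ 2 * K₁ * ρ ^ p := by positivity
      constructor <;> linarith [h1.1, h1.2, hQ.1, hQ.2, hF1.1, hF1.2, hF2.1, hF2.2]
    exact le_of_mul_le_mul_left this hρ0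
  refine ⟨K₂ + (K₂ * (2 ^ p + 1) + D ^ 2 * K₁ + w) + K₁, by positivity, fun x => ?_, fun x i => ?_,
    fun x i j => ?_⟩
  · refine (hF x).trans ?_
    refine mul_le_mul_of_nonneg_right ?_ (by positivity)
    have : 0 ≤ (K₂ * (2 ^ p + 1) + D ^ 2 * K₁ + w) := by positivity
    linarith
  · refine (hG x i).trans ?_
    refine mul_le_mul_of_nonneg_right ?_ (by positivity)
    linarith
  · refine (hH x i j).trans ?_
    refine mul_le_mul_of_nonneg_right ?_ (by positivity)
    have : 0 ≤ (K₂ * (2 ^ p + 1) + D ^ 2 * K₁ + w) := by positivity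
    linarith

end HasTaylor

section PositivePart

lemma hasDerivAt_max_zero_rpow {q : ℝ} (hq : 1 < q) (y : ℝ) :
    HasDerivAt (fun z : ℝ => max z 0 ^ q) (q * max y 0 ^ (q - 1)) y := by
  rcases lt_trichotomy y 0 with hy | rfl | hy
  · rw [max_eq_right hy.le, Real.zero_rpow (by linarith), mul_zero]
    refine (hasDerivAt_const y (0 : ℝ)).congr_of_eventuallyEq ?_
    filter_upwards [Iio_mem_nhds hy] with z hz
    rw [max_eq_right (le_of_lt hz), Real.zero_rpow (by linarith)]
  · rw [max_self, Real.zero_rpow (by linarith), mul_zero]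
    have h1 : HasDerivAt (fun z : ℝ => |z| ^ q) 0 0 := by
      have := Real.hasDerivAt_rpow_const (x := 0) (p := q) (Or.inr hq.le)
      rw [Real.zero_rpow (by linarith), mul_zero] at this
      rw [hasDerivAt_iff_isLittleO] at this ⊢
      simp only [sub_zero, abs_zero, smul_zero, Real.zero_rpow (by linarith : q ≠ 0)] at this ⊢
      rw [isLittleO_iff] at this ⊢
      intro c hc
      have h2 := (continuous_abs.tendsto' (0 : ℝ) 0 (by simp)).eventually (this hc)
      filter_upwards [h2] with z hz
      simpa using hz
    rw [hasDerivAt_iff_isLittleO] at h1 ⊢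
    simp only [sub_zero, abs_zero, smul_zero, max_self, Real.zero_rpow (by linarith : q ≠ 0)]
      at h1 ⊢
    refine IsBigO.trans_isLittleO (IsBigO.of_bound 1 (Eventually.of_forall fun z => ?_)) h1
    rw [one_mul, Real.norm_of_nonneg (by positivity), Real.norm_of_nonneg (by positivity)]
    have : max z 0 ≤ |z| := max_le (le_abs_self z) (abs_nonneg z)
    gcongr
  · rw [max_eq_left hy.le]
    refine (Real.hasDerivAt_rpow_const (Or.inl hy.ne')).congr_of_eventuallyEq ?_
    filter_upwards [Ioi_mem_nhds hy] with z hz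
    rw [max_eq_left (le_of_lt hz)]

lemma abs_max_zero_rpow_sub_le {q : ℝ} (hq : 0 ≤ q) (hq1 : q ≤ 1) (x y : ℝ) :
    |max x 0 ^ q - max y 0 ^ q| ≤ |x - y| ^ q := by
  wlog hxy : y ≤ x generalizing x y
  · rw [abs_sub_comm, abs_sub_comm x]
    exact this y x (le_of_not_ge hxy)
  have h1 : max y 0 ≤ max x 0 := max_le_max_right 0 hxy
  have h0 : 0 ≤ max y 0 := le_max_right _ _
  rw [abs_of_nonneg (sub_nonneg.2 (Real.rpow_le_rpow h0 h1 hq)), abs_of_nonneg (by linarith)]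
  have h2 : max x 0 ^ q ≤ (max y 0 + (x - y)) ^ q := by
    refine Real.rpow_le_rpow (h0.trans h1) (max_le ?_ (by linarith)) hq
    linarith [le_max_left y 0]
  have h3 := Real.rpow_add_le_add_rpow h0 (sub_nonneg.2 hxy) hq hq1
  linarith

/-- A function vanishing at zero whose derivative is at most `K |h| ^ q` is at most
`K |h| ^ (q + 1)`. -/
lemma abs_le_of_abs_deriv_le {f f' : ℝ → ℝ} {K q : ℝ} (hK : 0 ≤ K) (hq : 0 ≤ q) (h0 : f 0 = 0)
    (hf : ∀ h, HasDerivAt f (f' h) h) (hb : ∀ h, |f' h| ≤ K * |h| ^ q) (h : ℝ) :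
    |f h| ≤ K * |h| ^ (q + 1) := by
  rcases eq_or_ne h 0 with rfl | hh
  · rw [h0, abs_zero]; positivity
  have := (convex_closedBall (0 : ℝ) |h|).norm_image_sub_le_of_norm_hasDerivWithin_le
    (f := f) (f' := f') (C := K * |h| ^ q) (x := 0) (y := h)
    (fun z _ => (hf z).hasDerivWithinAt) (fun z hz => by
      refine (hb z).trans ?_
      have : |z| ≤ |h| := by simpa using hz
      gcongr) (by simp) (by simp)
  rw [h0, sub_zero, sub_zero, Real.norm_eq_abs, Real.norm_eq_abs] at this
  rwa [Real.rpow_add (abs_pos.2 hh), Real.rpow_one, ← mul_assoc]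

lemma abs_max_zero_rpow_taylor_le {p : ℝ} (hp : 2 < p) (hp3 : p ≤ 3) (y h : ℝ) :
    |max (y + h) 0 ^ p - max y 0 ^ p - p * max y 0 ^ (p - 1) * h
      - 1 / 2 * (p * (p - 1) * max y 0 ^ (p - 2)) * h ^ 2| ≤ p * (p - 1) * |h| ^ p := by
  have hp1 : 0 ≤ p * (p - 1) := mul_nonneg (by linarith) (by linarith)
  have hd : ∀ q : ℝ, 1 < q → ∀ h : ℝ,
      HasDerivAt (fun z : ℝ => max (y + z) 0 ^ q) (q * max (y + h) 0 ^ (q - 1)) h := fun q hq h =>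
    HasDerivAt.comp_const_add y h (hasDerivAt_max_zero_rpow hq (y + h))
  have h1 : ∀ h, |p * max (y + h) 0 ^ (p - 1) - p * max y 0 ^ (p - 1)
      - p * (p - 1) * max y 0 ^ (p - 2) * h| ≤ p * (p - 1) * |h| ^ (p - 1) := by
    intro h
    have := abs_le_of_abs_deriv_le
      (f := fun h => p * max (y + h) 0 ^ (p - 1) - p * max y 0 ^ (p - 1)
        - p * (p - 1) * max y 0 ^ (p - 2) * h)
      (f' := fun h => p * ((p - 1) * max (y + h) 0 ^ (p - 1 - 1))
        - p * (p - 1) * max y 0 ^ (p - 2)) (K := p * (p - 1)) (q := p - 2) hp1 (by linarith)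
      (by simp) (fun h => by
        have h2 := (((hd (p - 1) (by linarith) h).const_mul p).sub_const
          (p * max y 0 ^ (p - 1))).sub ((hasDerivAt_id h).const_mul
            (p * (p - 1) * max y 0 ^ (p - 2)))
        exact h2.congr_deriv (by simp)) (fun h => by
        have h3 := abs_max_zero_rpow_sub_le (q := p - 2) (by linarith) (by linarith) (y + h) y
        rw [add_sub_cancel_left] at h3
        have e : p - 1 - 1 = p - 2 := by ring
        rw [e, ← mul_assoc, ← mul_sub, abs_mul, abs_of_nonneg hp1]
        gcongr) h
    rwa [show p - 2 + 1 = p - 1 by ring] at this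
  have := abs_le_of_abs_deriv_le
    (f := fun h => max (y + h) 0 ^ p - max y 0 ^ p - p * max y 0 ^ (p - 1) * h
      - 1 / 2 * (p * (p - 1) * max y 0 ^ (p - 2)) * h ^ 2)
    (f' := fun h => p * max (y + h) 0 ^ (p - 1) - p * max y 0 ^ (p - 1)
      - p * (p - 1) * max y 0 ^ (p - 2) * h) (K := p * (p - 1)) (q := p - 1) hp1 (by linarith)
    (by simp) (fun h => by
      have h2 := (((hd p (by linarith) h).sub_const (max y 0 ^ p)).sub
        ((hasDerivAt_id h).const_mul (p * max y 0 ^ (p - 1)))).sub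
          ((hasDerivAt_pow 2 h).const_mul (1 / 2 * (p * (p - 1) * max y 0 ^ (p - 2))))
      refine h2.congr_deriv ?_
      simp
      ring) h1 h
  rwa [show p - 1 + 1 = p by ring] at this

end PositivePart

section Excess

variable {D : ℕ}

lemma excess_eq {p t : ℝ} (hp : 2 < p) (ht : 0 ≤ t) (y : ℝ) :
    max (|y| - t) 0 ^ p = max (y - t) 0 ^ p + max (-y - t) 0 ^ p := by
  have h0 : (0 : ℝ) ^ p = 0 := Real.zero_rpow (by linarith)
  rcases le_total 0 y with hy | hy
  · rw [abs_of_nonneg hy, max_eq_right (by linarith : -y - t ≤ 0), h0, add_zero]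
  · rw [abs_of_nonpos hy, max_eq_right (by linarith : y - t ≤ 0), h0, zero_add]

lemma exists_hasTaylor_excess {p t : ℝ} (hp : 2 < p) (hp3 : p ≤ 3) (ht : 0 ≤ t) (i : Fin D) :
    ∃ G H, HasTaylor p (2 * (p * (p - 1)))
      (fun x : EuclideanSpace ℝ (Fin D) => max (|x i| - t) 0 ^ p) G H := by
  refine ⟨fun x j => if j = i then p * max (x i - t) 0 ^ (p - 1)
      - p * max (-x i - t) 0 ^ (p - 1) else 0,
    fun x j k => if j = i then (if k = i then p * (p - 1) * max (x i - t) 0 ^ (p - 2)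
      + p * (p - 1) * max (-x i - t) 0 ^ (p - 2) else 0) else 0, ?_, ?_, ?_, ?_, ?_, ?_⟩
  · have : 0 ≤ p * (p - 1) := mul_nonneg (by linarith) (by linarith)
    linarith
  · fun_prop
  · refine measurable_pi_lambda _ fun j => ?_
    split_ifs <;> fun_prop
  · refine measurable_pi_lambda _ fun j => measurable_pi_lambda _ fun k => ?_
    split_ifs <;> fun_prop
  · intro x j k
    split_ifs <;> rfl
  · intro x h
    have h1 := abs_max_zero_rpow_taylor_le hp hp3 (x i - t) (h i)
    have h2 := abs_max_zero_rpow_taylor_le hp hp3 (-x i - t) (-h i)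
    have h3 : |h i| ^ p ≤ ‖h‖ ^ p := by
      gcongr
      simpa using PiLp.norm_apply_le h i
    have hpp : 0 ≤ p * (p - 1) := mul_nonneg (by linarith) (by linarith)
    have h4 := mul_le_mul_of_nonneg_left h3 hpp
    rw [abs_neg] at h2
    simp only [excess_eq hp ht, quadVal]
    simp only [ite_mul, zero_mul, Finset.sum_ite_eq', Finset.mem_univ, if_true, PiLp.add_apply,
      Finset.sum_ite_irrel, Finset.sum_const_zero]
    have e1 : x i + h i - t = x i - t + h i := by ring
    have e2 : -(x i + h i) - t = -x i - t + -h i := by ring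
    rw [e1, e2]
    rw [abs_le] at *
    constructor <;> linarith [h1.1, h1.2, h2.1, h2.2]

end Excess

section Gaussian

variable {D : ℕ} {S : Matrix (Fin D) (Fin D) ℝ} {γ : Measure (EuclideanSpace ℝ (Fin D))}

lemma IsCenteredGaussianCov.eq_multivariateGaussian (hγ : IsCenteredGaussianCov D S γ)
    (hS : S.PosSemidef) : γ = multivariateGaussian 0 S := by
  have := hγ.1
  refine Measure.ext_of_charFun ?_
  ext t
  rw [charFun_multivariateGaussian hS]
  have h1 := hγ.2 (fun i => t i)
  have h2 : charFun γ t = charFun (Measure.map (fun x => ∑ i, t i * x i) γ) 1 := by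
    rw [charFun_apply, charFun_apply, integral_map (by fun_prop) (by fun_prop)]
    congr 1
    ext x
    congr 3
    simp [PiLp.inner_apply]
  have h3 : (t : Fin D → ℝ) ⬝ᵥ S.mulVec t = ∑ i, ∑ j, t i * S i j * t j := by
    simp only [dotProduct, Matrix.mulVec, Finset.mul_sum, mul_assoc]
  have h4 : 0 ≤ ∑ i, ∑ j, t i * S i j * t j := by
    rw [← h3]
    simpa using hS.dotProduct_mulVec_nonneg t
  rw [h2, h1, charFun_gaussianReal, h3]
  congr 1
  rw [Real.coe_toNNReal _ h4]
  push_cast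
  simp

lemma integral_cexp_add_inner_stdGaussian (u t : EuclideanSpace ℝ (Fin D)) :
    ∫ y, Complex.exp (inner ℝ u y + inner ℝ t y * Complex.I)
      ∂(stdGaussian (EuclideanSpace ℝ (Fin D)))
      = Complex.exp (∑ i, ((u i : ℂ) + t i * Complex.I) ^ 2 / 2) := by
  rw [← map_pi_eq_stdGaussian, integral_map (by fun_prop)
    (by exact Measurable.aestronglyMeasurable (by fun_prop))]
  have h1 : ∀ x : Fin D → ℝ, Complex.exp (inner ℝ u (WithLp.toLp 2 x) +
      inner ℝ t (WithLp.toLp 2 x) * Complex.I)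
      = ∏ i, Complex.exp (((u i : ℂ) + t i * Complex.I) * x i) := by
    intro x
    rw [← Complex.exp_sum]
    congr 1
    simp only [PiLp.inner_apply]
    push_cast
    rw [Finset.sum_mul, ← Finset.sum_add_distrib]
    refine Finset.sum_congr rfl fun i _ => ?_
    simp
    ring
  simp_rw [h1]
  rw [integral_fintype_prod_eq_prod
    (fun i (x : ℝ) => Complex.exp (((u i : ℂ) + t i * Complex.I) * x)),
    Complex.exp_sum]
  refine Finset.prod_congr rfl fun i _ => ?_
  have := complexMGF_id_gaussianReal (μ := 0) (v := 1) ((u i : ℂ) + t i * Complex.I)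
  rw [complexMGF] at this
  simpa using this

/-- The Cameron-Martin formula for the standard Gaussian measure. -/
lemma integral_add_stdGaussian (f : EuclideanSpace ℝ (Fin D) → ℝ) (hf : Measurable f)
    (u : EuclideanSpace ℝ (Fin D)) :
    ∫ y, f (y + u) ∂(stdGaussian (EuclideanSpace ℝ (Fin D)))
      = ∫ y, f y * Real.exp (inner ℝ u y - ‖u‖ ^ 2 / 2)
        ∂(stdGaussian (EuclideanSpace ℝ (Fin D))) := by
  set ν := stdGaussian (EuclideanSpace ℝ (Fin D))
  have hmeas : Measurable fun y : EuclideanSpace ℝ (Fin D) =>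
    (Real.exp (inner ℝ u y - ‖u‖ ^ 2 / 2)).toNNReal := by fun_prop
  have hintc : Integrable (fun y => Complex.exp (inner ℝ u y)) ν := by
    by_contra h
    have := integral_cexp_add_inner_stdGaussian u 0
    simp only [inner_zero_left, Complex.ofReal_zero, zero_mul, add_zero] at this
    rw [integral_undef h] at this
    exact Complex.exp_ne_zero _ this.symm
  have hint : Integrable (fun y => Real.exp (inner ℝ u y - ‖u‖ ^ 2 / 2)) ν := by
    have := hintc.norm
    simp only [Complex.norm_exp, Complex.ofReal_re] at this
    simp_rw [Real.exp_sub]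
    exact this.div_const _
  have hfin : IsFiniteMeasure (ν.withDensity fun y =>
      (((Real.exp (inner ℝ u y - ‖u‖ ^ 2 / 2)).toNNReal : ℝ≥0) : ℝ≥0∞)) :=
    isFiniteMeasure_withDensity_ofReal hint.2
  have key : ν.map (fun y => y + u) = ν.withDensity fun y =>
      (((Real.exp (inner ℝ u y - ‖u‖ ^ 2 / 2)).toNNReal : ℝ≥0) : ℝ≥0∞) := by
    have : IsProbabilityMeasure (ν.map (fun y => y + u)) :=
      Measure.isProbabilityMeasure_map (by fun_prop)
    refine Measure.ext_of_charFun ?_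
    ext t
    rw [charFun_apply, charFun_apply, integral_map (by fun_prop)
      (by exact Measurable.aestronglyMeasurable (by fun_prop)),
      integral_withDensity_eq_integral_smul hmeas]
    have e1 : ∀ y : EuclideanSpace ℝ (Fin D), Complex.exp (inner ℝ (y + u) t * Complex.I)
        = Complex.exp (inner ℝ u t * Complex.I) *
          Complex.exp (inner ℝ (0 : EuclideanSpace ℝ (Fin D)) y + inner ℝ t y * Complex.I) := by
      intro y
      rw [← Complex.exp_add, inner_add_left, inner_zero_left, real_inner_comm t y]
      congr 1
      push_cast
      ring
    have e2 : ∀ y : EuclideanSpace ℝ (Fin D),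
        (Real.exp (inner ℝ u y - ‖u‖ ^ 2 / 2)).toNNReal • Complex.exp (inner ℝ y t * Complex.I)
        = Complex.exp (-‖u‖ ^ 2 / 2) *
          Complex.exp (inner ℝ u y + inner ℝ t y * Complex.I) := by
      intro y
      rw [NNReal.smul_def, Real.coe_toNNReal _ (Real.exp_pos _).le, Complex.real_smul,
        Complex.ofReal_exp, ← Complex.exp_add, ← Complex.exp_add, real_inner_comm t y]
      congr 1
      push_cast
      ring
    simp_rw [e1, e2]
    rw [integral_const_mul, integral_const_mul, integral_cexp_add_inner_stdGaussian,
      integral_cexp_add_inner_stdGaussian, ← Complex.exp_add, ← Complex.exp_add]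
    congr 1
    have e3 : (‖u‖ : ℂ) ^ 2 = ∑ i, (u i : ℂ) ^ 2 := by
      rw [← Complex.ofReal_pow, EuclideanSpace.real_norm_sq_eq]
      push_cast
      rfl
    rw [e3]
    simp only [PiLp.inner_apply]
    push_cast
    rw [neg_div, Finset.sum_div, ← Finset.sum_neg_distrib, Finset.sum_mul,
      ← Finset.sum_add_distrib, ← Finset.sum_add_distrib]
    refine Finset.sum_congr rfl fun i _ => ?_
    simp
    ring
  rw [← integral_map (φ := fun y => y + u) (f := f) (by fun_prop) hf.aestronglyMeasurable, key,
    integral_withDensity_eq_integral_smul hmeas]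
  refine integral_congr_ae (ae_of_all _ fun y => ?_)
  simp only [NNReal.smul_def, Real.coe_toNNReal _ (Real.exp_pos _).le, smul_eq_mul]
  ring

end Gaussian

section Moments

variable {Ω : Type*} [MeasurableSpace Ω] {P : Measure Ω} [IsFiniteMeasure P]

lemma MeasureTheory.MemLp.integrable_norm_rpow_of_le {E : Type*} [NormedAddCommGroup E] {X : Ω → E}
    {p q : ℝ} (hX : MemLp X (ENNReal.ofReal p) P) (hq : 0 ≤ q) (hqp : q ≤ p) :
    Integrable (fun ω => ‖X ω‖ ^ q) P := by
  rcases hq.eq_or_lt with rfl | hq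
  · simp
  have h := (hX.mono_exponent (ENNReal.ofReal_le_ofReal hqp)).integrable_norm_rpow
    (by simpa using hq) ENNReal.ofReal_ne_top
  simpa [ENNReal.toReal_ofReal hq.le] using h

lemma MeasureTheory.MemLp.integrable_one_add_norm_rpow {E : Type*} [NormedAddCommGroup E]
    {X : Ω → E} {p q : ℝ} (hX : MemLp X (ENNReal.ofReal p) P) (hq : 0 ≤ q) (hqp : q ≤ p) :
    Integrable (fun ω => (1 + ‖X ω‖) ^ q) P := by
  have h : MemLp (fun ω => 1 + ‖X ω‖) (ENNReal.ofReal p) P :=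
    (memLp_const (1 : ℝ)).add hX.norm
  refine (h.integrable_norm_rpow_of_le hq hqp).congr (ae_of_all _ fun ω => ?_)
  simp only [Real.norm_eq_abs]
  rw [abs_of_nonneg (by positivity)]

lemma ProbabilityTheory.IsGaussian.integrable_one_add_norm_rpow {E : Type*} [NormedAddCommGroup E]
    [NormedSpace ℝ E] [MeasurableSpace E] [BorelSpace E] [CompleteSpace E]
    [SecondCountableTopology E] (γ : Measure E) [IsGaussian γ] {q : ℝ} (hq : 0 ≤ q) :
    Integrable (fun y => (1 + ‖y‖) ^ q) γ :=
  (IsGaussian.memLp_id γ (ENNReal.ofReal q) ENNReal.ofReal_ne_top).integrable_one_add_norm_rpow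
    hq le_rfl

end Moments

section Semigroup

variable {D : ℕ} {S : Matrix (Fin D) (Fin D) ℝ} {γ : Measure (EuclideanSpace ℝ (Fin D))}

lemma map_add_smul_prod_multivariateGaussian (hS : S.PosSemidef) {a b c : ℝ}
    (habc : a ^ 2 + b ^ 2 = c ^ 2) :
    ((multivariateGaussian 0 S).prod (multivariateGaussian 0 S)).map
      (fun z : EuclideanSpace ℝ (Fin D) × EuclideanSpace ℝ (Fin D) => a • z.1 + b • z.2)
      = (multivariateGaussian 0 S).map (fun y => c • y) := by
  have h1 : ((multivariateGaussian 0 S).prod (multivariateGaussian 0 S)).map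
      (fun z : EuclideanSpace ℝ (Fin D) × EuclideanSpace ℝ (Fin D) => a • z.1 + b • z.2)
      = ((multivariateGaussian 0 S).map (fun y => a • y)).conv
        ((multivariateGaussian 0 S).map (fun y => b • y)) := by
    rw [Measure.conv, Measure.map_prod_map _ _ (by fun_prop) (by fun_prop),
      Measure.map_map (by fun_prop) (by fun_prop)]
    rfl
  rw [h1]
  have : IsProbabilityMeasure ((multivariateGaussian 0 S).map (fun y => a • y)) :=
    Measure.isProbabilityMeasure_map (by fun_prop)
  have : IsProbabilityMeasure ((multivariateGaussian 0 S).map (fun y => b • y)) :=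
    Measure.isProbabilityMeasure_map (by fun_prop)
  have : IsProbabilityMeasure ((multivariateGaussian 0 S).map (fun y => c • y)) :=
    Measure.isProbabilityMeasure_map (by fun_prop)
  refine Measure.ext_of_charFun ?_
  ext t
  have h2 : ((c : ℂ)) ^ 2 = a ^ 2 + b ^ 2 := by exact_mod_cast habc.symm
  rw [charFun_conv, charFun_map_smul, charFun_map_smul, charFun_map_smul,
    charFun_multivariateGaussian hS, charFun_multivariateGaussian hS,
    charFun_multivariateGaussian hS, ← Complex.exp_add]
  congr 1
  simp only [inner_zero_right, WithLp.ofLp_smul, Matrix.mulVec_smul,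
    dotProduct_smul, smul_dotProduct, smul_eq_mul]
  push_cast
  linear_combination (((t.ofLp ⬝ᵥ S.mulVec t.ofLp : ℝ) : ℂ) / 2) * h2

lemma integral_integral_multivariateGaussian (hS : S.PosSemidef)
    (hγ : γ = multivariateGaussian 0 S) {a b c : ℝ} (habc : a ^ 2 + b ^ 2 = c ^ 2)
    {f : EuclideanSpace ℝ (Fin D) → ℝ} (hf : Measurable f) {K q : ℝ} (hq : 0 ≤ q)
    (hK : ∀ x, |f x| ≤ K * (1 + ‖x‖) ^ q) (x : EuclideanSpace ℝ (Fin D)) :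
    ∫ y, ∫ z, f (x + a • y + b • z) ∂γ ∂γ = ∫ y, f (x + c • y) ∂γ := by
  subst hγ
  set γ := multivariateGaussian 0 S with hγ
  have h1 := map_add_smul_prod_multivariateGaussian hS habc
  have hm : Measurable (fun z : EuclideanSpace ℝ (Fin D) × EuclideanSpace ℝ (Fin D) =>
    a • z.1 + b • z.2) := by fun_prop
  have hfx : Measurable fun y => f (x + y) := hf.comp (measurable_const_add x)
  have hint : Integrable (fun y => f (x + c • y)) γ := by
    have := ((memLp_const (α := EuclideanSpace ℝ (Fin D)) (μ := γ) x).add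
      ((IsGaussian.memLp_id γ (ENNReal.ofReal q) ENNReal.ofReal_ne_top).const_smul c))
    have := (this.integrable_one_add_norm_rpow hq le_rfl).const_mul K
    refine this.mono' (by exact (hfx.comp (measurable_const_smul c)).aestronglyMeasurable)
      (ae_of_all _ fun y => ?_)
    exact hK _
  have hint2 : Integrable (fun z : EuclideanSpace ℝ (Fin D) × EuclideanSpace ℝ (Fin D) =>
      f (x + (a • z.1 + b • z.2))) (γ.prod γ) := by
    have h3 : Integrable (fun y => f (x + y)) (γ.map (fun y => c • y)) := by
      rw [integrable_map_measure hfx.aestronglyMeasurable (by fun_prop)]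
      exact hint
    rw [← h1, integrable_map_measure hfx.aestronglyMeasurable (by fun_prop)] at h3
    exact h3
  have h2 := integral_prod _ hint2
  simp only [add_assoc]
  rw [← h2]
  rw [← integral_map (φ := fun y => c • y) (f := fun y => f (x + y)) (by fun_prop)
    hfx.aestronglyMeasurable, ← h1, integral_map hm.aemeasurable hfx.aestronglyMeasurable]

lemma integral_apply_multivariateGaussian_zero (i : Fin D) :
    ∫ y, y i ∂(multivariateGaussian 0 S) = 0 := by
  have h := (EuclideanSpace.proj (𝕜 := ℝ) i).integral_comp_comm
    (IsGaussian.integrable_id (μ := multivariateGaussian 0 S))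
  simpa using h

lemma integral_mul_apply_multivariateGaussian_zero (hS : S.PosSemidef) (i j : Fin D) :
    ∫ y, y i * y j ∂(multivariateGaussian 0 S) = S i j := by
  have h := covariance_eval_multivariateGaussian (μ := 0) hS i j
  rw [covariance, integral_apply_multivariateGaussian_zero,
    integral_apply_multivariateGaussian_zero] at h
  simpa using h

open scoped MatrixOrder in
lemma exists_sqrt_of_posSemidef (hS : S.PosSemidef) :
    ∃ A : EuclideanSpace ℝ (Fin D) →L[ℝ] EuclideanSpace ℝ (Fin D),
      (∀ u v, inner ℝ (A u) v = inner ℝ u (A v)) ∧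
      (∀ u, ‖A u‖ ^ 2 = ∑ i, ∑ j, S i j * (u i * u j)) ∧
      multivariateGaussian 0 S = (stdGaussian (EuclideanSpace ℝ (Fin D))).map A := by
  set A := Matrix.toEuclideanCLM (𝕜 := ℝ) (CFC.sqrt S) with hA
  have hsa : IsSelfAdjoint A := (CFC.sqrt_nonneg S).isSelfAdjoint.map _
  have hadj : ∀ u v, inner ℝ (A u) v = inner ℝ u (A v) := fun u v => by
    conv_lhs => rw [← hsa.adjoint_eq]
    rw [ContinuousLinearMap.adjoint_inner_left]
  refine ⟨A, hadj, fun u => ?_, ?_⟩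
  · rw [← real_inner_self_eq_norm_sq, hadj, ← mul_apply_eq_comp, hA, ← map_mul,
      CFC.sqrt_mul_sqrt_self _ hS.nonneg, Matrix.inner_toEuclideanCLM]
    simp only [dotProduct, Matrix.mulVec, Finset.mul_sum]
    exact Finset.sum_congr rfl fun i _ => Finset.sum_congr rfl fun j _ => by ring
  · simp [multivariateGaussian, hA]

end Semigroup

section Growth

variable {Ω : Type*} [MeasurableSpace Ω] {P : Measure Ω} [IsFiniteMeasure P] {D : ℕ}

lemma integrable_comp_of_growth {X : Ω → EuclideanSpace ℝ (Fin D)} {p q K : ℝ}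
    {f : EuclideanSpace ℝ (Fin D) → ℝ} (hX : MemLp X (ENNReal.ofReal p) P) (hf : Measurable f)
    (hq : 0 ≤ q) (hqp : q ≤ p) (hK : ∀ x, |f x| ≤ K * (1 + ‖x‖) ^ q) :
    Integrable (fun ω => f (X ω)) P :=
  ((hX.integrable_one_add_norm_rpow hq hqp).const_mul K).mono'
    (hf.comp_aemeasurable hX.1.aemeasurable).aestronglyMeasurable (ae_of_all _ fun _ => hK _)

variable {p w : ℝ} {F : EuclideanSpace ℝ (Fin D) → ℝ}
  {G : EuclideanSpace ℝ (Fin D) → Fin D → ℝ} {H : EuclideanSpace ℝ (Fin D) → Fin D → Fin D → ℝ}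

namespace HasTaylor

lemma integrable_comp (hT : HasTaylor p w F G H) (hp : 2 < p) (hp3 : p ≤ 3)
    {X : Ω → EuclideanSpace ℝ (Fin D)} (hX : MemLp X (ENNReal.ofReal p) P) :
    Integrable (fun ω => F (X ω)) P ∧ (∀ i, Integrable (fun ω => G (X ω) i) P) ∧
      ∀ i j, Integrable (fun ω => H (X ω) i j) P := by
  obtain ⟨K, hK, hF, hG, hH⟩ := hT.exists_growth hp hp3
  have h1 := hT.measF
  have h2 := hT.measG
  have h3 := hT.measH
  exact ⟨integrable_comp_of_growth hX h1 (by linarith) le_rfl hF,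
    fun i => integrable_comp_of_growth hX (by fun_prop) (by linarith) (by linarith)
      fun x => hG x i,
    fun i j => integrable_comp_of_growth hX (by fun_prop) (by linarith) (by linarith)
      fun x => hH x i j⟩

lemma average (hT : HasTaylor p w F G H) (hp : 2 < p) (hp3 : p ≤ 3)
    (γ : Measure (EuclideanSpace ℝ (Fin D))) [IsGaussian γ] (c : ℝ) :
    HasTaylor p w (fun x => ∫ y, F (x + c • y) ∂γ) (fun x i => ∫ y, G (x + c • y) i ∂γ)
      (fun x i j => ∫ y, H (x + c • y) i j ∂γ) := by
  have hX : ∀ x, MemLp (fun y => x + c • y) (ENNReal.ofReal p) γ := fun x =>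
    (memLp_const x).add ((IsGaussian.memLp_id γ _ ENNReal.ofReal_ne_top).const_smul c)
  have hI := fun x => hT.integrable_comp hp hp3 (hX x)
  have h1 := hT.measF
  have h2 := hT.measG
  have h3 := hT.measH
  have hm : ∀ f : EuclideanSpace ℝ (Fin D) → ℝ, Measurable f →
      Measurable fun x => ∫ y, f (x + c • y) ∂γ := fun f hf =>
    (StronglyMeasurable.integral_prod_right'
      (f := fun z : EuclideanSpace ℝ (Fin D) × EuclideanSpace ℝ (Fin D) => f (z.1 + c • z.2))
      (by exact (hf.comp (by fun_prop)).stronglyMeasurable)).measurable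
  refine ⟨hT.nonneg, hm F h1, measurable_pi_lambda _ fun i => hm (fun x => G x i) (by fun_prop),
    measurable_pi_lambda _ fun i => measurable_pi_lambda _ fun j =>
      hm (fun x => H x i j) (by fun_prop), fun x i j => ?_, fun x h => ?_⟩
  · simp_rw [hT.symm _ i j]
  have e : ∫ y, F (x + h + c • y) ∂γ - ∫ y, F (x + c • y) ∂γ - ∑ i, (∫ y, G (x + c • y) i ∂γ) * h i
      - 1 / 2 * quadVal (fun i j => ∫ y, H (x + c • y) i j ∂γ) h
      = ∫ y, (F (x + c • y + h) - F (x + c • y) - ∑ i, G (x + c • y) i * h i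
        - 1 / 2 * quadVal (H (x + c • y)) h) ∂γ := by
    have i1 : Integrable (fun y => F (x + c • y + h)) γ := by
      simpa only [add_right_comm] using (hI (x + h)).1
    have i2 : Integrable (fun y => ∑ i, G (x + c • y) i * h i) γ :=
      integrable_finsetSum _ fun i _ => ((hI x).2.1 i).mul_const _
    have i3 : Integrable (fun y => 1 / 2 * quadVal (H (x + c • y)) h) γ :=
      (integrable_finsetSum _ fun i _ => integrable_finsetSum _ fun j _ =>
        ((hI x).2.2 i j).mul_const _).const_mul _
    have i4 : Integrable (fun y => F (x + c • y + h) - F (x + c • y)) γ := i1.sub (hI x).1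
    have i5 : Integrable (fun y => F (x + c • y + h) - F (x + c • y)
      - ∑ i, G (x + c • y) i * h i) γ := i4.sub i2
    rw [integral_sub i5 i3, integral_sub i4 i2, integral_sub i1 (hI x).1, integral_const_mul,
      integral_finsetSum _ fun i _ => ((hI x).2.1 i).mul_const _]
    simp only [quadVal]
    rw [integral_finsetSum _ fun i _ => integrable_finsetSum _ fun j _ =>
        ((hI x).2.2 i j).mul_const _]
    simp_rw [fun i => integral_finsetSum (μ := γ) Finset.univ
      fun j _ => ((hI x).2.2 i j).mul_const (h i * h j), integral_mul_const, add_right_comm]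
  rw [e, ← Real.norm_eq_abs]
  refine (norm_integral_le_of_norm_le_const (C := w * ‖h‖ ^ p) (ae_of_all _ fun y => ?_)).trans ?_
  · exact hT.bound _ _
  · simp

lemma comp_linear (hT : HasTaylor p w F G H) (hp : 0 < p)
    (L : EuclideanSpace ℝ (Fin D) →L[ℝ] EuclideanSpace ℝ (Fin D)) :
    ∃ G' H', HasTaylor p (w * ‖L‖ ^ p) (fun x => F (L x)) G' H' := by
  have h1 := hT.measF
  have h2 := hT.measG
  have h3 := hT.measH
  set l : Fin D → Fin D → ℝ := fun a i => L (EuclideanSpace.single i 1) a with hl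
  have hL : ∀ (h : EuclideanSpace ℝ (Fin D)) a, L h a = ∑ i, l a i * h i := by
    intro h a
    have : h = ∑ i, h i • EuclideanSpace.single i (1 : ℝ) := by
      ext j
      simp [Pi.single_apply]
    conv_lhs => rw [this]
    simp [hl, mul_comm]
  refine ⟨fun x i => ∑ a, G (L x) a * l a i, fun x i j => ∑ a, ∑ b, H (L x) a b * (l a i * l b j),
    mul_nonneg hT.nonneg (by positivity), h1.comp L.measurable,
    measurable_pi_lambda _ fun i => Finset.measurable_sum _ fun a _ => ?_,
    measurable_pi_lambda _ fun i => measurable_pi_lambda _ fun j =>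
      Finset.measurable_sum _ fun a _ => Finset.measurable_sum _ fun b _ => ?_,
    fun x i j => ?_, fun x h => ?_⟩
  · have := L.measurable
    fun_prop
  · have := L.measurable
    fun_prop
  · rw [Finset.sum_comm]
    exact Finset.sum_congr rfl fun a _ => Finset.sum_congr rfl fun b _ => by
      rw [hT.symm _ b a]; ring
  · have := hT.bound (L x) (L h)
    have e1 : ∑ i, (∑ a, G (L x) a * l a i) * h i = ∑ i, G (L x) i * L h i := by
      simp only [hL, Finset.sum_mul, Finset.mul_sum, mul_assoc]
      rw [Finset.sum_comm]
    have e2 : quadVal (fun i j => ∑ a, ∑ b, H (L x) a b * (l a i * l b j)) h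
        = quadVal (H (L x)) (L h) := by
      simp only [quadVal, hL, Finset.sum_mul_sum]
      simp only [Finset.sum_mul, Finset.mul_sum]
      calc _ = ∑ i, ∑ a, ∑ j, ∑ b, H (L x) a b * (l a i * l b j) * (h i * h j) :=
            Finset.sum_congr rfl fun i _ => Finset.sum_comm
        _ = ∑ a, ∑ i, ∑ j, ∑ b, H (L x) a b * (l a i * l b j) * (h i * h j) := Finset.sum_comm
        _ = ∑ a, ∑ i, ∑ b, ∑ j, H (L x) a b * (l a i * l b j) * (h i * h j) :=
            Finset.sum_congr rfl fun a _ => Finset.sum_congr rfl fun i _ => Finset.sum_comm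
        _ = ∑ a, ∑ b, ∑ i, ∑ j, H (L x) a b * (l a i * l b j) * (h i * h j) :=
            Finset.sum_congr rfl fun a _ => Finset.sum_comm
        _ = _ := Finset.sum_congr rfl fun a _ => Finset.sum_congr rfl fun b _ =>
            Finset.sum_congr rfl fun i _ => Finset.sum_congr rfl fun j _ => by ring
    rw [e1, e2, map_add]
    refine this.trans ?_
    rw [mul_assoc, ← Real.mul_rpow (norm_nonneg _) (norm_nonneg _)]
    have := hT.nonneg
    gcongr
    exact L.le_opNorm h

end HasTaylor

end Growth

section Smoothing

lemma abs_exp_sub_cubic_le (z : ℝ) : |Real.exp z - 1 - z - z ^ 2 / 2| ≤ |z| ^ 3 * Real.exp |z| := by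
  have h := Complex.norm_exp_sub_sum_le_norm_mul_exp (z : ℂ) 3
  have e : Complex.exp z - ∑ m ∈ Finset.range 3, (z : ℂ) ^ m / (m.factorial : ℂ)
      = ((Real.exp z - 1 - z - z ^ 2 / 2 : ℝ) : ℂ) := by
    simp [Finset.sum_range_succ, Nat.factorial]
    ring
  rw [e, Complex.norm_real, Complex.norm_real, Real.norm_eq_abs, Real.norm_eq_abs] at h
  exact h

lemma exists_integral_exp_linear_of_isGaussian {E : Type*} [NormedAddCommGroup E]
    [NormedSpace ℝ E] [MeasurableSpace E] [BorelSpace E] [CompleteSpace E]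
    [SecondCountableTopology E] (γ : Measure E) [IsGaussian γ] (a b : ℝ) :
    Integrable (fun y => Real.exp (a + b * ‖y‖)) γ := by
  obtain ⟨C, hC, hint⟩ := IsGaussian.exists_integrable_exp_sq γ
  refine (hint.const_mul (Real.exp (a + b ^ 2 / (4 * C)))).mono' (by fun_prop)
    (ae_of_all _ fun y => ?_)
  rw [Real.norm_of_nonneg (Real.exp_pos _).le, ← Real.exp_add]
  refine Real.exp_le_exp.2 ?_
  have : 0 ≤ C * (‖y‖ - b / (2 * C)) ^ 2 := by positivity
  have e : C * (‖y‖ - b / (2 * C)) ^ 2 = C * ‖y‖ ^ 2 - b * ‖y‖ + b ^ 2 / (4 * C) := by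
    field_simp
    ring
  linarith

variable {D : ℕ}

lemma quadVal_outer_sub_one (h y : EuclideanSpace ℝ (Fin D)) :
    quadVal (fun i j => y i * y j - if i = j then 1 else 0) h = inner ℝ h y ^ 2 - ‖h‖ ^ 2 := by
  simp only [quadVal, sub_mul, Finset.sum_sub_distrib]
  congr 1
  · rw [PiLp.inner_apply, sq, Finset.sum_mul_sum]
    refine Finset.sum_congr rfl fun i _ => Finset.sum_congr rfl fun j _ => ?_
    simp
    ring
  · rw [EuclideanSpace.real_norm_sq_eq]
    simp [sq]

lemma norm_gaussian_bracket_le {h y : EuclideanSpace ℝ (Fin D)} (hh : ‖h‖ ≤ 1) :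
    ‖y‖ * |Real.exp (inner ℝ h y - ‖h‖ ^ 2 / 2) - 1 - inner ℝ h y
      - 1 / 2 * (inner ℝ h y ^ 2 - ‖h‖ ^ 2)| ≤ 2 * ‖h‖ ^ 3 * Real.exp (1 + 5 * ‖y‖) := by
  set a := inner ℝ h y with ha
  set r := ‖h‖ with hr
  set t := ‖y‖ with ht
  have hr0 : 0 ≤ r := norm_nonneg _
  have ht0 : 0 ≤ t := norm_nonneg _
  have ha1 : |a| ≤ r * t := abs_real_inner_le_norm h y
  set z := a - r ^ 2 / 2 with hz
  have hz1 : |z| ≤ r * (1 + t) := by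
    have : |z| ≤ |a| + |r ^ 2 / 2| := abs_sub _ _
    rw [abs_of_nonneg (by positivity : 0 ≤ r ^ 2 / 2)] at this
    nlinarith
  have hz2 : |z| ≤ 1 + t := hz1.trans (by nlinarith)
  have h1 := abs_exp_sub_cubic_le z
  have h2 : |z| ^ 3 * Real.exp |z| ≤ (r * (1 + t)) ^ 3 * Real.exp (1 + t) := by gcongr
  have e : Real.exp z - 1 - a - 1 / 2 * (a ^ 2 - r ^ 2)
      = (Real.exp z - 1 - z - z ^ 2 / 2) + (- a * (r ^ 2 / 2) + r ^ 4 / 8) := by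
    rw [hz]; ring
  have h3 : |- a * (r ^ 2 / 2) + r ^ 4 / 8| ≤ r ^ 3 * (1 + t) := by
    refine (abs_add_le _ _).trans ?_
    rw [abs_mul, abs_neg, abs_of_nonneg (by positivity : 0 ≤ r ^ 2 / 2),
      abs_of_nonneg (by positivity : 0 ≤ r ^ 4 / 8)]
    have : r ^ 4 ≤ r ^ 3 := pow_le_pow_of_le_one hr0 hh (by norm_num)
    have h4 : |a| * (r ^ 2 / 2) ≤ r * t * (r ^ 2 / 2) := by gcongr
    have : 0 ≤ r ^ 3 := by positivity
    nlinarith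
  have ht1 : 1 + t ≤ Real.exp t := by linarith [Real.add_one_le_exp t]
  have ht2 : t ≤ Real.exp t := by linarith
  have hT : 1 ≤ Real.exp t := by linarith
  rw [e]
  calc t * |Real.exp z - 1 - z - z ^ 2 / 2 + (- a * (r ^ 2 / 2) + r ^ 4 / 8)|
      ≤ Real.exp t * ((r * Real.exp t) ^ 3 * Real.exp (1 + t) + r ^ 3 * Real.exp t) := by
        gcongr
        refine (abs_add_le _ _).trans (add_le_add (h1.trans (h2.trans ?_)) (h3.trans ?_)) <;> gcongr
    _ ≤ Real.exp t * ((r * Real.exp t) ^ 3 * Real.exp (1 + t)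
          + r ^ 3 * (Real.exp t ^ 3 * Real.exp (1 + t))) := by
        gcongr
        have : 1 ≤ Real.exp (1 + t) := Real.one_le_exp (by linarith)
        calc Real.exp t = Real.exp t ^ 1 * 1 := by ring
          _ ≤ Real.exp t ^ 3 * Real.exp (1 + t) := by
            gcongr
            norm_num
    _ = _ := by
        have : Real.exp (1 + 5 * t) = Real.exp t ^ 4 * Real.exp (1 + t) := by
          rw [← Real.exp_nat_mul, ← Real.exp_add]
          congr 1
          push_cast
          ring
        rw [this]
        ring

lemma exists_hasTaylor_smoothing_one {p : ℝ} (hp : 2 < p) (hp3 : p ≤ 3) :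
    ∃ C : ℝ, 0 ≤ C ∧ ∀ (K : ℝ≥0) (φ : EuclideanSpace ℝ (Fin D) → ℝ), LipschitzWith K φ →
      ∃ G H, HasTaylor p (K * C)
        (fun x => ∫ y, φ (x + y) ∂(stdGaussian (EuclideanSpace ℝ (Fin D)))) G H := by
  set ν := stdGaussian (EuclideanSpace ℝ (Fin D)) with hν
  have hW := exists_integral_exp_linear_of_isGaussian ν 1 5
  set I := ∫ y, Real.exp (1 + 5 * ‖y‖) ∂ν with hI
  have hI0 : 0 ≤ I := integral_nonneg fun y => (Real.exp_pos _).le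
  refine ⟨1 + 2 * I, by positivity, fun K φ hφ => ?_⟩
  have hφc := hφ.continuous
  set ψ : EuclideanSpace ℝ (Fin D) → EuclideanSpace ℝ (Fin D) → ℝ := fun x y => φ (x + y) - φ x
    with hψ
  have hψc : ∀ x, Continuous (ψ x) := fun x => by fun_prop
  have hψb : ∀ x y, |ψ x y| ≤ K * ‖y‖ := fun x y => by
    simpa [dist_eq_norm] using hφ.dist_le_mul (x + y) x
  have hexp : ∀ y : EuclideanSpace ℝ (Fin D), 1 + ‖y‖ ≤ Real.exp ‖y‖ := fun y => by
    linarith [Real.add_one_le_exp ‖y‖]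
  have hexp5 : ∀ y : EuclideanSpace ℝ (Fin D), (1 + ‖y‖) ^ 5 ≤ Real.exp (1 + 5 * ‖y‖) := fun y => by
    calc (1 + ‖y‖) ^ 5 ≤ Real.exp ‖y‖ ^ 5 := by gcongr; exact hexp y
      _ = Real.exp (5 * ‖y‖) := by rw [← Real.exp_nat_mul]; norm_num
      _ ≤ _ := by gcongr; linarith
  have hint : ∀ x (q : EuclideanSpace ℝ (Fin D) → ℝ) (c : ℝ), Continuous q →
      (∀ y, ‖y‖ * |q y| ≤ c * Real.exp (1 + 5 * ‖y‖)) →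
      Integrable (fun y => ψ x y * q y) ν ∧ |∫ y, ψ x y * q y ∂ν| ≤ K * c * I := by
    intro x q c hq hb
    have hb' : ∀ y, ‖ψ x y * q y‖ ≤ K * c * Real.exp (1 + 5 * ‖y‖) := by
      intro y
      rw [Real.norm_eq_abs, abs_mul]
      calc |ψ x y| * |q y| ≤ K * ‖y‖ * |q y| := by gcongr; exact hψb x y
        _ = K * (‖y‖ * |q y|) := by ring
        _ ≤ K * (c * Real.exp (1 + 5 * ‖y‖)) := mul_le_mul_of_nonneg_left (hb y) K.2
        _ = _ := by ring
    refine ⟨(hW.const_mul _).mono' ((hψc x).mul hq).aestronglyMeasurable (ae_of_all _ hb'), ?_⟩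
    rw [← Real.norm_eq_abs, hI, ← integral_const_mul]
    exact norm_integral_le_of_norm_le (hW.const_mul _) (ae_of_all _ hb')
  have hlin : ∀ h y : EuclideanSpace ℝ (Fin D),
      ‖y‖ * |inner ℝ h y| ≤ ‖h‖ * Real.exp (1 + 5 * ‖y‖) := by
    intro h y
    have hy := norm_nonneg y
    calc ‖y‖ * |inner ℝ h y| ≤ ‖y‖ * (‖h‖ * ‖y‖) := by gcongr; exact abs_real_inner_le_norm h y
      _ = ‖h‖ * ‖y‖ ^ 2 := by ring
      _ ≤ ‖h‖ * (1 + ‖y‖) ^ 5 := by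
        gcongr
        nlinarith [pow_nonneg hy 3, pow_nonneg hy 4, pow_nonneg hy 5, pow_nonneg hy 2]
      _ ≤ _ := by gcongr; exact hexp5 y
  have hquad : ∀ h y : EuclideanSpace ℝ (Fin D),
      ‖y‖ * |inner ℝ h y ^ 2 - ‖h‖ ^ 2| ≤ ‖h‖ ^ 2 * Real.exp (1 + 5 * ‖y‖) := by
    intro h y
    have hy := norm_nonneg y
    have h1 : inner ℝ h y ^ 2 ≤ (‖h‖ * ‖y‖) ^ 2 := by
      rw [← sq_abs]
      gcongr
      exact abs_real_inner_le_norm h y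
    have h2 : |inner ℝ h y ^ 2 - ‖h‖ ^ 2| ≤ ‖h‖ ^ 2 * (1 + ‖y‖ ^ 2) := by
      rw [abs_le]
      constructor <;> nlinarith [sq_nonneg (inner ℝ h y), sq_nonneg (‖h‖ * ‖y‖), sq_nonneg ‖h‖]
    calc ‖y‖ * |inner ℝ h y ^ 2 - ‖h‖ ^ 2| ≤ ‖y‖ * (‖h‖ ^ 2 * (1 + ‖y‖ ^ 2)) := by gcongr
      _ = ‖h‖ ^ 2 * (‖y‖ * (1 + ‖y‖ ^ 2)) := by ring
      _ ≤ ‖h‖ ^ 2 * (1 + ‖y‖) ^ 5 := by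
        gcongr
        nlinarith [pow_nonneg hy 3, pow_nonneg hy 4, pow_nonneg hy 5, pow_nonneg hy 2]
      _ ≤ _ := by gcongr; exact hexp5 y
  have hco : ∀ (y : EuclideanSpace ℝ (Fin D)) i, |y i| ≤ ‖y‖ := fun y i => by
    simpa using PiLp.norm_apply_le y i
  have hi1 : ∀ x i, Integrable (fun y => ψ x y * y i) ν := fun x i =>
    (hint x (fun y => y i) 1 (by fun_prop) fun y => by
      have := hlin (EuclideanSpace.single i 1) y
      simpa [EuclideanSpace.inner_single_left] using this).1
  have hi2 : ∀ x i j, Integrable (fun y => ψ x y * (y i * y j - if i = j then 1 else 0)) ν :=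
    fun x i j => (hint x (fun y => y i * y j - if i = j then 1 else 0) 1 (by fun_prop) fun y => by
      have hy := norm_nonneg y
      have h1 : |y i * y j - if i = j then (1 : ℝ) else 0| ≤ ‖y‖ ^ 2 + 1 := by
        refine (abs_sub _ _).trans ?_
        rw [abs_mul, sq]
        have := hco y i
        have := hco y j
        gcongr
        split_ifs <;> simp
      calc ‖y‖ * |y i * y j - if i = j then 1 else 0| ≤ ‖y‖ * (‖y‖ ^ 2 + 1) := by gcongr
        _ ≤ (1 + ‖y‖) ^ 5 := by
          nlinarith [pow_nonneg hy 3, pow_nonneg hy 4, pow_nonneg hy 5, pow_nonneg hy 2]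
        _ ≤ _ := by rw [one_mul]; exact hexp5 y).1
  have hi0 : ∀ x, Integrable (ψ x) ν := fun x => by
    have := (hint x (fun _ => 1) 1 (by fun_prop) fun y => by
      have hy := norm_nonneg y
      rw [abs_one, mul_one, one_mul]
      refine le_trans ?_ (hexp5 y)
      nlinarith [pow_nonneg hy 3, pow_nonneg hy 4, pow_nonneg hy 5, pow_nonneg hy 2]).1
    simpa using this
  have hF : ∀ x, ∫ y, φ (x + y) ∂ν = φ x + ∫ y, ψ x y ∂ν := by
    intro x
    have : ∀ y, φ (x + y) = φ x + ψ x y := fun y => by simp [hψ]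
    simp_rw [this]
    rw [integral_add (integrable_const _) (hi0 x)]
    simp
  have hm : ∀ q : EuclideanSpace ℝ (Fin D) → ℝ, Continuous q →
      Measurable fun x => ∫ y, ψ x y * q y ∂ν := fun q hq =>
    (StronglyMeasurable.integral_prod_right'
      (f := fun z : EuclideanSpace ℝ (Fin D) × EuclideanSpace ℝ (Fin D) => ψ z.1 z.2 * q z.2)
      (by exact Continuous.stronglyMeasurable (by fun_prop))).measurable
  have hlip : ∀ x h, |∫ y, φ (x + h + y) ∂ν - ∫ y, φ (x + y) ∂ν| ≤ K * ‖h‖ := by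
    intro x h
    have hc : ∀ x, Integrable (fun y => φ (x + y)) ν := fun x => by
      have := (integrable_const (μ := ν) (φ x)).add (hi0 x)
      refine this.congr (ae_of_all _ fun y => ?_)
      simp [hψ]
    rw [← integral_sub (hc _) (hc _), ← Real.norm_eq_abs]
    refine (norm_integral_le_of_norm_le_const (C := K * ‖h‖) (ae_of_all _ fun y => ?_)).trans
      (by simp)
    have := hφ.dist_le_mul (x + h + y) (x + y)
    rw [dist_eq_norm, dist_eq_norm] at this
    refine this.trans (le_of_eq ?_)
    congr 2
    abel
  refine ⟨fun x i => ∫ y, ψ x y * y i ∂ν,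
    fun x i j => ∫ y, ψ x y * (y i * y j - if i = j then 1 else 0) ∂ν, by positivity, ?_,
    measurable_pi_lambda _ fun i => hm _ (by fun_prop),
    measurable_pi_lambda _ fun i => measurable_pi_lambda _ fun j => hm _ (by fun_prop),
    fun x i j => ?_, fun x h => ?_⟩
  · simp_rw [hF]
    have := hm (fun _ => 1) (by fun_prop)
    simp only [mul_one] at this
    exact hφc.measurable.add this
  · refine integral_congr_ae (ae_of_all _ fun y => ?_)
    simp only [mul_comm (y i), eq_comm (a := i)]
  have eG : ∑ i, (∫ y, ψ x y * y i ∂ν) * h i = ∫ y, ψ x y * inner ℝ h y ∂ν := by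
    simp_rw [← integral_mul_const]
    rw [← integral_finsetSum _ fun i _ => (hi1 x i).mul_const _]
    refine integral_congr_ae (ae_of_all _ fun y => ?_)
    simp only [PiLp.inner_apply, Finset.mul_sum]
    refine Finset.sum_congr rfl fun i _ => ?_
    simp
    ring
  have eH : quadVal (fun i j => ∫ y, ψ x y * (y i * y j - if i = j then 1 else 0) ∂ν) h
      = ∫ y, ψ x y * (inner ℝ h y ^ 2 - ‖h‖ ^ 2) ∂ν := by
    simp_rw [← quadVal_outer_sub_one]
    simp only [quadVal]
    simp_rw [← integral_mul_const]
    have hi2' : ∀ i j, Integrable (fun y => ψ x y * (y i * y j - if i = j then 1 else 0)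
      * (h i * h j)) ν := fun i j => (hi2 x i j).mul_const _
    simp_rw [fun i => (integral_finsetSum (μ := ν) Finset.univ fun j _ => hi2' i j).symm]
    rw [← integral_finsetSum _ fun i _ => integrable_finsetSum _ fun j _ => hi2' i j]
    refine integral_congr_ae (ae_of_all _ fun y => ?_)
    simp only [Finset.mul_sum]
    exact Finset.sum_congr rfl fun i _ => Finset.sum_congr rfl fun j _ => by ring
  have bG := hint x (fun y => inner ℝ h y) ‖h‖ (by fun_prop) (hlin h)
  have bH := hint x (fun y => inner ℝ h y ^ 2 - ‖h‖ ^ 2) (‖h‖ ^ 2) (by fun_prop) (hquad h)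
  rw [eG, eH]
  rcases le_total ‖h‖ 1 with hh | hh
  · have hCM : ∫ y, φ (x + h + y) ∂ν
        = φ x + ∫ y, ψ x y * Real.exp (inner ℝ h y - ‖h‖ ^ 2 / 2) ∂ν := by
      rw [← integral_add_stdGaussian (ψ x) (hψc x).measurable h]
      have : ∀ y, φ (x + h + y) = φ x + ψ x (y + h) := fun y => by
        simp [hψ, add_assoc, add_comm h]
      simp_rw [this]
      rw [integral_add (integrable_const _)]
      · rw [← hν]
        simp
      · have : ∀ y, ψ x (y + h) = (φ (x + h) - φ x) + ψ (x + h) y := fun y => by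
          simp [hψ, add_assoc, add_comm h]
        simp_rw [this]
        exact (integrable_const _).add (hi0 _)
    have bE := (hint x (fun y => Real.exp (inner ℝ h y - ‖h‖ ^ 2 / 2)) 1 (by fun_prop) fun y => by
      have hy := norm_nonneg y
      rw [abs_of_pos (Real.exp_pos _), one_mul]
      have h1 : inner ℝ h y ≤ ‖y‖ := (real_inner_le_norm h y).trans (by nlinarith)
      have h2 : ‖y‖ ≤ Real.exp ‖y‖ := by linarith [hexp y]
      calc ‖y‖ * Real.exp (inner ℝ h y - ‖h‖ ^ 2 / 2) ≤ Real.exp ‖y‖ * Real.exp ‖y‖ := by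
            refine mul_le_mul h2 (Real.exp_le_exp.2 ?_) (Real.exp_pos _).le (Real.exp_pos _).le
            linarith [sq_nonneg ‖h‖]
        _ ≤ _ := by
          rw [← Real.exp_add]
          exact Real.exp_le_exp.2 (by linarith)).1
    have key := (hint x (fun y => Real.exp (inner ℝ h y - ‖h‖ ^ 2 / 2) - 1 - inner ℝ h y
      - 1 / 2 * (inner ℝ h y ^ 2 - ‖h‖ ^ 2)) (2 * ‖h‖ ^ 3) (by fun_prop)
      fun y => norm_gaussian_bracket_le hh).2
    have e : ∫ y, ψ x y * (Real.exp (inner ℝ h y - ‖h‖ ^ 2 / 2) - 1 - inner ℝ h y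
        - 1 / 2 * (inner ℝ h y ^ 2 - ‖h‖ ^ 2)) ∂ν
        = ∫ y, φ (x + h + y) ∂ν - ∫ y, φ (x + y) ∂ν - ∫ y, ψ x y * inner ℝ h y ∂ν
          - 1 / 2 * ∫ y, ψ x y * (inner ℝ h y ^ 2 - ‖h‖ ^ 2) ∂ν := by
      rw [hCM, hF]
      have e1 : ∀ y, ψ x y * (Real.exp (inner ℝ h y - ‖h‖ ^ 2 / 2) - 1 - inner ℝ h y
        - 1 / 2 * (inner ℝ h y ^ 2 - ‖h‖ ^ 2))
        = ψ x y * Real.exp (inner ℝ h y - ‖h‖ ^ 2 / 2) - ψ x y - ψ x y * inner ℝ h y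
          - 1 / 2 * (ψ x y * (inner ℝ h y ^ 2 - ‖h‖ ^ 2)) := fun y => by ring
      simp_rw [e1]
      have i1 : Integrable (fun y => ψ x y * Real.exp (inner ℝ h y - ‖h‖ ^ 2 / 2) - ψ x y) ν :=
        bE.sub (hi0 x)
      have i2 : Integrable (fun y => ψ x y * Real.exp (inner ℝ h y - ‖h‖ ^ 2 / 2) - ψ x y
        - ψ x y * inner ℝ h y) ν := i1.sub bG.1
      rw [integral_sub i2 (bH.1.const_mul _), integral_sub i1 bG.1, integral_sub bE (hi0 x),
        integral_const_mul]
      ring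
    rw [← e]
    refine key.trans ?_
    have h3 : ‖h‖ ^ 3 ≤ ‖h‖ ^ p := by
      rw [← Real.rpow_natCast]
      exact Real.rpow_le_rpow_of_exponent_ge_of_imp (norm_nonneg _) hh (by simpa using hp3)
        (by intro h0 h1; norm_num at h1)
    have : (0 : ℝ) ≤ ‖h‖ ^ p := by positivity
    calc K * (2 * ‖h‖ ^ 3) * I = K * (2 * I) * ‖h‖ ^ 3 := by ring
      _ ≤ K * (1 + 2 * I) * ‖h‖ ^ p := by gcongr; linarith
  · have h1 := hlip x h
    have p1 : ‖h‖ ≤ ‖h‖ ^ p := by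
      conv_lhs => rw [← Real.rpow_one ‖h‖]
      exact Real.rpow_le_rpow_of_exponent_le hh (by linarith)
    have p2 : ‖h‖ ^ 2 ≤ ‖h‖ ^ p := by
      rw [← Real.rpow_two]
      exact Real.rpow_le_rpow_of_exponent_le hh (by linarith)
    have b1 : K * ‖h‖ ≤ K * ‖h‖ ^ p := by gcongr
    have b2 : K * ‖h‖ * I ≤ K * ‖h‖ ^ p * I := by gcongr
    have b3 : K * ‖h‖ ^ 2 * I ≤ K * ‖h‖ ^ p * I := by gcongr
    have b4 : 0 ≤ K * ‖h‖ ^ p * I := by positivity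
    have c2 := bG.2
    have c3 := bH.2
    rw [abs_le] at h1 c2 c3 ⊢
    constructor <;> linarith [h1.1, h1.2, c2.1, c2.2, c3.1, c3.2]

end Smoothing

section SmoothingScale

variable {D : ℕ} {p w : ℝ} {F : EuclideanSpace ℝ (Fin D) → ℝ}
    {G : EuclideanSpace ℝ (Fin D) → Fin D → ℝ}
    {H : EuclideanSpace ℝ (Fin D) → Fin D → Fin D → ℝ}

lemma HasTaylor.const_mul (hT : HasTaylor p w F G H) {c : ℝ} (hc : 0 ≤ c) :
    HasTaylor p (c * w) (fun x => c * F x) (fun x i => c * G x i) (fun x i j => c * H x i j) := by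
  have h1 := hT.measF
  have h2 := hT.measG
  have h3 := hT.measH
  refine ⟨mul_nonneg hc hT.nonneg, by fun_prop, by fun_prop, by fun_prop,
    fun x i j => by rw [hT.symm], fun x h => ?_⟩
  have e : c * F (x + h) - c * F x - ∑ i, c * G x i * h i
      - 1 / 2 * quadVal (fun i j => c * H x i j) h
      = c * (F (x + h) - F x - ∑ i, G x i * h i - 1 / 2 * quadVal (H x) h) := by
    simp only [quadVal, mul_assoc, ← Finset.mul_sum]
    ring
  rw [e, abs_mul, abs_of_nonneg hc, mul_assoc]
  exact mul_le_mul_of_nonneg_left (hT.bound x h) hc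

lemma exists_hasTaylor_smoothing (hp : 2 < p) (hp3 : p ≤ 3) :
    ∃ C : ℝ, 0 ≤ C ∧ ∀ (K : ℝ≥0) (φ : EuclideanSpace ℝ (Fin D) → ℝ), LipschitzWith K φ →
      ∀ (L : EuclideanSpace ℝ (Fin D) →L[ℝ] EuclideanSpace ℝ (Fin D)) (s : ℝ), 0 < s →
      ∃ G H, HasTaylor p (K * C * ‖L‖ ^ p * s ^ (1 - p))
        (fun x => ∫ y, φ (L x + s • y) ∂(stdGaussian (EuclideanSpace ℝ (Fin D)))) G H := by
  obtain ⟨C, hC, h⟩ := exists_hasTaylor_smoothing_one (D := D) hp hp3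
  refine ⟨C, hC, fun K φ hφ L s hs => ?_⟩
  have hφ1 : LipschitzWith K (fun z => φ (s • z) / s) := by
    refine LipschitzWith.of_dist_le_mul fun x y => ?_
    have := hφ.dist_le_mul (s • x) (s • y)
    rw [dist_smul₀, Real.norm_of_nonneg hs.le, Real.dist_eq] at this
    rw [Real.dist_eq, ← sub_div, abs_div, abs_of_pos hs, div_le_iff₀ hs]
    linarith
  obtain ⟨G1, H1, hT1⟩ := h K _ hφ1
  obtain ⟨G2, H2, hT2⟩ := hT1.comp_linear (by linarith) (s⁻¹ • L)
  have hT3 := hT2.const_mul hs.le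
  refine ⟨fun x i => s * G2 x i, fun x i j => s * H2 x i j, ?_⟩
  convert hT3 using 1
  · rw [norm_smul, norm_inv, Real.norm_of_nonneg hs.le,
      Real.mul_rpow (by positivity) (norm_nonneg _), Real.inv_rpow hs.le, Real.rpow_sub hs,
      Real.rpow_one]
    field_simp
  · funext x
    rw [← integral_const_mul]
    refine integral_congr_ae (ae_of_all _ fun y => ?_)
    have : s • ((s⁻¹ • L) x + y) = L x + s • y := by
      simp [smul_smul, hs.ne']
    simp only [this]
    field_simp

end SmoothingScale

section Envelope

lemma gaussianReal_Ioi_ge {x : ℝ} (hx : 0 ≤ x) :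
    (√(2 * Real.pi))⁻¹ * Real.exp (-(x + 1) ^ 2 / 2) ≤ ((gaussianReal 0 1) (Set.Ioi x)).toReal := by
  have h0 : ENNReal.ofReal ((√(2 * Real.pi))⁻¹ * Real.exp (-(x + 1) ^ 2 / 2))
      ≤ (gaussianReal 0 1) (Set.Ioi x) := by
    rw [gaussianReal_apply 0 one_ne_zero]
    calc ENNReal.ofReal ((√(2 * Real.pi))⁻¹ * Real.exp (-(x + 1) ^ 2 / 2))
        = ∫⁻ _ in Set.Ioo x (x + 1),
          ENNReal.ofReal ((√(2 * Real.pi))⁻¹ * Real.exp (-(x + 1) ^ 2 / 2)) := by simp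
      _ ≤ ∫⁻ y in Set.Ioo x (x + 1), gaussianPDF 0 1 y := by
          refine setLIntegral_mono (by fun_prop) fun y hy => ?_
          rw [gaussianPDF, gaussianPDFReal]
          refine ENNReal.ofReal_le_ofReal ?_
          simp only [NNReal.coe_one, mul_one, sub_zero]
          gcongr
          · linarith [hy.1]
          · exact hy.2.le
      _ ≤ _ := lintegral_mono_set Set.Ioo_subset_Ioi_self
  rw [← ENNReal.toReal_ofReal (by positivity :
    0 ≤ (√(2 * Real.pi))⁻¹ * Real.exp (-(x + 1) ^ 2 / 2))]
  exact ENNReal.toReal_mono (measure_ne_top _ _) h0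

lemma stdNormalCDF_eq (x : ℝ) :
    stdNormalCDF x = 1 - ((gaussianReal 0 1) (Set.Ioi x)).toReal := by
  rw [stdNormalCDF, ← Set.compl_Ioi, prob_compl_eq_one_sub measurableSet_Ioi,
    ENNReal.toReal_sub_of_le prob_le_one ENNReal.one_ne_top, ENNReal.toReal_one]

lemma monotone_stdNormalCDF : Monotone stdNormalCDF := fun _ _ h =>
  ENNReal.toReal_mono (measure_ne_top _ _) (measure_mono (Set.Iic_subset_Iic.2 h))

lemma tendsto_stdNormalCDF_atTop : Tendsto stdNormalCDF atTop (𝓝 1) := by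
  have := tendsto_measure_Iic_atTop (gaussianReal 0 1)
  rw [measure_univ] at this
  exact (ENNReal.tendsto_toReal ENNReal.one_ne_top).comp this

lemma le_stdNormalCDFInv {x y : ℝ} (hy : y < 1) (h : stdNormalCDF x < y) :
    x ≤ stdNormalCDFInv y := by
  refine le_csInf ?_ fun z hz => ?_
  · obtain ⟨z, hz⟩ := (tendsto_stdNormalCDF_atTop.eventually_const_lt hy).exists
    exact ⟨z, hz.le⟩
  · by_contra! hlt
    exact absurd (hz.trans (monotone_stdNormalCDF hlt.le)) (not_le.2 h)

lemma exp_neg_max_stdNormalCDFInv_le {u : ℝ} (hu : u ∈ Set.Ioo (0 : ℝ) 1) :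
    2 * (√(2 * Real.pi))⁻¹ * Real.exp (-(9 / 2) * max 1 (stdNormalCDFInv (1 - u / 2)) ^ 2) ≤ u := by
  set m := max 1 (stdNormalCDFInv (1 - u / 2)) with hm
  have hm1 : 1 ≤ m := le_max_left _ _
  have h1 : ¬ stdNormalCDF (2 * m) < 1 - u / 2 := fun h => by
    have := le_stdNormalCDFInv (by linarith [hu.1]) h
    have := this.trans (le_max_right 1 _)
    rw [← hm] at this
    linarith
  rw [stdNormalCDF_eq] at h1
  have h2 := gaussianReal_Ioi_ge (by linarith : 0 ≤ 2 * m)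
  have h3 : (√(2 * Real.pi))⁻¹ * Real.exp (-(9 / 2) * m ^ 2)
      ≤ (√(2 * Real.pi))⁻¹ * Real.exp (-(2 * m + 1) ^ 2 / 2) := by
    gcongr
    nlinarith
  linarith

lemma le_mul_max_stdNormalCDFInv {c C : ℝ} (hc : 0 < c) (hC : 0 < C) :
    ∃ C' : ℝ, 0 ≤ C' ∧ ∀ u ∈ Set.Ioo (0 : ℝ) 1, ∀ r : ℝ, u < C * Real.exp (-c * r ^ 2) →
      r ≤ C' * max 1 (stdNormalCDFInv (1 - u / 2)) := by
  set c0 := 2 * (√(2 * Real.pi))⁻¹ with hc0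
  have hc0' : 0 < c0 := by positivity
  refine ⟨√((|Real.log (C / c0)| + 9 / 2) / c), Real.sqrt_nonneg _, fun u hu r hr => ?_⟩
  have h1 := (exp_neg_max_stdNormalCDFInv_le hu).trans_lt hr
  set m := max 1 (stdNormalCDFInv (1 - u / 2)) with hm
  have hm1 : 1 ≤ m := le_max_left _ _
  have h2 := Real.log_lt_log (by positivity) h1
  rw [Real.log_mul hc0'.ne' (Real.exp_pos _).ne', Real.log_mul hC.ne' (Real.exp_pos _).ne',
    Real.log_exp, Real.log_exp] at h2
  have h3 : Real.log (C / c0) = Real.log C - Real.log c0 := Real.log_div hC.ne' hc0'.ne'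
  have h4 := le_abs_self (Real.log (C / c0))
  have h5 : r ^ 2 ≤ (|Real.log (C / c0)| + 9 / 2) / c * m ^ 2 := by
    rw [div_mul_eq_mul_div, le_div_iff₀ hc]
    have h6 : |Real.log (C / c0)| * 1 ≤ |Real.log (C / c0)| * m ^ 2 :=
      mul_le_mul_of_nonneg_left (by nlinarith) (abs_nonneg _)
    linarith
  calc r ≤ √((|Real.log (C / c0)| + 9 / 2) / c * m ^ 2) := Real.le_sqrt_of_sq_le h5
    _ = _ := by rw [Real.sqrt_mul' _ (by positivity), Real.sqrt_sq (by linarith)]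

lemma ofReal_min_eq_lintegral {a b : ℝ} (ha : a ≤ 1) :
    ENNReal.ofReal (min a b) = ∫⁻ u in Set.Ioo (0 : ℝ) 1,
      (if u < a then 1 else 0) * (if u < b then 1 else 0) := by
  have : ∀ u : ℝ, ((if u < a then 1 else 0) * (if u < b then 1 else 0) : ℝ≥0∞)
      = (Set.Iio (min a b)).indicator 1 u := fun u => by
    by_cases h1 : u < a <;> by_cases h2 : u < b <;> simp [h1, h2, Set.indicator]
  simp_rw [this]
  rw [lintegral_indicator_one measurableSet_Iio, Measure.restrict_apply measurableSet_Iio]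
  have : Set.Iio (min a b) ∩ Set.Ioo 0 1 = Set.Ioo 0 (min a b) := by
    ext u
    simp only [Set.mem_inter_iff, Set.mem_Iio, Set.mem_Ioo]
    constructor
    · rintro ⟨h1, h2, -⟩
      exact ⟨h2, h1⟩
    · rintro ⟨h1, h2⟩
      exact ⟨h2, h1, h2.trans_le ((min_le_left _ _).trans ha)⟩
  rw [this]
  simp

lemma lintegral_lintegral_ofReal_min {a b : ℝ → ℝ} (ha : Measurable a) (hb : Measurable b)
    (ha1 : ∀ s, a s ≤ 1) :
    ∫⁻ t in Set.Ioi (0 : ℝ), ∫⁻ s in Set.Ioi (0 : ℝ), ENNReal.ofReal (min (a s) (b t))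
      = ∫⁻ u in Set.Ioo (0 : ℝ) 1, volume ({s | u < a s} ∩ Set.Ioi 0)
        * volume ({t | u < b t} ∩ Set.Ioi 0) := by
  have m1 : Measurable fun z : ℝ × ℝ => (if z.2 < a z.1 then 1 else 0 : ℝ≥0∞) :=
    Measurable.ite (measurableSet_lt measurable_snd (ha.comp measurable_fst)) (by fun_prop)
      (by fun_prop)
  have m2 : Measurable fun z : ℝ × ℝ => (if z.2 < b z.1 then 1 else 0 : ℝ≥0∞) :=
    Measurable.ite (measurableSet_lt measurable_snd (hb.comp measurable_fst)) (by fun_prop)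
      (by fun_prop)
  have e1 : ∀ u, ∫⁻ s in Set.Ioi (0 : ℝ), (if u < a s then 1 else 0 : ℝ≥0∞)
      = volume ({s | u < a s} ∩ Set.Ioi 0) := fun u => by
    have hs : MeasurableSet {s | u < a s} := measurableSet_lt measurable_const ha
    rw [← Measure.restrict_apply hs, ← lintegral_indicator_one hs]
    exact lintegral_congr fun s => by simp [Set.indicator]
  have e2 : ∀ u, ∫⁻ s in Set.Ioi (0 : ℝ), (if u < b s then 1 else 0 : ℝ≥0∞)
      = volume ({s | u < b s} ∩ Set.Ioi 0) := fun u => by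
    have hs : MeasurableSet {s | u < b s} := measurableSet_lt measurable_const hb
    rw [← Measure.restrict_apply hs, ← lintegral_indicator_one hs]
    exact lintegral_congr fun s => by simp [Set.indicator]
  simp_rw [ofReal_min_eq_lintegral (ha1 _), ← e1, ← e2]
  have step : ∀ t, ∫⁻ s in Set.Ioi (0 : ℝ), ∫⁻ u in Set.Ioo (0 : ℝ) 1,
      ((if u < a s then 1 else 0) * (if u < b t then 1 else 0) : ℝ≥0∞)
      = ∫⁻ u in Set.Ioo (0 : ℝ) 1, (∫⁻ s in Set.Ioi (0 : ℝ), (if u < a s then 1 else 0))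
        * (if u < b t then 1 else 0) := fun t => by
    rw [lintegral_lintegral_swap]
    · refine lintegral_congr fun u => ?_
      rw [lintegral_mul_const]
      exact m1.comp (measurable_id.prodMk measurable_const)
    · exact (m1.mul (m2.comp (measurable_const.prodMk measurable_snd))).aemeasurable
  simp_rw [step]
  rw [lintegral_lintegral_swap]
  · refine lintegral_congr fun u => ?_
    rw [lintegral_const_mul]
    exact m2.comp (measurable_id.prodMk measurable_const)
  · refine (Measurable.mul ?_ m2).aemeasurable
    exact (m1.comp measurable_swap).lintegral_prod_right'.comp measurable_snd

variable {Ω : Type*} [MeasurableSpace Ω] {P : Measure Ω}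

lemma lintegral_ofReal_mul_le_lintegral_min [IsProbabilityMeasure P] {A B : Ω → ℝ}
    (hA : Measurable A) (hB : Measurable B) (hA0 : ∀ ω, 0 ≤ A ω) (hB0 : ∀ ω, 0 ≤ B ω) :
    ∫⁻ ω, ENNReal.ofReal (A ω * B ω) ∂P ≤
      ∫⁻ t in Set.Ioi (0 : ℝ), ∫⁻ s in Set.Ioi (0 : ℝ),
        ENNReal.ofReal (min (P {ω | s < A ω}).toReal (P {ω | t < B ω}).toReal) := by
  have hA' : Measurable fun ω => ENNReal.ofReal (A ω) := hA.ennreal_ofReal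
  have e : ∫⁻ ω, ENNReal.ofReal (A ω * B ω) ∂P
      = ∫⁻ ω, ENNReal.ofReal (B ω) ∂(P.withDensity fun ω => ENNReal.ofReal (A ω)) := by
    rw [lintegral_withDensity_eq_lintegral_mul _ hA' hB.ennreal_ofReal]
    exact lintegral_congr fun ω => by simp [ENNReal.ofReal_mul (hA0 ω)]
  rw [e, lintegral_eq_lintegral_meas_lt _ (ae_of_all _ hB0) hB.aemeasurable]
  refine lintegral_mono fun t => ?_
  have hs : MeasurableSet {ω | t < B ω} := measurableSet_lt measurable_const hB
  simp only
  rw [withDensity_apply _ hs, lintegral_eq_lintegral_meas_lt _ (ae_of_all _ hA0) hA.aemeasurable]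
  refine lintegral_mono fun s => ?_
  have hs' : MeasurableSet {ω | s < A ω} := measurableSet_lt measurable_const hA
  rw [Measure.restrict_apply hs', ENNReal.ofReal_min, ENNReal.ofReal_toReal (measure_ne_top _ _),
    ENNReal.ofReal_toReal (measure_ne_top _ _)]
  exact le_min (measure_mono Set.inter_subset_left) (measure_mono Set.inter_subset_right)

lemma antitone_tail [IsFiniteMeasure P] (A : Ω → ℝ) : Antitone fun s => (P {ω | s < A ω}).toReal :=
  fun _ _ h => ENNReal.toReal_mono (measure_ne_top _ _)
    (measure_mono fun _ (hω : _ < _) => h.trans_lt hω)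

lemma exists_tail_le [IsFiniteMeasure P] {B : Ω → ℝ} (hB : Measurable B) {u : ℝ} (hu : 0 < u) :
    ∃ x, (P {ω | x < B ω}).toReal ≤ u := by
  have h := tendsto_measure_iInter_atTop (μ := P) (s := fun n : ℕ => {ω | (n : ℝ) < B ω})
    (fun n => (measurableSet_lt measurable_const hB).nullMeasurableSet)
    (fun n m hnm ω (hω : (m : ℝ) < B ω) => lt_of_le_of_lt (Nat.cast_le.2 hnm) hω)
    ⟨0, measure_ne_top _ _⟩
  have he : ⋂ n : ℕ, {ω | (n : ℝ) < B ω} = ∅ := by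
    ext ω
    obtain ⟨n, hn⟩ := exists_nat_ge (B ω)
    simp only [Set.mem_iInter, Set.mem_ofPred_eq, Set.mem_empty_iff_false, iff_false, not_forall,
      not_lt]
    exact ⟨n, hn⟩
  rw [he, measure_empty] at h
  have h' := (ENNReal.tendsto_toReal ENNReal.zero_ne_top).comp h
  obtain ⟨n, hn⟩ := (h'.eventually_lt_const (by simpa using hu)).exists
  exact ⟨n, hn.le⟩

lemma volume_tail_le_absQuantile [IsFiniteMeasure P] {Y : Ω → ℝ} (hY : Measurable Y) {u : ℝ}
    (hu : 0 < u) :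
    volume ({t | u < (P {ω | t < |Y ω|}).toReal} ∩ Set.Ioi 0)
      ≤ ENNReal.ofReal (absQuantile P Y u) := by
  refine (measure_mono (t := Set.Ioc 0 (absQuantile P Y u)) ?_).trans (by simp)
  rintro t ⟨ht, ht0⟩
  refine ⟨ht0, le_csInf (exists_tail_le hY.abs hu) fun x hx => ?_⟩
  by_contra! h
  exact absurd ((antitone_tail (P := P) (fun ω => |Y ω|) h.le).trans hx) (not_le.2 ht)

lemma exists_lintegral_rpow_mul_le_envNorm {p c C : ℝ} (hp : 2 < p) (hc : 0 < c) (hC : 0 < C) :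
    ∃ C' : ℝ, 0 ≤ C' ∧ ∀ (P : Measure Ω) [IsProbabilityMeasure P] (W Y : Ω → ℝ),
      Measurable W → Measurable Y → (∀ ω, 0 ≤ W ω) →
      (∀ s, 0 ≤ s → (P {ω | s < W ω}).toReal ≤ C * Real.exp (-c * s ^ 2)) →
      ∫⁻ ω, ENNReal.ofReal (W ω ^ (p - 2) * |Y ω|) ∂P ≤ ENNReal.ofReal C' * envNorm P p Y := by
  obtain ⟨C', hC', h⟩ := le_mul_max_stdNormalCDFInv hc hC
  have hp2 : 0 < p - 2 := by linarith
  refine ⟨C' ^ (p - 2), by positivity, fun P _ W Y hW hY hW0 ht => ?_⟩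
  refine (lintegral_ofReal_mul_le_lintegral_min (hW.pow_const _) hY.abs
    (fun ω => Real.rpow_nonneg (hW0 ω) _) (fun ω => abs_nonneg _)).trans ?_
  rw [lintegral_lintegral_ofReal_min (antitone_tail _).measurable (antitone_tail _).measurable
    (fun s => measureReal_le_one), envNorm, ← lintegral_const_mul' _ _ ENNReal.ofReal_ne_top]
  refine setLIntegral_mono' measurableSet_Ioo fun u hu => ?_
  have hm : 0 ≤ max 1 (stdNormalCDFInv (1 - u / 2)) := le_max_of_le_left zero_le_one
  rw [ENNReal.ofReal_mul (by positivity), ← mul_assoc, ← ENNReal.ofReal_mul (by positivity),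
    ← Real.mul_rpow hC' hm]
  refine mul_le_mul' ?_ (volume_tail_le_absQuantile hY hu.1)
  refine (measure_mono (t := Set.Ioc 0 ((C' * max 1 (stdNormalCDFInv (1 - u / 2))) ^ (p - 2)))
    ?_).trans (by simp)
  rintro s ⟨hs, hs0 : 0 < s⟩
  refine ⟨hs0, ?_⟩
  have e : s = (s ^ (p - 2)⁻¹) ^ (p - 2) := by rw [Real.rpow_inv_rpow hs0.le hp2.ne']
  rw [e]
  refine Real.rpow_le_rpow (by positivity) (h u hu _ (lt_of_lt_of_le hs ?_)) hp2.le
  refine le_trans ?_ (ht _ (by positivity))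
  refine ENNReal.toReal_mono (measure_ne_top _ _)
    (measure_mono fun ω (hω : s < W ω ^ (p - 2)) => ?_)
  rw [e] at hω
  exact (Real.rpow_lt_rpow_iff (by positivity) (hW0 ω) hp2).1 hω

end Envelope

section TailMoment

variable {Ω : Type*} [MeasurableSpace Ω]

lemma toReal_measure_lt_le_of_lintegral_excess {P : Measure Ω} {X : Ω → ℝ} (hX : Measurable X)
    {p t B : ℝ} (hp : 0 < p) (ht : 0 < t) (hB : 0 ≤ B)
    (h : ∫⁻ ω, ENNReal.ofReal (max (|X ω| - t) 0 ^ p) ∂P ≤ ENNReal.ofReal B) :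
    (P {ω | 2 * t < |X ω|}).toReal ≤ B / t ^ p := by
  have htp : 0 < t ^ p := Real.rpow_pos_of_pos ht p
  have h1 : ENNReal.ofReal (t ^ p) * P {ω | 2 * t < |X ω|} ≤ ENNReal.ofReal B := by
    refine le_trans ?_ h
    refine le_trans ?_ (mul_meas_ge_le_lintegral (by fun_prop) (ENNReal.ofReal (t ^ p)))
    gcongr
    rename_i ω
    intro hω
    have hω : 2 * t < |X ω| := hω
    refine ENNReal.ofReal_le_ofReal (Real.rpow_le_rpow ht.le ?_ hp.le)
    exact le_max_of_le_left (by linarith)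
  have h2 := ENNReal.toReal_mono ENNReal.ofReal_ne_top h1
  rw [ENNReal.toReal_mul, ENNReal.toReal_ofReal htp.le, ENNReal.toReal_ofReal hB] at h2
  rw [le_div_iff₀ htp]
  linarith

lemma lintegral_rpow_indicator_le_of_excess {P : Measure Ω} {X : Ω → ℝ} {p x : ℝ} (hp : 0 < p) :
    ∫⁻ ω, ENNReal.ofReal ((if 2 * x < |X ω| then |X ω| else 0) ^ p) ∂P
      ≤ ENNReal.ofReal (2 ^ p) * ∫⁻ ω, ENNReal.ofReal (max (|X ω| - x) 0 ^ p) ∂P := by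
  rw [← lintegral_const_mul' _ _ ENNReal.ofReal_ne_top]
  refine lintegral_mono fun ω => ?_
  rw [← ENNReal.ofReal_mul (by positivity)]
  refine ENNReal.ofReal_le_ofReal ?_
  split_ifs with h
  · rw [← Real.mul_rpow (by norm_num) (le_max_right _ _)]
    refine Real.rpow_le_rpow (abs_nonneg _) ?_ hp.le
    linarith [le_max_left (|X ω| - x) 0]
  · rw [Real.zero_rpow hp.ne']
    positivity

lemma lintegral_rpow_mul_le_holder {P : Measure Ω} {Z Y : Ω → ℝ} (hZ : Measurable Z)
    (hY : Measurable Y) (hZ0 : ∀ ω, 0 ≤ Z ω) {p B : ℝ} (hp : 2 < p) (hB : 0 ≤ B)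
    (h : ∫⁻ ω, ENNReal.ofReal (Z ω ^ p) ∂P ≤ ENNReal.ofReal B) :
    ∫⁻ ω, ENNReal.ofReal (Z ω ^ (p - 2) * |Y ω|) ∂P
      ≤ ENNReal.ofReal (B ^ ((p - 2) / p)) * eLpNorm Y (ENNReal.ofReal (p / 2)) P := by
  have hp2 : 0 < p - 2 := by linarith
  have hp0 : 0 < p := by linarith
  have hpq : (p / (p - 2)).HolderConjugate (p / 2) := by
    rw [Real.holderConjugate_iff]
    refine ⟨by rw [lt_div_iff₀ hp2]; linarith, ?_⟩
    field_simp
    ring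
  have e : ∀ ω, ENNReal.ofReal (Z ω ^ (p - 2) * |Y ω|)
      = ((fun ω => ENNReal.ofReal (Z ω ^ (p - 2))) * fun ω => ENNReal.ofReal |Y ω|) ω := fun ω => by
    simp [ENNReal.ofReal_mul (Real.rpow_nonneg (hZ0 ω) _)]
  simp_rw [e]
  refine (ENNReal.lintegral_mul_le_Lp_mul_Lq P hpq (by fun_prop) (by fun_prop)).trans ?_
  refine mul_le_mul' ?_ (le_of_eq ?_)
  · have : ∀ ω, ENNReal.ofReal (Z ω ^ (p - 2)) ^ (p / (p - 2)) = ENNReal.ofReal (Z ω ^ p) :=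
      fun ω => by
      rw [ENNReal.ofReal_rpow_of_nonneg (Real.rpow_nonneg (hZ0 ω) _) (by positivity),
        ← Real.rpow_mul (hZ0 ω)]
      congr 2
      field_simp
    simp_rw [this]
    rw [one_div_div, ← ENNReal.ofReal_rpow_of_nonneg hB (by positivity)]
    exact ENNReal.rpow_le_rpow h (by positivity)
  · rw [eLpNorm_eq_lintegral_rpow_enorm_toReal (by simpa using hp0) ENNReal.ofReal_ne_top,
      ENNReal.toReal_ofReal (by positivity)]
    simp [Real.enorm_eq_ofReal_abs]

lemma exists_lintegral_rpow_mul_le {p c A : ℝ} (hp : 2 < p) (hc : 0 < c) (hA : 0 ≤ A) :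
    ∃ C : ℝ, 0 ≤ C ∧ ∀ (P : Measure Ω) [IsProbabilityMeasure P] (X Y : Ω → ℝ) (R K : ℝ),
      Measurable X → Measurable Y → 0 < R → 0 < K →
      (∀ t, 0 ≤ t → ∫⁻ ω, ENNReal.ofReal (max (|X ω| - t) 0 ^ p) ∂P
        ≤ ENNReal.ofReal (A * (R ^ (p / 2) * Real.exp (-c * t ^ 2 / R)) + K * R)) →
      ∫⁻ ω, ENNReal.ofReal (|X ω| ^ (p - 2) * |Y ω|) ∂P
        ≤ ENNReal.ofReal C * (ENNReal.ofReal (R ^ ((p - 2) / 2)) * envNorm P p Y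
          + ENNReal.ofReal ((K * R) ^ ((p - 2) / p)) * eLpNorm Y (ENNReal.ofReal (p / 2)) P) := by
  have hp2 : 0 < p - 2 := by linarith
  have hp0 : 0 < p := by linarith
  set C1 := (A + 1) * 2 ^ p + Real.exp (c / 4) with hC1
  have hC1' : 0 < C1 := by positivity
  obtain ⟨C', hC', h⟩ := exists_lintegral_rpow_mul_le_envNorm (Ω := Ω) hp
    (by positivity : 0 < c / 4)
    hC1'
  set B := 2 ^ p * (A + 1) with hB
  refine ⟨max C' (B ^ ((p - 2) / p)), by positivity, fun P _ X Y R K hX hY hR hK ht => ?_⟩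
  set ℓ := max 0 (Real.log (R ^ (p / 2 - 1) / K)) with hℓ
  have hℓ0 : 0 ≤ ℓ := le_max_left _ _
  set x := √(R / c * ℓ) with hx
  have hx0 : 0 ≤ x := Real.sqrt_nonneg _
  have hx2 : x ^ 2 = R / c * ℓ := Real.sq_sqrt (by positivity)
  have hRp : R ^ (p / 2) = R ^ (p / 2 - 1) * R := by
    rw [← Real.rpow_add_one hR.ne']
    congr 1
    ring
  have hlarge : R ^ (p / 2) * Real.exp (-c * x ^ 2 / R) ≤ K * R := by
    have e : -c * x ^ 2 / R = -ℓ := by rw [hx2]; field_simp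
    have h1 : Real.exp (-ℓ) ≤ K / R ^ (p / 2 - 1) := by
      rw [← Real.exp_log (by positivity : 0 < K / R ^ (p / 2 - 1))]
      refine Real.exp_le_exp.2 ?_
      rw [← inv_div, Real.log_inv]
      exact neg_le_neg (le_max_right _ _)
    rw [e, hRp]
    rw [le_div_iff₀ (by positivity)] at h1
    nlinarith
  have hsmall : ∀ t, 0 < t → t < x → K * R ≤ R ^ (p / 2) * Real.exp (-c * t ^ 2 / R) := by
    intro t ht0 htx
    have hx' : 0 < x ^ 2 := by nlinarith
    have hlp : 0 < ℓ := by
      rcases hℓ0.eq_or_lt with h0 | h0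
      · rw [hx2, ← h0] at hx'
        simp at hx'
      · exact h0
    have hl : ℓ = Real.log (R ^ (p / 2 - 1) / K) := by
      rcases max_choice 0 (Real.log (R ^ (p / 2 - 1) / K)) with h0 | h0
      · rw [← hℓ] at h0
        exact absurd h0 hlp.ne'
      · exact h0
    have h1 : -ℓ ≤ -c * t ^ 2 / R := by
      have : c * t ^ 2 / R ≤ c * x ^ 2 / R := by gcongr
      have e : c * x ^ 2 / R = ℓ := by rw [hx2]; field_simp
      rw [neg_mul, neg_div]
      linarith
    have h2 := Real.exp_le_exp.2 h1
    rw [hl, ← Real.log_inv, inv_div, Real.exp_log (by positivity),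
      div_le_iff₀ (by positivity)] at h2
    rw [hRp]
    nlinarith
  set Z := fun ω => if 2 * x < |X ω| then |X ω| else 0 with hZ
  have hZm : Measurable Z := Measurable.ite (measurableSet_lt measurable_const hX.abs) hX.abs
    measurable_const
  have hZ0 : ∀ ω, 0 ≤ Z ω := fun ω => by
    simp only [hZ]
    split_ifs <;> positivity
  set W := fun ω => (if 2 * x < |X ω| then 0 else |X ω|) / √R with hW
  have hWm : Measurable W := (Measurable.ite (measurableSet_lt measurable_const hX.abs)
    measurable_const hX.abs).div_const _
  have hW0 : ∀ ω, 0 ≤ W ω := fun ω => by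
    simp only [hW]
    split_ifs <;> positivity
  have hsR : 0 < √R := Real.sqrt_pos.2 hR
  have hsplit : ∀ ω, ENNReal.ofReal (|X ω| ^ (p - 2) * |Y ω|)
      = ENNReal.ofReal (R ^ ((p - 2) / 2)) * ENNReal.ofReal (W ω ^ (p - 2) * |Y ω|)
        + ENNReal.ofReal (Z ω ^ (p - 2) * |Y ω|) := fun ω => by
    have e1 : R ^ ((p - 2) / 2) = √R ^ (p - 2) := by
      rw [Real.sqrt_eq_rpow, ← Real.rpow_mul hR.le]
      congr 1
      ring
    have hW' := hW0 ω
    have hZ' := hZ0 ω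
    rw [← ENNReal.ofReal_mul (by positivity), ← ENNReal.ofReal_add (by positivity) (by positivity),
      e1, ← mul_assoc, ← Real.mul_rpow hsR.le hW']
    congr 1
    simp only [hW, hZ]
    split_ifs
    · simp [Real.zero_rpow hp2.ne']
    · simp [Real.zero_rpow hp2.ne', mul_div_cancel₀ _ hsR.ne']
  simp_rw [hsplit]
  rw [lintegral_add_right _ (by fun_prop), lintegral_const_mul' _ _ ENNReal.ofReal_ne_top, mul_add]
  refine add_le_add ?_ ?_
  · rw [mul_left_comm]
    refine mul_le_mul' le_rfl ?_
    refine (h P W Y hWm hY hW0 fun s hs => ?_).trans ?_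
    · rcases lt_or_ge s 1 with h1 | h1
      · refine measureReal_le_one.trans ?_
        have : 1 ≤ Real.exp (c / 4) * Real.exp (-(c / 4) * s ^ 2) := by
          rw [← Real.exp_add]
          refine Real.one_le_exp ?_
          have : s ^ 2 ≤ 1 := by nlinarith
          nlinarith
        refine this.trans ?_
        gcongr
        rw [hC1]
        have : 0 ≤ (A + 1) * 2 ^ p := by positivity
        linarith
      · set t := s * √R / 2 with htdef
        have ht0 : 0 < t := by positivity
        by_cases htx : t < x
        · have h2 := hsmall t ht0 htx
          have h3 := toReal_measure_lt_le_of_lintegral_excess hX hp0 ht0 (by positivity)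
            (ht t ht0.le)
          have e1 : -c * t ^ 2 / R = -(c / 4) * s ^ 2 := by
            rw [htdef, div_pow, mul_pow, Real.sq_sqrt hR.le]
            field_simp
            ring
          have e2 : t ^ p = s ^ p * R ^ (p / 2) / 2 ^ p := by
            rw [htdef, Real.div_rpow (by positivity) (by norm_num), Real.mul_rpow (by positivity)
              (by positivity), Real.sqrt_eq_rpow, ← Real.rpow_mul hR.le]
            congr 3
            ring
          have hsp : 1 ≤ s ^ p := Real.one_le_rpow h1 hp0.le
          calc (P {ω | s < W ω}).toReal ≤ (P {ω | 2 * t < |X ω|}).toReal := by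
                refine ENNReal.toReal_mono (measure_ne_top _ _) (measure_mono fun ω hω => ?_)
                have hω' : s < W ω := hω
                rw [lt_div_iff₀ hsR] at hω'
                change 2 * t < |X ω|
                split_ifs at hω' with h4
                · nlinarith
                · rw [htdef]; linarith
            _ ≤ _ := h3
            _ ≤ (A + 1) * (R ^ (p / 2) * Real.exp (-c * t ^ 2 / R)) / t ^ p := by
                gcongr
                linarith
            _ = ((A + 1) * 2 ^ p * Real.exp (-(c / 4) * s ^ 2)) / s ^ p := by
                rw [e1, e2]
                field_simp
            _ ≤ (A + 1) * 2 ^ p * Real.exp (-(c / 4) * s ^ 2) :=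
                div_le_self (by positivity) hsp
            _ ≤ _ := by
                gcongr
                rw [hC1]
                linarith [Real.exp_pos (c / 4)]
        · have : {ω | s < W ω} = ∅ := by
            ext ω
            simp only [Set.mem_ofPred_eq, Set.mem_empty_iff_false, iff_false, not_lt]
            simp only [hW]
            rw [div_le_iff₀ hsR]
            split_ifs with h4
            · positivity
            · linarith
          rw [this, measure_empty, ENNReal.toReal_zero]
          positivity
    · gcongr
      exact le_max_left _ _
  · have hZp : ∫⁻ ω, ENNReal.ofReal (Z ω ^ p) ∂P ≤ ENNReal.ofReal (B * (K * R)) := by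
      refine (lintegral_rpow_indicator_le_of_excess hp0).trans ?_
      have : B * (K * R) = 2 ^ p * ((A + 1) * (K * R)) := by rw [hB]; ring
      rw [this, ENNReal.ofReal_mul (by positivity)]
      refine mul_le_mul' le_rfl ((ht x hx0).trans (ENNReal.ofReal_le_ofReal ?_))
      have := mul_le_mul_of_nonneg_left hlarge hA
      linarith
    refine (lintegral_rpow_mul_le_holder hZm hY hZ0 hp (by positivity) hZp).trans ?_
    rw [Real.mul_rpow (x := B) (by positivity) (by positivity), ENNReal.ofReal_mul
      (by positivity), mul_assoc]
    exact mul_le_mul' (ENNReal.ofReal_le_ofReal (le_max_right _ _)) le_rfl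

end TailMoment

section Dyadic

lemma abs_sum_range_two_mul_sub_le {a c β : ℕ → ℝ} {m : ℕ} (hβ : ∀ q, 0 ≤ β q)
    (h : ∀ q < m, |a (2 * q) + a (2 * q + 1) - c q| ≤ β (2 * q)) :
    |∑ q ∈ Finset.range (2 * m), a q - ∑ q ∈ Finset.range m, c q|
      ≤ ∑ q ∈ Finset.range (2 * m), β q := by
  induction m with
  | zero => simp
  | succ m ih =>
    have h1 := ih fun q hq => h q (by lia)
    have h2 := h m (by lia)
    have e : 2 * (m + 1) = 2 * m + 1 + 1 := by ring
    rw [e, Finset.sum_range_succ, Finset.sum_range_succ, Finset.sum_range_succ (n := m),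
      Finset.sum_range_succ, Finset.sum_range_succ]
    have h3 := hβ (2 * m + 1)
    rw [abs_le] at h1 h2 ⊢
    constructor <;> linarith [h1.1, h1.2, h2.1, h2.2]

lemma abs_sum_range_sub_sum_range_half_le {a c β : ℕ → ℝ} {Q : ℕ} (hβ : ∀ q, 0 ≤ β q)
    (h : ∀ q, 2 * q + 1 < Q → |a (2 * q) + a (2 * q + 1) - c q| ≤ β (2 * q))
    (h' : ∀ q, 2 * q + 1 = Q → |a (2 * q)| ≤ β (2 * q)) :
    |∑ q ∈ Finset.range Q, a q - ∑ q ∈ Finset.range (Q / 2), c q|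
      ≤ ∑ q ∈ Finset.range Q, β q := by
  rcases Nat.even_or_odd' Q with ⟨m, rfl | rfl⟩
  · have : 2 * m / 2 = m := by lia
    rw [this]
    exact abs_sum_range_two_mul_sub_le hβ fun q hq => h q (by lia)
  · have : (2 * m + 1) / 2 = m := by lia
    rw [this, Finset.sum_range_succ, Finset.sum_range_succ]
    have h1 := abs_sum_range_two_mul_sub_le (a := a) (c := c) (m := m) hβ fun q hq => h q (by lia)
    have h2 := h' m rfl
    rw [abs_le] at h1 h2 ⊢
    constructor <;> linarith [h1.1, h1.2, h2.1, h2.2]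

lemma abs_sum_range_le_dyadic {a β : ℕ → ℕ → ℝ} {n : ℕ} (hβ : ∀ L q, 0 ≤ β L q)
    (h : ∀ L q, 2 * q + 1 < n / 2 ^ L → |a L (2 * q) + a L (2 * q + 1) - a (L + 1) q| ≤ β L (2 * q))
    (h' : ∀ L q, 2 * q + 1 = n / 2 ^ L → |a L (2 * q)| ≤ β L (2 * q)) {N : ℕ} (hN : n < 2 ^ N) :
    |∑ q ∈ Finset.range n, a 0 q| ≤
      ∑ L ∈ Finset.range N, ∑ q ∈ Finset.range (n / 2 ^ L), β L q := by
  have key : ∀ N, |∑ q ∈ Finset.range n, a 0 q| ≤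
      (∑ L ∈ Finset.range N, ∑ q ∈ Finset.range (n / 2 ^ L), β L q)
        + |∑ q ∈ Finset.range (n / 2 ^ N), a N q| := by
    intro N
    induction N with
    | zero => simp
    | succ N ih =>
      have h1 := abs_sum_range_sub_sum_range_half_le (hβ N) (h N) (h' N)
      rw [Nat.div_div_eq_div_mul, ← pow_succ] at h1
      rw [Finset.sum_range_succ]
      have h2 := abs_sub_abs_le_abs_sub (∑ q ∈ Finset.range (n / 2 ^ N), a N q)
        (∑ q ∈ Finset.range (n / 2 ^ (N + 1)), a (N + 1) q)
      linarith
  have := key N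
  rw [Nat.div_eq_of_lt hN] at this
  simpa using this

lemma exists_sum_dyadic_average_le {e : ℕ → ℝ} (he : ∀ m, 0 ≤ e m) {θ : ℝ} (hθ : 0 < θ)
    (hs : Summable fun m : ℕ => ((m : ℝ) + 1) ^ (-θ) * e (m + 1)) :
    ∃ B : ℝ, 0 ≤ B ∧ ∀ N, ∑ L ∈ Finset.range N,
      ((2 : ℝ) ^ L) ^ (-θ) * ∑ m ∈ Finset.range (2 ^ L), e (m + 1) ≤ B := by
  set ρ : ℝ := 2 ^ (-θ) with hρ
  have hρ0 : 0 < ρ := by positivity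
  have hρ1 : ρ < 1 := Real.rpow_lt_one_of_one_lt_of_neg (by norm_num) (by linarith)
  set x : ℕ → ℝ := fun L => ((2 : ℝ) ^ L) ^ (-θ) * ∑ m ∈ Finset.range (2 ^ L), e (m + 1) with hx
  set y : ℕ → ℝ := fun m => ((m : ℝ) + 1) ^ (-θ) * e (m + 1) with hy
  have hx0 : ∀ L, 0 ≤ x L := fun L => mul_nonneg (by positivity)
    (Finset.sum_nonneg fun m _ => he _)
  have hy0 : ∀ m, 0 ≤ y m := fun m => mul_nonneg (by positivity) (he _)
  have key : ∀ N, (∑ L ∈ Finset.range (N + 1), x L) * (1 - ρ) + ρ * x N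
      ≤ ∑ m ∈ Finset.range (2 ^ N), y m := by
    intro N
    induction N with
    | zero => simp [hx, hy]; linarith
    | succ N ih =>
      have hstep : x (N + 1) ≤ ρ * x N + ∑ m ∈ Finset.Ico (2 ^ N) (2 ^ (N + 1)), y m := by
        have e1 : ((2 : ℝ) ^ (N + 1)) ^ (-θ) = ρ * ((2 : ℝ) ^ N) ^ (-θ) := by
          rw [pow_succ, Real.mul_rpow (by positivity) (by norm_num), mul_comm]
        simp only [hx]
        rw [← Finset.sum_range_add_sum_Ico (fun m => e (m + 1))
          (Nat.pow_le_pow_right two_pos N.le_succ), mul_add]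
        refine add_le_add (by rw [e1, mul_assoc]) ?_
        rw [Finset.mul_sum]
        refine Finset.sum_le_sum fun m hm => ?_
        refine mul_le_mul_of_nonneg_right ?_ (he _)
        refine Real.rpow_le_rpow_of_nonpos (by positivity) ?_ (by linarith)
        have := (Finset.mem_Ico.1 hm).2
        exact_mod_cast this
      rw [Finset.sum_range_succ, ← Finset.sum_range_add_sum_Ico y
          (Nat.pow_le_pow_right two_pos N.le_succ)]
      linarith
  refine ⟨(∑' m, y m) / (1 - ρ), div_nonneg (tsum_nonneg hy0) (by linarith), fun N => ?_⟩
  rw [le_div_iff₀ (by linarith)]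
  have h1 := key N
  have h2 := hs.sum_le_tsum (Finset.range (2 ^ N)) fun m _ => hy0 m
  rw [Finset.sum_range_succ] at h1
  have := hx0 N
  nlinarith

end Dyadic

section GaussianExcess

variable {D : ℕ}

lemma exists_integral_excess_le (γ : Measure (EuclideanSpace ℝ (Fin D))) [IsGaussian γ] {p : ℝ}
    (hp : 0 < p) : ∃ c A : ℝ, 0 < c ∧ 0 ≤ A ∧ ∀ (i : Fin D) (R t : ℝ), 0 < R → 0 ≤ t →
      ∫ y, max (|√R * y i| - t) 0 ^ p ∂γ ≤ A * (R ^ (p / 2) * Real.exp (-c * t ^ 2 / R)) := by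
  obtain ⟨C, hC, hint⟩ := IsGaussian.exists_integrable_exp_sq γ
  have hint2 := IsGaussian.integrable_one_add_norm_rpow γ (q := 2 * p) (by positivity)
  set q : EuclideanSpace ℝ (Fin D) → ℝ := fun y =>
    (1 + ‖y‖) ^ (2 * p) + Real.exp (C * ‖y‖ ^ 2) with hq
  have hqi : Integrable q γ := hint2.add hint
  refine ⟨C / 2, ∫ y, q y ∂γ, by positivity, integral_nonneg fun y => by positivity,
    fun i R t hR ht => ?_⟩
  rw [mul_comm, ← integral_const_mul]
  refine integral_mono_of_nonneg (ae_of_all _ fun y => by positivity) (hqi.const_mul _)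
    (ae_of_all _ fun y => ?_)
  have hy : |y i| ≤ ‖y‖ := by simpa using PiLp.norm_apply_le y i
  have hab : ‖y‖ ^ p * Real.exp (C / 2 * ‖y‖ ^ 2) ≤ q y := by
    have h1 : ‖y‖ ^ p ≤ (1 + ‖y‖) ^ p := by gcongr; linarith
    have h2 : (1 + ‖y‖) ^ (2 * p) = ((1 + ‖y‖) ^ p) ^ 2 := by
      rw [← Real.rpow_natCast, ← Real.rpow_mul (by positivity)]
      congr 1
      push_cast
      ring
    have h3 : Real.exp (C * ‖y‖ ^ 2) = Real.exp (C / 2 * ‖y‖ ^ 2) ^ 2 := by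
      rw [← Real.exp_nat_mul]
      congr 1
      push_cast
      ring
    simp only [hq]
    rw [h2, h3]
    have h4 : ‖y‖ ^ p * Real.exp (C / 2 * ‖y‖ ^ 2)
      ≤ (1 + ‖y‖) ^ p * Real.exp (C / 2 * ‖y‖ ^ 2) := by gcongr
    nlinarith [sq_nonneg ((1 + ‖y‖) ^ p - Real.exp (C / 2 * ‖y‖ ^ 2)),
      sq_nonneg ((1 + ‖y‖) ^ p), sq_nonneg (Real.exp (C / 2 * ‖y‖ ^ 2))]
  have hsR : 0 < √R := Real.sqrt_pos.2 hR
  have hRp : R ^ (p / 2) = √R ^ p := by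
    rw [Real.sqrt_eq_rpow, ← Real.rpow_mul hR.le]
    congr 1
    ring
  simp only
  rw [abs_mul, abs_of_pos hsR]
  rcases le_or_gt (√R * |y i|) t with h | h
  · rw [max_eq_right (by linarith), Real.zero_rpow hp.ne']
    have : 0 ≤ q y := by positivity
    positivity
  · have h1 : t ≤ √R * ‖y‖ := h.le.trans (by gcongr)
    have h2 : t ^ 2 ≤ R * ‖y‖ ^ 2 := by
      calc t ^ 2 ≤ (√R * ‖y‖) ^ 2 := by gcongr
        _ = _ := by rw [mul_pow, Real.sq_sqrt hR.le]
    have h3 : 1 ≤ Real.exp (-(C / 2) * t ^ 2 / R) * Real.exp (C / 2 * ‖y‖ ^ 2) := by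
      rw [← Real.exp_add]
      refine Real.one_le_exp ?_
      have : t ^ 2 / R ≤ ‖y‖ ^ 2 := by rw [div_le_iff₀ hR]; linarith
      rw [neg_mul, neg_div, mul_div_assoc]
      nlinarith
    calc max (√R * |y i| - t) 0 ^ p ≤ (√R * ‖y‖) ^ p := by
          refine Real.rpow_le_rpow (le_max_right _ _) (max_le ?_ (by positivity)) hp.le
          have : √R * |y i| ≤ √R * ‖y‖ := by gcongr
          linarith
      _ = R ^ (p / 2) * ‖y‖ ^ p * 1 := by rw [Real.mul_rpow hsR.le (norm_nonneg _), hRp, mul_one]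
      _ ≤ R ^ (p / 2) * ‖y‖ ^ p * (Real.exp (-(C / 2) * t ^ 2 / R)
          * Real.exp (C / 2 * ‖y‖ ^ 2)) := by gcongr
      _ = R ^ (p / 2) * Real.exp (-(C / 2) * t ^ 2 / R)
          * (‖y‖ ^ p * Real.exp (C / 2 * ‖y‖ ^ 2)) := by ring
      _ ≤ _ := by gcongr

end GaussianExcess

section StationaryMDS

/-- Stationary martingale differences with a finite moment of order `p`. -/
structure StationaryMDS {Ω : Type*} [mΩ : MeasurableSpace Ω] {D : ℕ} (P : Measure Ω) (p : ℝ)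
    (ℱ : ℤ → MeasurableSpace Ω) (d : ℤ → Ω → EuclideanSpace ℝ (Fin D)) : Prop where
  mono : Monotone ℱ
  le : ∀ n, ℱ n ≤ mΩ
  adapted : ∀ n, StronglyMeasurable[ℱ n] (d n)
  integrable : ∀ n, Integrable (d n) P
  condExp_eq : ∀ n, P[d n | ℱ (n - 1)] =ᵐ[P] 0
  stationary : ∀ k : ℤ, Measure.map (fun ω => fun n : ℤ => d (n + k) ω) P
    = Measure.map (fun ω => fun n : ℤ => d n ω) P
  memLp_zero : MemLp (d 0) (ENNReal.ofReal p) P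

/-- The past `(d_b, d_{b-1}, …)` of a sequence at time `b`. -/
def past {Ω E : Type*} (d : ℤ → Ω → E) (b : ℤ) (ω : Ω) (j : ℕ) : E := d (b - j) ω

/-- The coordinates of `x xᵗ - S`. -/
def centeredProd {D : ℕ} (S : Fin D → Fin D → ℝ) (i j : Fin D) (x : EuclideanSpace ℝ (Fin D)) : ℝ :=
  x i * x j - S i j

lemma norm_rpow_le_sum_abs_rpow {D : ℕ} (x : EuclideanSpace ℝ (Fin D)) {q : ℝ} (hq : 0 < q)
    (hq1 : q ≤ 1) : ‖x‖ ^ q ≤ ∑ i, |x i| ^ q := by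
  have h1 : ‖x‖ ≤ ∑ i, |x i| := by
    have : x = ∑ i, x i • EuclideanSpace.single i (1 : ℝ) := by
      ext j
      simp [Pi.single_apply]
    conv_lhs => rw [this]
    refine (norm_sum_le _ _).trans (Finset.sum_le_sum fun i _ => ?_)
    simp [norm_smul]
  refine (Real.rpow_le_rpow (norm_nonneg _) h1 hq.le).trans ?_
  exact Finset.le_sum_of_subadditive_on_pred (fun y : ℝ => y ^ q) (fun y => 0 ≤ y)
    (by simp [Real.zero_rpow hq.ne'])
    (fun y z hy hz => Real.rpow_add_le_add_rpow hy hz hq.le hq1) (fun y z => add_nonneg)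
    _ fun i _ => abs_nonneg _

variable {Ω : Type*} [mΩ : MeasurableSpace Ω] {P : Measure Ω}

lemma rpow_mul_mul_le_add {p a b c : ℝ} (hp : 2 < p) (ha : 0 ≤ a) (hb : 0 ≤ b) (hc : 0 ≤ c) :
    a ^ (p - 2) * (b * c) ≤ a ^ p + b ^ p + c ^ p := by
  set m := max a (max b c) with hm
  have hma : a ≤ m := le_max_left _ _
  have hmb : b ≤ m := (le_max_left _ _).trans (le_max_right _ _)
  have hmc : c ≤ m := (le_max_right _ _).trans (le_max_right _ _)
  have hm0 : 0 ≤ m := ha.trans hma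
  have h1 : a ^ (p - 2) * (b * c) ≤ m ^ (p - 2) * (m * m) := by
    have : 0 ≤ p - 2 := by linarith
    gcongr
  have h2 : m ^ (p - 2) * (m * m) = m ^ p := by
    rw [← sq, ← Real.rpow_two, ← Real.rpow_add' hm0 (by linarith)]
    congr 1
    ring
  have h3 : m ^ p ≤ a ^ p + b ^ p + c ^ p := by
    have ha' : 0 ≤ a ^ p := by positivity
    have hb' : 0 ≤ b ^ p := by positivity
    have hc' : 0 ≤ c ^ p := by positivity
    rcases max_choice a (max b c) with h | h <;> rw [← hm] at h
    · rw [h]; linarith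
    · rcases max_choice b c with h' | h' <;> rw [h'] at h <;> rw [h] <;> linarith
  linarith

lemma integrable_rpow_mul_mul [IsFiniteMeasure P] {E E' E'' : Type*} [NormedAddCommGroup E]
    [NormedAddCommGroup E'] [NormedAddCommGroup E''] {X : Ω → E} {Y : Ω → E'} {Z : Ω → E''} {p : ℝ}
    (hp : 2 < p) (hX : MemLp X (ENNReal.ofReal p) P) (hY : MemLp Y (ENNReal.ofReal p) P)
    (hZ : MemLp Z (ENNReal.ofReal p) P) :
    Integrable (fun ω => ‖X ω‖ ^ (p - 2) * (‖Y ω‖ * ‖Z ω‖)) P := by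
  have hp0 : 0 ≤ p := by linarith
  refine (((hX.integrable_norm_rpow_of_le hp0 le_rfl).add
    (hY.integrable_norm_rpow_of_le hp0 le_rfl)).add
    (hZ.integrable_norm_rpow_of_le hp0 le_rfl)).mono' ?_ (ae_of_all _ fun ω => ?_)
  · have h1 := hX.1.norm
    have h2 := hY.1.norm
    have h3 := hZ.1.norm
    exact (h1.aemeasurable.pow_const _).aestronglyMeasurable.mul (h2.mul h3)
  · rw [Real.norm_of_nonneg (by positivity)]
    exact rpow_mul_mul_le_add hp (norm_nonneg _) (norm_nonneg _) (norm_nonneg _)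

namespace StationaryMDS

variable {D : ℕ} {p : ℝ} {ℱ : ℤ → MeasurableSpace Ω} {d : ℤ → Ω → EuclideanSpace ℝ (Fin D)}

section
variable (h : StationaryMDS P p ℱ d)
include h

lemma measurable (k : ℤ) : Measurable (d k) := ((h.adapted k).mono (h.le k)).measurable

lemma measurable_path (k : ℤ) : Measurable (fun ω => fun n : ℤ => d (n + k) ω) :=
  measurable_pi_lambda _ fun n => h.measurable (n + k)

lemma integral_shift {Φ : (ℤ → EuclideanSpace ℝ (Fin D)) → ℝ} (hΦ : Measurable Φ) (k : ℤ) :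
    ∫ ω, Φ (fun n => d (n + k) ω) ∂P = ∫ ω, Φ (fun n => d n ω) ∂P := by
  have h0 : Measurable (fun ω => fun n : ℤ => d n ω) :=
    measurable_pi_lambda _ fun n => h.measurable n
  rw [← integral_map (h.measurable_path k).aemeasurable hΦ.aestronglyMeasurable,
    ← integral_map h0.aemeasurable hΦ.aestronglyMeasurable, h.stationary k]

lemma map_eq (k : ℤ) : P.map (d k) = P.map (d 0) := by
  have h0 : Measurable (fun ω => fun n : ℤ => d n ω) :=
    measurable_pi_lambda _ fun n => h.measurable n
  have := congrArg (fun μ => Measure.map (fun x : ℤ → EuclideanSpace ℝ (Fin D) => x 0) μ)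
    (h.stationary k)
  rw [Measure.map_map (measurable_pi_apply 0) (h.measurable_path k),
    Measure.map_map (measurable_pi_apply 0) h0] at this
  simpa [Function.comp_def] using this

lemma identDistrib (k : ℤ) : IdentDistrib (d k) (d 0) P P :=
  ⟨(h.measurable k).aemeasurable, (h.measurable 0).aemeasurable, h.map_eq k⟩

lemma memLp (k : ℤ) : MemLp (d k) (ENNReal.ofReal p) P :=
  (h.identDistrib k).symm.memLp_snd h.memLp_zero

lemma integral_comp_eq (k : ℤ) {f : EuclideanSpace ℝ (Fin D) → ℝ} (hf : Measurable f) :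
    ∫ ω, f (d k ω) ∂P = ∫ ω, f (d 0 ω) ∂P :=
  ((h.identDistrib k).comp hf).integral_eq

lemma measurable_of_le {a b : ℤ} (hab : a ≤ b) : Measurable[ℱ b] (d a) :=
  ((h.adapted a).mono (h.mono hab)).measurable

lemma measurable_past (b : ℤ) : Measurable[ℱ b] (past d b) :=
  @measurable_pi_lambda _ _ _ (ℱ b) _ _ fun j => h.measurable_of_le (by lia)

lemma stronglyMeasurable_comp_past {ζ : (ℕ → EuclideanSpace ℝ (Fin D)) → ℝ} (hζ : Measurable ζ)
    {a b : ℤ} (hab : a ≤ b) : StronglyMeasurable[ℱ b] (fun ω => ζ (past d a ω)) :=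
  ((hζ.comp (h.measurable_past a)).stronglyMeasurable).mono (h.mono hab)

lemma measurable_past' (b : ℤ) : Measurable (past d b) := (h.measurable_past b).mono (h.le b) le_rfl

lemma integral_past_shift {ζ : (ℕ → EuclideanSpace ℝ (Fin D)) → ℝ} (hζ : Measurable ζ)
    {q : EuclideanSpace ℝ (Fin D) → ℝ} (hq : Measurable q) (b k s : ℤ) :
    ∫ ω, ζ (past d (b + s) ω) * q (d (k + s) ω) ∂P = ∫ ω, ζ (past d b ω) * q (d k ω) ∂P := by
  have h1 : Measurable fun x : ℤ → EuclideanSpace ℝ (Fin D) => fun j : ℕ => x (b - j) :=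
    measurable_pi_lambda _ fun j => measurable_pi_apply _
  have h2 : Measurable fun x : ℤ → EuclideanSpace ℝ (Fin D) => x k := measurable_pi_apply k
  have := h.integral_shift ((hζ.comp h1).mul (hq.comp h2)) s
  refine Eq.trans (integral_congr_ae (ae_of_all _ fun ω => ?_)) this
  change ζ (past d (b + s) ω) * q (d (k + s) ω)
    = ζ (fun j : ℕ => d (b - j + s) ω) * q (d (k + s) ω)
  congr 2
  funext j
  rw [past, show b + s - (j : ℤ) = b - j + s by ring]

lemma integral_comp_past_shift {ζ : (ℕ → EuclideanSpace ℝ (Fin D)) → ℝ} (hζ : Measurable ζ)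
    (b s : ℤ) : ∫ ω, ζ (past d (b + s) ω) ∂P = ∫ ω, ζ (past d b ω) ∂P := by
  simpa using h.integral_past_shift hζ (q := fun _ => 1) measurable_const b 0 s

lemma condExp_coord [IsFiniteMeasure P] {m k : ℤ} (hmk : m < k) (i : Fin D) :
    P[fun ω => d k ω i | ℱ m] =ᵐ[P] 0 := by
  have h1 := (EuclideanSpace.proj i : EuclideanSpace ℝ (Fin D) →L[ℝ] ℝ).comp_condExp_comm
    (m := ℱ (k - 1)) (h.integrable k)
  have h2 : P[fun ω => d k ω i | ℱ (k - 1)] =ᵐ[P] 0 := by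
    refine h1.symm.trans ?_
    filter_upwards [h.condExp_eq k] with ω hω
    simp [hω]
  have h3 := condExp_condExp_of_le (μ := P) (f := fun ω => d k ω i)
    (h.mono (show m ≤ k - 1 by lia)) (h.le (k - 1))
  refine h3.symm.trans ((condExp_congr_ae h2).trans ?_)
  rw [show (0 : Ω → ℝ) = fun _ => 0 from rfl]
  exact (condExp_zero (E := ℝ) (m := ℱ m) (μ := P)).eventuallyEq

lemma integrable_coord (k : ℤ) (i : Fin D) : Integrable (fun ω => d k ω i) P :=
  (EuclideanSpace.proj i : EuclideanSpace ℝ (Fin D) →L[ℝ] ℝ).integrable_comp (h.integrable k)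

lemma integral_mul_coord_eq_zero [IsFiniteMeasure P] {m k : ℤ} (hmk : m < k) (i : Fin D) {Z : Ω → ℝ}
    (hZ : StronglyMeasurable[ℱ m] Z) (hint : Integrable (fun ω => Z ω * d k ω i) P) :
    ∫ ω, Z ω * d k ω i ∂P = 0 := by
  have h1 := condExp_mul_of_stronglyMeasurable_left (μ := P) hZ hint (h.integrable_coord k i)
  rw [← integral_condExp (h.le m)]
  refine (integral_congr_ae (h1.trans (EventuallyEq.rfl.mul (h.condExp_coord hmk i)))).trans ?_
  simp

lemma integral_mul_mul_eq_zero_of_lt [IsFiniteMeasure P] {a k l : ℤ} (hak : a ≤ k) (hkl : k < l)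
    (i j : Fin D) {Z : Ω → ℝ} (hZ : StronglyMeasurable[ℱ a] Z)
    (hint : Integrable (fun ω => Z ω * (d k ω i * d l ω j)) P) :
    ∫ ω, Z ω * (d k ω i * d l ω j) ∂P = 0 := by
  simp_rw [← mul_assoc] at hint ⊢
  refine h.integral_mul_coord_eq_zero hkl j ?_ hint
  refine (hZ.mono (h.mono hak)).mul ?_
  have hc : Continuous fun x : EuclideanSpace ℝ (Fin D) => x i := by fun_prop
  exact hc.comp_stronglyMeasurable (h.adapted k)

lemma integral_mul_mul_eq_zero [IsFiniteMeasure P] {a k l : ℤ} (hak : a ≤ k) (hal : a ≤ l)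
    (hkl : k ≠ l) (i j : Fin D) {Z : Ω → ℝ} (hZ : StronglyMeasurable[ℱ a] Z)
    (hint : Integrable (fun ω => Z ω * (d k ω i * d l ω j)) P) :
    ∫ ω, Z ω * (d k ω i * d l ω j) ∂P = 0 := by
  rcases hkl.lt_or_gt with hlt | hgt
  · exact h.integral_mul_mul_eq_zero_of_lt hak hlt i j hZ hint
  · simp_rw [mul_comm (d k _ i)] at hint ⊢
    exact h.integral_mul_mul_eq_zero_of_lt hal hgt j i hZ hint

end

end StationaryMDS

end StationaryMDS

section PartialSum

variable {Ω : Type*} {D : ℕ}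

lemma partialSum_eq_sum_range (d : ℤ → Ω → EuclideanSpace ℝ (Fin D)) (n : ℕ) (ω : Ω) :
    partialSum d n ω = ∑ k ∈ Finset.range n, d (k + 1) ω := by
  induction n with
  | zero => simp [partialSum]
  | succ n ih =>
    rw [Finset.sum_range_succ, ← ih, partialSum, partialSum, Nat.cast_succ,
      ← Finset.insert_Icc_right_eq_Icc_add_one (by lia), Finset.sum_insert (by simp), add_comm]

lemma partialSum_succ (d : ℤ → Ω → EuclideanSpace ℝ (Fin D)) (n : ℕ) (ω : Ω) :
    partialSum d (n + 1) ω = partialSum d n ω + d (n + 1) ω := by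
  rw [partialSum_eq_sum_range, partialSum_eq_sum_range, Finset.sum_range_succ]

lemma partialSum_eq_sum_past (d : ℤ → Ω → EuclideanSpace ℝ (Fin D)) (n : ℕ) (ω : Ω) :
    partialSum d n ω = ∑ j ∈ Finset.range n, past d n ω j := by
  rw [partialSum_eq_sum_range, ← Finset.sum_range_reflect]
  refine Finset.sum_congr rfl fun k hk => ?_
  have := Finset.mem_range.1 hk
  rw [past]
  congr 1
  lia

end PartialSum

section ConditionalVariance

variable {Ω : Type*} [mΩ : MeasurableSpace Ω] {D : ℕ}

/-- The coordinates of `E(M_n M_nᵗ | ℱ₀) - E(M_n M_nᵗ)`. -/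
def condDev (P : Measure Ω) (ℱ : ℤ → MeasurableSpace Ω) (d : ℤ → Ω → EuclideanSpace ℝ (Fin D))
    (n : ℕ) (i j : Fin D) (ω : Ω) : ℝ :=
  (P[fun ω' => partialSum d n ω' i * partialSum d n ω' j | ℱ 0]) ω
    - ∫ ω', partialSum d n ω' i * partialSum d n ω' j ∂P

/-- The covariance matrix of `d_0`. -/
def covMat (P : Measure Ω) (d : ℤ → Ω → EuclideanSpace ℝ (Fin D)) (i j : Fin D) : ℝ :=
  ∫ ω, d 0 ω i * d 0 ω j ∂P

variable {P : Measure Ω} {p : ℝ} {ℱ : ℤ → MeasurableSpace Ω}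
  {d : ℤ → Ω → EuclideanSpace ℝ (Fin D)}

namespace StationaryMDS

variable (h : StationaryMDS P p ℱ d)
include h

lemma memLp_partialSum (n : ℕ) : MemLp (partialSum d n) (ENNReal.ofReal p) P :=
  memLp_finsetSum (μ := P) (Finset.Icc (1 : ℤ) n) fun k _ => h.memLp k

lemma memLp_sum_past (r : ℕ) (a : ℤ) :
    MemLp (fun ω => ∑ j ∈ Finset.range r, past d a ω j) (ENNReal.ofReal p) P :=
  memLp_finsetSum _ fun j _ => h.memLp (a - j)

lemma memLp_two [IsFiniteMeasure P] (hp : 2 < p) (k : ℤ) (i : Fin D) :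
    MemLp (fun ω => d k ω i) 2 P := by
  have h1 : MemLp (d k) 2 P := (h.memLp k).mono_exponent (by
    rw [show (2 : ℝ≥0∞) = ENNReal.ofReal 2 by simp]
    exact ENNReal.ofReal_le_ofReal hp.le)
  refine h1.mono ?_ (ae_of_all _ fun ω => by simpa using PiLp.norm_apply_le (d k ω) i)
  have hc : Continuous fun x : EuclideanSpace ℝ (Fin D) => x i := by fun_prop
  exact hc.comp_aestronglyMeasurable h1.1

lemma integrable_mul_coord [IsFiniteMeasure P] (hp : 2 < p) (k l : ℤ) (i j : Fin D) :
    Integrable (fun ω => d k ω i * d l ω j) P :=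
  (h.memLp_two hp k i).integrable_mul (h.memLp_two hp l j)

lemma integral_mul_self (k : ℤ) (i j : Fin D) :
    ∫ ω, d k ω i * d k ω j ∂P = covMat P d i j :=
  h.integral_comp_eq k (f := fun x => x i * x j) (by fun_prop)

/-- Integrability of functionals of the past of polynomial growth against products. -/
lemma integrable_comp_past_mul_mul [IsFiniteMeasure P] (hp : 2 < p)
    {ζ : (ℕ → EuclideanSpace ℝ (Fin D)) → ℝ} (hζ : Measurable ζ) {r : ℕ} {c : ℝ}
    (hb : ∀ x, |ζ x| ≤ ‖∑ j ∈ Finset.range r, x j‖ ^ (p - 2) + c) (a k l : ℤ) (i j : Fin D) :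
    Integrable (fun ω => ζ (past d a ω) * (d k ω i * d l ω j)) P := by
  have h1 := integrable_rpow_mul_mul hp (h.memLp_sum_past r a) (h.memLp k) (h.memLp l)
  have h2 := (h.integrable_mul_coord hp k l i j).norm.const_mul c
  have hm : Measurable fun ω => ζ (past d a ω) := hζ.comp (h.measurable_past' a)
  refine (h1.add h2).mono' (hm.aestronglyMeasurable.mul
    (h.integrable_mul_coord hp k l i j).1) (ae_of_all _ fun ω => ?_)
  have e1 := hb (past d a ω)
  have e2 : ‖d k ω i * d l ω j‖ ≤ ‖d k ω‖ * ‖d l ω‖ := by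
    rw [norm_mul]
    exact mul_le_mul (PiLp.norm_apply_le _ _) (PiLp.norm_apply_le _ _) (norm_nonneg _)
      (norm_nonneg _)
  rw [norm_mul, Real.norm_eq_abs (ζ _)]
  calc _ ≤ (‖∑ j ∈ Finset.range r, past d a ω j‖ ^ (p - 2) + c) * ‖d k ω i * d l ω j‖ := by gcongr
    _ = ‖∑ j ∈ Finset.range r, past d a ω j‖ ^ (p - 2) * ‖d k ω i * d l ω j‖
      + c * ‖d k ω i * d l ω j‖ := by ring
    _ ≤ _ := by
      simp only [Pi.add_apply]
      gcongr

lemma integral_mul_partialSum [IsFiniteMeasure P] {Z : Ω → ℝ} (hZ : StronglyMeasurable[ℱ 0] Z)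
    (i j : Fin D) (hint : ∀ k l : ℤ, Integrable (fun ω => Z ω * (d k ω i * d l ω j)) P) (n : ℕ) :
    Integrable (fun ω => Z ω * (partialSum d n ω i * partialSum d n ω j)) P ∧
    ∫ ω, Z ω * (partialSum d n ω i * partialSum d n ω j) ∂P
      = ∑ k ∈ Finset.range n, ∫ ω, Z ω * (d (k + 1) ω i * d (k + 1) ω j) ∂P := by
  have hexp : (fun ω => Z ω * (partialSum d n ω i * partialSum d n ω j)) = fun ω =>
      ∑ k ∈ Finset.range n, ∑ l ∈ Finset.range n, Z ω * (d (k + 1) ω i * d (l + 1) ω j) := by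
    funext ω
    simp only [partialSum_eq_sum_range, WithLp.ofLp_sum, Finset.sum_apply]
    rw [Finset.sum_mul_sum, Finset.mul_sum]
    exact Finset.sum_congr rfl fun k _ => Finset.mul_sum _ _ _
  rw [hexp]
  refine ⟨integrable_finsetSum _ fun k _ => integrable_finsetSum _ fun l _ => hint _ _, ?_⟩
  rw [integral_finsetSum _ fun k _ => integrable_finsetSum _ fun l _ => hint _ _]
  refine Finset.sum_congr rfl fun k hk => ?_
  rw [integral_finsetSum _ fun l _ => hint _ _]
  refine Finset.sum_eq_single k (fun l _ hlk => ?_) (fun hk' => absurd hk hk')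
  exact h.integral_mul_mul_eq_zero (by lia) (by lia) (by lia) i j hZ (hint _ _)

/-- Correlations of the past with the centered squares, through the conditional variances. -/
lemma sum_integral_mul_centeredProd [IsProbabilityMeasure P] (hp : 2 < p) {Z : Ω → ℝ}
    (hZ : StronglyMeasurable[ℱ 0] Z) (hZi : Integrable Z P)
    (i j : Fin D) (hint : ∀ k l : ℤ, Integrable (fun ω => Z ω * (d k ω i * d l ω j)) P) (n : ℕ) :
    ∑ k ∈ Finset.range n, ∫ ω, Z ω * centeredProd (covMat P d) i j (d (k + 1) ω) ∂P
      = ∫ ω, Z ω * condDev P ℱ d n i j ω ∂P := by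
  obtain ⟨h1, h2⟩ := h.integral_mul_partialSum hZ i j hint n
  obtain ⟨h3, h4⟩ := h.integral_mul_partialSum (Z := fun _ => 1) stronglyMeasurable_const i j
    (fun k l => by simpa using h.integrable_mul_coord hp k l i j) n
  simp only [one_mul] at h3 h4
  have h5 : ∫ ω, partialSum d n ω i * partialSum d n ω j ∂P = n * covMat P d i j := by
    rw [h4]
    simp [h.integral_mul_self]
  have h6 := condExp_mul_of_stronglyMeasurable_left (μ := P) (m := ℱ 0) hZ h1 h3
  have h7 : Integrable (fun ω => Z ω *
      (P[fun ω' => partialSum d n ω' i * partialSum d n ω' j | ℱ 0]) ω) P :=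
    integrable_condExp.congr h6
  have h8 : ∫ ω, Z ω * (P[fun ω' => partialSum d n ω' i * partialSum d n ω' j | ℱ 0]) ω ∂P
      = ∫ ω, Z ω * (partialSum d n ω i * partialSum d n ω j) ∂P := by
    rw [← integral_condExp (h.le 0) (f := fun ω => Z ω * (partialSum d n ω i * partialSum d n ω j))]
    exact (integral_congr_ae h6).symm
  simp only [condDev, centeredProd, mul_sub]
  rw [integral_sub h7 (hZi.mul_const _), h8, h2, h5, integral_mul_const]
  rw [Finset.sum_congr rfl fun k _ => integral_sub (hint _ _) (hZi.mul_const _),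
    Finset.sum_sub_distrib]
  simp only [integral_mul_const, Finset.sum_const, Finset.card_range, nsmul_eq_mul]
  ring

lemma measurable_condDev (n : ℕ) (i j : Fin D) : Measurable (condDev P ℱ d n i j) :=
  (stronglyMeasurable_condExp.mono (h.le 0)).measurable.sub measurable_const

end StationaryMDS

end ConditionalVariance

section PastCorrelation

variable {Ω : Type*} [mΩ : MeasurableSpace Ω] {D : ℕ}

/-- A bound on the `p`-th moments of the excesses of the coordinates of `M_r`. -/
def ExcessBound (P : Measure Ω) (p : ℝ) (d : ℤ → Ω → EuclideanSpace ℝ (Fin D)) (A c K : ℝ)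
    (r : ℕ) : Prop :=
  ∀ (i : Fin D) (t : ℝ), 0 ≤ t → ∫ ω, max (|partialSum d r ω i| - t) 0 ^ p ∂P
    ≤ A * ((r : ℝ) ^ (p / 2) * Real.exp (-c * t ^ 2 / r)) + K * r

variable {P : Measure Ω} {p : ℝ} {ℱ : ℤ → MeasurableSpace Ω}
  {d : ℤ → Ω → EuclideanSpace ℝ (Fin D)}

lemma rpow_mul_exp_neg_div_mono {p c t : ℝ} (hp : 0 < p) (hc : 0 ≤ c) {r R : ℕ} (hr : r ≤ R) :
    (r : ℝ) ^ (p / 2) * Real.exp (-c * t ^ 2 / r) ≤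
      (R : ℝ) ^ (p / 2) * Real.exp (-c * t ^ 2 / R) := by
  rcases Nat.eq_zero_or_pos r with rfl | hr0
  · rw [Nat.cast_zero, Real.zero_rpow (by positivity), zero_mul]
    positivity
  · have h0 : (0 : ℝ) < r := by exact_mod_cast hr0
    have h1 : (r : ℝ) ≤ R := by exact_mod_cast hr
    have h2 : -c * t ^ 2 / r ≤ -c * t ^ 2 / R := by
      have : c * t ^ 2 / R ≤ c * t ^ 2 / r := by gcongr
      calc -c * t ^ 2 / r = -(c * t ^ 2 / r) := by ring
        _ ≤ -(c * t ^ 2 / R) := by linarith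
        _ = _ := by ring
    have h3 := Real.exp_le_exp.2 h2
    gcongr

lemma abs_integral_le_toReal_lintegral {f : Ω → ℝ} (hf : ∫⁻ ω, ENNReal.ofReal |f ω| ∂P ≠ ⊤) :
    |∫ ω, f ω ∂P| ≤ (∫⁻ ω, ENNReal.ofReal |f ω| ∂P).toReal := by
  rw [← ENNReal.ofReal_le_iff_le_toReal hf]
  have := enorm_integral_le_lintegral_enorm (μ := P) f
  simpa [Real.enorm_eq_ofReal_abs] using this

lemma exists_lintegral_abs_le_envNorm {p : ℝ} (hp : 2 < p) :
    ∃ C : ℝ, 0 ≤ C ∧ ∀ (P : Measure Ω) [IsProbabilityMeasure P] (Y : Ω → ℝ), Measurable Y →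
      ∫⁻ ω, ENNReal.ofReal |Y ω| ∂P ≤ ENNReal.ofReal C * envNorm P p Y := by
  obtain ⟨C, hC, h⟩ := exists_lintegral_rpow_mul_le_envNorm (Ω := Ω) hp one_pos (Real.exp_pos 1)
  refine ⟨C, hC, fun P _ Y hY => ?_⟩
  have := h P (fun _ => 1) Y measurable_const hY (fun _ => zero_le_one) fun s hs => by
    rcases lt_or_ge s 1 with h1 | h1
    · refine measureReal_le_one.trans ?_
      rw [← Real.exp_add]
      exact Real.one_le_exp (by nlinarith)
    · have : {ω : Ω | s < 1} = ∅ := by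
        ext ω
        simpa using h1
      rw [this]
      simp only [measure_empty, ENNReal.toReal_zero]
      positivity
  simpa using this

namespace StationaryMDS

lemma integrable_excess [IsFiniteMeasure P] {X : Ω → EuclideanSpace ℝ (Fin D)} (hp : 0 < p)
    (hX : MemLp X (ENNReal.ofReal p) P) (i : Fin D) {t : ℝ} (ht : 0 ≤ t) :
    Integrable (fun ω => max (|X ω i| - t) 0 ^ p) P := by
  refine (hX.integrable_norm_rpow_of_le hp.le le_rfl).mono' ?_ (ae_of_all _ fun ω => ?_)
  · have hc : Continuous fun x : EuclideanSpace ℝ (Fin D) => max (|x i| - t) 0 ^ p :=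
      Continuous.rpow_const (by fun_prop) fun _ => Or.inr hp.le
    exact hc.comp_aestronglyMeasurable hX.1
  · rw [Real.norm_of_nonneg (by positivity)]
    have h1 : |X ω i| ≤ ‖X ω‖ := by simpa using PiLp.norm_apply_le (X ω) i
    refine Real.rpow_le_rpow (by positivity) (max_le (by linarith) (norm_nonneg _)) hp.le

variable (h : StationaryMDS P p ℱ d)
include h

lemma lintegral_excess_le [IsProbabilityMeasure P] (hp : 0 < p) {A c K : ℝ} (hA : 0 ≤ A)
    (hc : 0 ≤ c) (hK : 0 ≤ K) {r R : ℕ} (hr : r ≤ R) (hE : ExcessBound P p d A c K r) (a : ℤ)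
    (i : Fin D) {t : ℝ} (ht : 0 ≤ t) :
    ∫⁻ ω, ENNReal.ofReal (max (|(∑ j ∈ Finset.range r, past d a ω j) i| - t) 0 ^ p) ∂P
      ≤ ENNReal.ofReal (A * ((R : ℝ) ^ (p / 2) * Real.exp (-c * t ^ 2 / R)) + K * R) := by
  rw [← ofReal_integral_eq_lintegral_ofReal (integrable_excess hp (h.memLp_sum_past r a) i ht)
    (ae_of_all _ fun ω => by positivity)]
  refine ENNReal.ofReal_le_ofReal ?_
  have h1 : ∫ ω, max (|(∑ j ∈ Finset.range r, past d a ω j) i| - t) 0 ^ p ∂P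
      = ∫ ω, max (|partialSum d r ω i| - t) 0 ^ p ∂P := by
    have := h.integral_comp_past_shift
      (ζ := fun x => max (|(∑ j ∈ Finset.range r, x j) i| - t) 0 ^ p) (by fun_prop) r (a - r)
    rw [show (r : ℤ) + (a - r) = a by ring] at this
    simp only [partialSum_eq_sum_past]
    exact this
  have h2 := rpow_mul_exp_neg_div_mono (t := t) hp hc hr
  have h3 : (r : ℝ) ≤ R := by exact_mod_cast hr
  calc _ = _ := h1
    _ ≤ _ := hE i t ht
    _ ≤ _ := by gcongr

end StationaryMDS

lemma exists_abs_integral_comp_past_mul_le (D : ℕ) {p c A : ℝ} (hp : 2 < p) (hp3 : p ≤ 3)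
    (hc : 0 < c) (hA : 0 ≤ A) :
    ∃ C : ℝ, 0 ≤ C ∧ ∀ (P : Measure Ω) [IsProbabilityMeasure P] (ℱ : ℤ → MeasurableSpace Ω)
      (d : ℤ → Ω → EuclideanSpace ℝ (Fin D)), StationaryMDS P p ℱ d →
      ∀ (K : ℝ) (r R : ℕ), 0 < K → 0 < R → r ≤ R → ExcessBound P p d A c K r →
      ∀ ζ : (ℕ → EuclideanSpace ℝ (Fin D)) → ℝ,
      (∀ x, |ζ x| ≤ ‖∑ j ∈ Finset.range r, x j‖ ^ (p - 2) + (R : ℝ) ^ ((p - 2) / 2)) →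
      ∀ (Y : Ω → ℝ), Measurable Y → envNorm P p Y ≠ ⊤ → eLpNorm Y (ENNReal.ofReal (p / 2)) P ≠ ⊤ →
      ∀ a : ℤ, |∫ ω, ζ (past d a ω) * Y ω ∂P| ≤
        C * ((R : ℝ) ^ ((p - 2) / 2) * (envNorm P p Y).toReal
        + (K * R) ^ ((p - 2) / p) * (eLpNorm Y (ENNReal.ofReal (p / 2)) P).toReal) := by
  obtain ⟨C1, hC1, H1⟩ := exists_lintegral_rpow_mul_le (Ω := Ω) hp hc hA
  obtain ⟨C2, hC2, H2⟩ := exists_lintegral_abs_le_envNorm (Ω := Ω) hp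
  refine ⟨D * C1 + C2, by positivity, fun P _ ℱ d h K r R hK hR hr hE ζ hζ Y hY he hl a => ?_⟩
  have hR' : (0 : ℝ) < R := by exact_mod_cast hR
  set s := (R : ℝ) ^ ((p - 2) / 2) with hs
  set q := (K * R) ^ ((p - 2) / p) with hq
  have hs0 : 0 ≤ s := by positivity
  have hq0 : 0 ≤ q := by positivity
  set X : Ω → EuclideanSpace ℝ (Fin D) := fun ω => ∑ j ∈ Finset.range r, past d a ω j with hX
  have hXm : Measurable X :=
    Finset.measurable_sum _ fun j _ => h.measurable (a - j)
  have hXi : ∀ i, Measurable fun ω => X ω i := fun i => by fun_prop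
  have hXY : ∀ i, Measurable fun ω => ENNReal.ofReal (|X ω i| ^ (p - 2) * |Y ω|) := fun i =>
    (((hXi i).abs.pow_const _).mul hY.abs).ennreal_ofReal
  have h1 : ∫⁻ ω, ENNReal.ofReal |ζ (past d a ω) * Y ω| ∂P ≤
      (∑ i : Fin D, ∫⁻ ω, ENNReal.ofReal (|X ω i| ^ (p - 2) * |Y ω|) ∂P)
        + ENNReal.ofReal s * ∫⁻ ω, ENNReal.ofReal |Y ω| ∂P := by
    rw [← lintegral_finsetSum _ fun i _ => hXY i,
      ← lintegral_const_mul _ hY.abs.ennreal_ofReal, ← lintegral_add_right _ (by fun_prop)]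
    refine lintegral_mono fun ω => ?_
    rw [← ENNReal.ofReal_sum_of_nonneg fun i _ => by positivity, ← ENNReal.ofReal_mul hs0,
      ← ENNReal.ofReal_add (Finset.sum_nonneg fun i _ => by positivity) (by positivity),
      ← Finset.sum_mul, ← add_mul, abs_mul]
    refine ENNReal.ofReal_le_ofReal (mul_le_mul_of_nonneg_right ?_ (abs_nonneg _))
    refine (hζ _).trans (add_le_add_left ?_ _)
    exact norm_rpow_le_sum_abs_rpow (X ω) (by linarith) (by linarith)
  have h2 : ∀ i, ∫⁻ ω, ENNReal.ofReal (|X ω i| ^ (p - 2) * |Y ω|) ∂P ≤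
      ENNReal.ofReal C1 * (ENNReal.ofReal s * envNorm P p Y
        + ENNReal.ofReal q * eLpNorm Y (ENNReal.ofReal (p / 2)) P) := fun i =>
    H1 P (fun ω => X ω i) Y R K (hXi i) hY hR' hK fun t ht =>
      h.lintegral_excess_le (by linarith) hA hc.le hK.le hr hE a i ht
  have h3 : ∫⁻ ω, ENNReal.ofReal |ζ (past d a ω) * Y ω| ∂P ≤
      ENNReal.ofReal ((D * C1 + C2) * (s * (envNorm P p Y).toReal
        + q * (eLpNorm Y (ENNReal.ofReal (p / 2)) P).toReal)) := by
    have e1 : ENNReal.ofReal (s * (envNorm P p Y).toReal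
        + q * (eLpNorm Y (ENNReal.ofReal (p / 2)) P).toReal) = ENNReal.ofReal s * envNorm P p Y
        + ENNReal.ofReal q * eLpNorm Y (ENNReal.ofReal (p / 2)) P := by
      rw [ENNReal.ofReal_add (by positivity) (by positivity), ENNReal.ofReal_mul hs0,
        ENNReal.ofReal_mul hq0, ENNReal.ofReal_toReal he, ENNReal.ofReal_toReal hl]
    rw [ENNReal.ofReal_mul (by positivity), e1, ENNReal.ofReal_add (by positivity) hC2,
      ENNReal.ofReal_mul (by positivity), ENNReal.ofReal_natCast, add_mul]
    refine h1.trans (add_le_add ?_ ?_)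
    · refine (Finset.sum_le_sum fun i _ => h2 i).trans (le_of_eq ?_)
      simp [mul_assoc]
    · refine (mul_le_mul_right (H2 P Y hY) _).trans ?_
      rw [mul_left_comm]
      gcongr
      exact le_self_add
  refine (abs_integral_le_toReal_lintegral (ne_top_of_le_ne_top ENNReal.ofReal_ne_top h3)).trans ?_
  exact ENNReal.toReal_le_of_le_ofReal (by positivity) h3

end PastCorrelation

section PastCorrelationSum

variable {Ω : Type*} [mΩ : MeasurableSpace Ω] {D : ℕ}

/-- The sum over the coordinates of the envelope norms of `E(M_n M_nᵗ | ℱ₀) - E(M_n M_nᵗ)`. -/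
def envDev (P : Measure Ω) (p : ℝ) (ℱ : ℤ → MeasurableSpace Ω)
    (d : ℤ → Ω → EuclideanSpace ℝ (Fin D)) (n : ℕ) : ℝ :=
  ∑ i, ∑ j, (envNorm P p (condDev P ℱ d n i j)).toReal

/-- The sum over the coordinates of the `L^{p/2}` norms of `E(M_n M_nᵗ | ℱ₀) - E(M_n M_nᵗ)`. -/
def lpDev (P : Measure Ω) (p : ℝ) (ℱ : ℤ → MeasurableSpace Ω)
    (d : ℤ → Ω → EuclideanSpace ℝ (Fin D)) (n : ℕ) : ℝ :=
  ∑ i, ∑ j, (eLpNorm (condDev P ℱ d n i j) (ENNReal.ofReal (p / 2)) P).toReal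

lemma envDev_nonneg (P : Measure Ω) (p : ℝ) (ℱ : ℤ → MeasurableSpace Ω)
    (d : ℤ → Ω → EuclideanSpace ℝ (Fin D)) (n : ℕ) : 0 ≤ envDev P p ℱ d n :=
  Finset.sum_nonneg fun _ _ => Finset.sum_nonneg fun _ _ => ENNReal.toReal_nonneg

lemma lpDev_nonneg (P : Measure Ω) (p : ℝ) (ℱ : ℤ → MeasurableSpace Ω)
    (d : ℤ → Ω → EuclideanSpace ℝ (Fin D)) (n : ℕ) : 0 ≤ lpDev P p ℱ d n :=
  Finset.sum_nonneg fun _ _ => Finset.sum_nonneg fun _ _ => ENNReal.toReal_nonneg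

lemma le_sum_sum_of_nonneg {ι : Type*} [Fintype ι] {f : ι → ι → ℝ} (hf : ∀ i j, 0 ≤ f i j)
    (i j : ι) : f i j ≤ ∑ i, ∑ j, f i j :=
  (Finset.single_le_sum (f := fun j => f i j) (fun j _ => hf i j) (Finset.mem_univ j)).trans
    (Finset.single_le_sum (f := fun i => ∑ j, f i j)
      (fun i _ => Finset.sum_nonneg fun j _ => hf i j) (Finset.mem_univ i))

lemma abs_le_two_mul_average {T : ℝ} {g : ℕ → ℝ} (hg : ∀ m, 0 ≤ g m) {R : ℕ} (hR : 0 < R)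
    (h : ∀ m < R, |T| ≤ g (m + 1) + if R - (m + 1) = 0 then 0 else g (R - (m + 1))) :
    |T| ≤ 2 * ((R : ℝ)⁻¹ * ∑ m ∈ Finset.range R, g (m + 1)) := by
  have hR' : (0 : ℝ) < R := by exact_mod_cast hR
  set f : ℕ → ℝ := fun j => if j = 0 then 0 else g j with hf
  have hf0 : ∀ j, 0 ≤ f j := fun j => by
    simp only [hf]
    split_ifs
    exacts [le_rfl, hg j]
  have h1 : (R : ℝ) * |T| ≤ ∑ m ∈ Finset.range R, (g (m + 1) + f (R - (m + 1))) := by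
    have := Finset.card_nsmul_le_sum (Finset.range R) (fun m => g (m + 1) + f (R - (m + 1))) |T|
      fun m hm => h m (Finset.mem_range.1 hm)
    simpa using this
  have h2 : ∑ m ∈ Finset.range R, f (R - (m + 1)) ≤ ∑ m ∈ Finset.range R, g (m + 1) := by
    have e1 : ∑ m ∈ Finset.range R, f (R - (m + 1)) = ∑ m ∈ Finset.range R, f m := by
      rw [← Finset.sum_range_reflect f R]
      exact Finset.sum_congr rfl fun m _ => by rw [Nat.sub_sub, add_comm 1 m]
    have e2 : ∑ m ∈ Finset.range (R + 1), f m = ∑ m ∈ Finset.range R, g (m + 1) := by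
      rw [Finset.sum_range_succ']
      simp [hf]
    rw [e1, ← e2, Finset.sum_range_succ]
    linarith [hf0 R]
  rw [Finset.sum_add_distrib] at h1
  rw [← mul_assoc, mul_comm 2, mul_assoc, ← div_eq_inv_mul, le_div_iff₀ hR']
  linarith

lemma exists_abs_sum_integral_comp_past_le (D : ℕ) {p c A : ℝ} (hp : 2 < p) (hp3 : p ≤ 3)
    (hc : 0 < c) (hA : 0 ≤ A) :
    ∃ C : ℝ, 0 ≤ C ∧ ∀ (P : Measure Ω) [IsProbabilityMeasure P] (ℱ : ℤ → MeasurableSpace Ω)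
      (d : ℤ → Ω → EuclideanSpace ℝ (Fin D)), StationaryMDS P p ℱ d →
      (∀ n i j, envNorm P p (condDev P ℱ d (n + 1) i j) ≠ ⊤) →
      (∀ n i j, eLpNorm (condDev P ℱ d (n + 1) i j) (ENNReal.ofReal (p / 2)) P ≠ ⊤) →
      ∀ (K : ℝ) (r R : ℕ), 0 < K → 0 < R → r ≤ R → ExcessBound P p d A c K r →
      ∀ ζ : (ℕ → EuclideanSpace ℝ (Fin D)) → ℝ, Measurable ζ →
      (∀ x, |ζ x| ≤ ‖∑ j ∈ Finset.range r, x j‖ ^ (p - 2) + (R : ℝ) ^ ((p - 2) / 2)) →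
      ∀ (b : ℤ) (i j : Fin D),
      |∑ k ∈ Finset.range R, ∫ ω, ζ (past d b ω)
          * centeredProd (covMat P d) i j (d (b + (k + 1)) ω) ∂P|
        ≤ C * ((R : ℝ) ^ ((p - 2) / 2) * ((R : ℝ)⁻¹ * ∑ m ∈ Finset.range R, envDev P p ℱ d (m + 1))
          + (K * R) ^ ((p - 2) / p)
            * ((R : ℝ)⁻¹ * ∑ m ∈ Finset.range R, lpDev P p ℱ d (m + 1))) := by
  obtain ⟨C, hC, H⟩ := exists_abs_integral_comp_past_mul_le (Ω := Ω) D hp hp3 hc hA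
  refine ⟨2 * C, by positivity, fun P _ ℱ d h he hl K r R hK hR hr hE ζ hζm hζ b i j => ?_⟩
  set s := (R : ℝ) ^ ((p - 2) / 2) with hs
  set q := (K * R) ^ ((p - 2) / p) with hq
  have hs0 : 0 ≤ s := by positivity
  have hq0 : 0 ≤ q := by positivity
  set g : ℕ → ℝ := fun n => C * (s * envDev P p ℱ d n + q * lpDev P p ℱ d n) with hg
  have hg0 : ∀ n, 0 ≤ g n := fun n => by
    have := envDev_nonneg P p ℱ d n
    have := lpDev_nonneg P p ℱ d n
    positivity
  have hY : ∀ (n : ℕ) (a : ℤ),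
      |∫ ω, ζ (past d a ω) * condDev P ℱ d (n + 1) i j ω ∂P| ≤ g (n + 1) := fun n a => by
    refine (H P ℱ d h K r R hK hR hr hE ζ hζ _ (h.measurable_condDev _ i j) (he n i j) (hl n i j)
      a).trans ?_
    have e1 : (envNorm P p (condDev P ℱ d (n + 1) i j)).toReal ≤ envDev P p ℱ d (n + 1) :=
      le_sum_sum_of_nonneg (f := fun i j => (envNorm P p (condDev P ℱ d (n + 1) i j)).toReal)
        (fun i j => ENNReal.toReal_nonneg) i j
    have e2 : (eLpNorm (condDev P ℱ d (n + 1) i j) (ENNReal.ofReal (p / 2)) P).toReal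
        ≤ lpDev P p ℱ d (n + 1) :=
      le_sum_sum_of_nonneg (f := fun i j =>
        (eLpNorm (condDev P ℱ d (n + 1) i j) (ENNReal.ofReal (p / 2)) P).toReal)
        (fun i j => ENNReal.toReal_nonneg) i j
    simp only [hg]
    gcongr
  have hqm : Measurable (centeredProd (covMat P d) i j) := by
    unfold centeredProd
    fun_prop
  have hshift : ∀ (a : ℤ) (k : ℕ), ∫ ω, ζ (past d a ω)
      * centeredProd (covMat P d) i j (d (a + (k + 1)) ω) ∂P
      = ∫ ω, ζ (past d 0 ω) * centeredProd (covMat P d) i j (d (k + 1) ω) ∂P := fun a k => by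
    have := h.integral_past_shift hζm hqm 0 (k + 1) a
    rwa [zero_add, add_comm _ a] at this
  have hsum : ∀ (a : ℤ), a ≤ 0 → ∀ n : ℕ, ∑ k ∈ Finset.range n, ∫ ω, ζ (past d a ω)
      * centeredProd (covMat P d) i j (d (k + 1) ω) ∂P
      = ∫ ω, ζ (past d a ω) * condDev P ℱ d n i j ω ∂P := fun a ha n => by
    refine h.sum_integral_mul_centeredProd hp (h.stronglyMeasurable_comp_past hζm ha) ?_ i j
      (fun k l => h.integrable_comp_past_mul_mul hp hζm hζ a k l i j) n
    have hX := (h.memLp_sum_past r a).integrable_norm_rpow_of_le (q := p - 2) (by linarith)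
      (by linarith)
    refine (hX.add (integrable_const s)).mono'
      (hζm.comp (h.measurable_past' a)).aestronglyMeasurable (ae_of_all _ fun ω => hζ _)
  obtain ⟨I, hI⟩ : ∃ I : ℤ → ℤ → ℝ, ∀ a k, ∫ ω, ζ (past d a ω)
      * centeredProd (covMat P d) i j (d k ω) ∂P = I a k := ⟨_, fun _ _ => rfl⟩
  obtain ⟨J, hJ⟩ : ∃ J : ℤ → ℕ → ℝ, ∀ a n, ∫ ω, ζ (past d a ω)
      * condDev P ℱ d n i j ω ∂P = J a n := ⟨_, fun _ _ => rfl⟩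
  simp only [hI, hJ] at hshift hsum hY ⊢
  have hkey : ∀ m < R, |∑ k ∈ Finset.range R, I b (b + (k + 1))|
      ≤ g (m + 1) + if R - (m + 1) = 0 then 0 else g (R - (m + 1)) := fun m hm => by
    obtain ⟨l, rfl⟩ : ∃ l, R = m + 1 + l := ⟨R - (m + 1), by lia⟩
    rw [Finset.sum_congr rfl fun k _ => hshift b k, Finset.sum_range_add, hsum 0 le_rfl]
    refine (abs_add_le _ _).trans (add_le_add (hY m 0) ?_)
    have e1 : ∑ k ∈ Finset.range l, I 0 (((m + 1 + k : ℕ) : ℤ) + 1) = J (-(m + 1)) l := by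
      rw [← hsum _ (by lia)]
      refine Finset.sum_congr rfl fun k _ => ?_
      rw [← hshift (-(m + 1)) (m + 1 + k)]
      congr 1
      push_cast
      ring
    rw [e1, Nat.add_sub_cancel_left]
    split_ifs with hl0
    · rw [← hsum _ (by lia), hl0]
      simp
    · obtain ⟨l', rfl⟩ := Nat.exists_eq_succ_of_ne_zero hl0
      exact hY l' _
  refine (abs_le_two_mul_average hg0 hR hkey).trans (le_of_eq ?_)
  simp only [hg]
  rw [← Finset.mul_sum, Finset.sum_add_distrib, ← Finset.mul_sum, ← Finset.mul_sum]
  ring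

end PastCorrelationSum

section LindebergStep

variable {Ω : Type*} [mΩ : MeasurableSpace Ω] {D : ℕ} {P : Measure Ω} {p w : ℝ}
  {ℱ : ℤ → MeasurableSpace Ω} {d : ℤ → Ω → EuclideanSpace ℝ (Fin D)}
  {F : EuclideanSpace ℝ (Fin D) → ℝ} {G : EuclideanSpace ℝ (Fin D) → Fin D → ℝ}
  {H : EuclideanSpace ℝ (Fin D) → Fin D → Fin D → ℝ}

namespace HasTaylor

lemma abs_integral_add_sub_le [IsProbabilityMeasure P] (hT : HasTaylor p w F G H) (hp : 2 < p)
    (hp3 : p ≤ 3) {X Y : Ω → EuclideanSpace ℝ (Fin D)} (hX : MemLp X (ENNReal.ofReal p) P)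
    (hY : MemLp Y (ENNReal.ofReal p) P)
    (hG : ∀ i, Integrable (fun ω => G (X ω) i * Y ω i) P)
    (hG0 : ∀ i, ∫ ω, G (X ω) i * Y ω i ∂P = 0)
    (hH : ∀ i j, Integrable (fun ω => H (X ω) i j * (Y ω i * Y ω j)) P) :
    |∫ ω, F (X ω + Y ω) ∂P - ∫ ω, F (X ω) ∂P
      - 1 / 2 * ∑ i, ∑ j, ∫ ω, H (X ω) i j * (Y ω i * Y ω j) ∂P| ≤ w * ∫ ω, ‖Y ω‖ ^ p ∂P := by
  have i1 := (hT.integrable_comp hp hp3 (hX.add hY)).1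
  have i2 := (hT.integrable_comp hp hp3 hX).1
  simp only [Pi.add_apply] at i1
  have i3 : Integrable (fun ω => ∑ i, G (X ω) i * Y ω i) P := integrable_finsetSum _ fun i _ => hG i
  have i4 : Integrable (fun ω => quadVal (H (X ω)) (Y ω)) P :=
    integrable_finsetSum _ fun i _ => integrable_finsetSum _ fun j _ => hH i j
  have i5 := hY.integrable_norm_rpow_of_le (q := p) (by linarith) le_rfl
  have e3 : ∫ ω, ∑ i, G (X ω) i * Y ω i ∂P = 0 := by
    rw [integral_finsetSum _ fun i _ => hG i]
    simp [hG0]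
  have e4 : ∫ ω, quadVal (H (X ω)) (Y ω) ∂P
      = ∑ i, ∑ j, ∫ ω, H (X ω) i j * (Y ω i * Y ω j) ∂P := by
    unfold quadVal
    rw [integral_finsetSum _ fun i _ => integrable_finsetSum _ fun j _ => hH i j]
    exact Finset.sum_congr rfl fun i _ => integral_finsetSum _ fun j _ => hH i j
  have e : ∫ ω, (F (X ω + Y ω) - F (X ω) - ∑ i, G (X ω) i * Y ω i
      - 1 / 2 * quadVal (H (X ω)) (Y ω)) ∂P = ∫ ω, F (X ω + Y ω) ∂P - ∫ ω, F (X ω) ∂P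
      - 1 / 2 * ∑ i, ∑ j, ∫ ω, H (X ω) i j * (Y ω i * Y ω j) ∂P := by
    have i12 : Integrable (fun ω => F (X ω + Y ω) - F (X ω)) P := i1.sub i2
    have i13 : Integrable (fun ω => F (X ω + Y ω) - F (X ω) - ∑ i, G (X ω) i * Y ω i) P :=
      i12.sub i3
    rw [integral_sub i13 (i4.const_mul _), integral_sub i12 i3,
      integral_sub i1 i2, integral_const_mul, e3, e4, sub_zero]
  rw [← e, ← integral_const_mul, ← Real.norm_eq_abs]
  refine norm_integral_le_of_norm_le (i5.const_mul w) (ae_of_all _ fun ω => ?_)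
  rw [Real.norm_eq_abs]
  exact hT.bound (X ω) (Y ω)

lemma abs_integral_gaussian_le (hT : HasTaylor p w F G H) (hp : 2 < p) (hp3 : p ≤ 3)
    {S : Matrix (Fin D) (Fin D) ℝ} (hS : S.PosSemidef) {γ : Measure (EuclideanSpace ℝ (Fin D))}
    (hγ : γ = multivariateGaussian 0 S) (x : EuclideanSpace ℝ (Fin D)) :
    |∫ y, F (x + y) ∂γ - F x - 1 / 2 * ∑ i, ∑ j, H x i j * S i j| ≤ w * ∫ y, ‖y‖ ^ p ∂γ := by
  subst hγ
  have hY : MemLp (fun y : EuclideanSpace ℝ (Fin D) => y) (ENNReal.ofReal p)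
    (multivariateGaussian 0 S) := IsGaussian.memLp_id _ _ ENNReal.ofReal_ne_top
  have h2 : ∀ i, MemLp (fun y : EuclideanSpace ℝ (Fin D) => y i) 2 (multivariateGaussian 0 S) :=
    fun i => (IsGaussian.memLp_id (multivariateGaussian 0 S) 2 (by simp)).mono
      (by fun_prop) (ae_of_all _ fun y => by simpa using PiLp.norm_apply_le y i)
  have := hT.abs_integral_add_sub_le hp hp3 (memLp_const x) hY
    (fun i => ((h2 i).integrable one_le_two).const_mul _)
    (fun i => by rw [integral_const_mul, integral_apply_multivariateGaussian_zero, mul_zero])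
    (fun i j => ((h2 i).integrable_mul (h2 j)).const_mul _)
  simpa [integral_const_mul, integral_mul_apply_multivariateGaussian_zero hS] using this

end HasTaylor

namespace StationaryMDS

variable (h : StationaryMDS P p ℱ d)
include h

lemma stronglyMeasurable_partialSum (n : ℕ) : StronglyMeasurable[ℱ n] (partialSum d n) := by
  have h1 := (h.measurable_past n)
  have h2 : Measurable fun x : ℕ → EuclideanSpace ℝ (Fin D) => ∑ j ∈ Finset.range n, x j := by
    fun_prop
  have h3 : partialSum d n = (fun x : ℕ → EuclideanSpace ℝ (Fin D) => ∑ j ∈ Finset.range n, x j)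
      ∘ past d n := funext fun ω => partialSum_eq_sum_past d n ω
  rw [h3]
  exact (h2.comp h1).stronglyMeasurable

lemma integrable_grad_mul [IsProbabilityMeasure P] (hT : HasTaylor p w F G H) (hp : 2 < p)
    (hp3 : p ≤ 3) {X : Ω → EuclideanSpace ℝ (Fin D)} (hX : MemLp X (ENNReal.ofReal p) P)
    (k : ℤ) (i : Fin D) : Integrable (fun ω => G (X ω) i * d k ω i) P := by
  obtain ⟨K, hK, -, hG, -⟩ := hT.exists_growth hp hp3
  have i1 := hX.integrable_one_add_norm_rpow (q := p) (by linarith) le_rfl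
  have i2 := (h.memLp k).integrable_norm_rpow_of_le (q := p) (by linarith) le_rfl
  have hm := (hT.integrable_comp hp hp3 hX).2.1 i
  refine ((i1.add i2).const_mul K).mono' (hm.1.mul (h.integrable_coord k i).1)
    (ae_of_all _ fun ω => ?_)
  have e1 : ‖d k ω i‖ ≤ ‖d k ω‖ := PiLp.norm_apply_le _ _
  have e2 := hG (X ω) i
  have e3 : (1 + ‖X ω‖) ^ (p - 1) * ‖d k ω‖ ≤ (1 + ‖X ω‖) ^ p + ‖d k ω‖ ^ p := by
    rcases le_total ‖d k ω‖ (1 + ‖X ω‖) with h1 | h1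
    · calc _ ≤ (1 + ‖X ω‖) ^ (p - 1) * (1 + ‖X ω‖) := by gcongr
        _ = (1 + ‖X ω‖) ^ p := by
          rw [← Real.rpow_add_one (by positivity)]
          congr 1
          ring
        _ ≤ _ := le_add_of_nonneg_right (by positivity)
    · have : 0 < ‖d k ω‖ := by linarith [norm_nonneg (X ω)]
      calc _ ≤ ‖d k ω‖ ^ (p - 1) * ‖d k ω‖ := by
            have : 0 ≤ p - 1 := by linarith
            gcongr
        _ = ‖d k ω‖ ^ p := by
          rw [← Real.rpow_add_one (by positivity)]
          congr 1
          ring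
        _ ≤ _ := le_add_of_nonneg_left (by positivity)
  rw [norm_mul, Real.norm_eq_abs (G _ _)]
  calc _ ≤ (K * (1 + ‖X ω‖) ^ (p - 1)) * ‖d k ω‖ := by gcongr
    _ = K * ((1 + ‖X ω‖) ^ (p - 1) * ‖d k ω‖) := by ring
    _ ≤ _ := by
      simp only [Pi.add_apply]
      gcongr

lemma integrable_hessian_mul [IsProbabilityMeasure P] (hT : HasTaylor p w F G H) (hp : 2 < p)
    (hp3 : p ≤ 3) {X : Ω → EuclideanSpace ℝ (Fin D)} (hX : MemLp X (ENNReal.ofReal p) P)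
    (k : ℤ) (i j i' j' : Fin D) :
    Integrable (fun ω => H (X ω) i j * (d k ω i' * d k ω j')) P := by
  obtain ⟨K, hK, -, -, hH⟩ := hT.exists_growth hp hp3
  have i1 := integrable_rpow_mul_mul hp ((memLp_const (1 : ℝ)).add hX.norm) (h.memLp k) (h.memLp k)
  have hm := (hT.integrable_comp hp hp3 hX).2.2 i j
  refine (i1.const_mul K).mono' (hm.1.mul (h.integrable_mul_coord hp k k i' j').1)
    (ae_of_all _ fun ω => ?_)
  have e1 : ‖d k ω i'‖ ≤ ‖d k ω‖ := PiLp.norm_apply_le _ _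
  have e1' : ‖d k ω j'‖ ≤ ‖d k ω‖ := PiLp.norm_apply_le _ _
  have e2 := hH (X ω) i j
  rw [norm_mul, norm_mul, Real.norm_eq_abs (H _ _ _)]
  calc _ ≤ (K * (1 + ‖X ω‖) ^ (p - 2)) * (‖d k ω‖ * ‖d k ω‖) := by gcongr
    _ = _ := by
      simp only [Pi.add_apply]
      rw [Real.norm_of_nonneg (show (0 : ℝ) ≤ 1 + ‖X ω‖ by positivity)]
      ring

lemma integrable_hessian_mul_centeredProd [IsProbabilityMeasure P] (hT : HasTaylor p w F G H)
    (hp : 2 < p) (hp3 : p ≤ 3) {X : Ω → EuclideanSpace ℝ (Fin D)}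
    (hX : MemLp X (ENNReal.ofReal p) P) (S : Fin D → Fin D → ℝ) (k : ℤ) (i j i' j' : Fin D) :
    Integrable (fun ω => H (X ω) i j * centeredProd S i' j' (d k ω)) P := by
  simp only [centeredProd, mul_sub]
  exact (h.integrable_hessian_mul hT hp hp3 hX k i j i' j').sub
    (((hT.integrable_comp hp hp3 hX).2.2 i j).mul_const _)

/-- One step of Lindeberg's replacement scheme. -/
lemma abs_lindeberg_step_le [IsProbabilityMeasure P] (hT : HasTaylor p w F G H) (hp : 2 < p)
    (hp3 : p ≤ 3) {S : Matrix (Fin D) (Fin D) ℝ} (hS : S.PosSemidef)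
    {γ : Measure (EuclideanSpace ℝ (Fin D))} (hγ : γ = multivariateGaussian 0 S)
    {F' : EuclideanSpace ℝ (Fin D) → ℝ} (hF' : ∀ x, F' x = ∫ y, F (x + y) ∂γ)
    (k : ℕ) (hI : Integrable (fun ω => F' (partialSum d k ω)) P) :
    |∫ ω, F (partialSum d (k + 1) ω) ∂P - ∫ ω, F' (partialSum d k ω) ∂P
      - 1 / 2 * ∑ i, ∑ j, ∫ ω, H (partialSum d k ω) i j * centeredProd S i j (d (k + 1) ω) ∂P|
      ≤ w * (∫ ω, ‖d 0 ω‖ ^ p ∂P + ∫ y, ‖y‖ ^ p ∂γ) := by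
  have hX := h.memLp_partialSum k
  obtain ⟨i1, -, i2⟩ := hT.integrable_comp hp hp3 hX
  have iG : ∀ i, Integrable (fun ω => G (partialSum d k ω) i * d (k + 1) ω i) P := fun i =>
    h.integrable_grad_mul hT hp hp3 hX _ i
  have iH : ∀ i j, Integrable (fun ω => H (partialSum d k ω) i j
      * (d (k + 1) ω i * d (k + 1) ω j)) P := fun i j =>
    h.integrable_hessian_mul hT hp hp3 hX _ i j i j
  have h1 := hT.abs_integral_add_sub_le hp hp3 hX (h.memLp (k + 1)) iG (fun i =>
    h.integral_mul_coord_eq_zero (m := k) (by lia) i (by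
      have hm : Measurable fun x => G x i := by
        have := hT.measG
        fun_prop
      exact (hm.comp (h.stronglyMeasurable_partialSum k).measurable).stronglyMeasurable) (iG i)) iH
  have h2 : |∫ ω, (F' (partialSum d k ω) - F (partialSum d k ω)
      - 1 / 2 * ∑ i, ∑ j, H (partialSum d k ω) i j * S i j) ∂P| ≤ w * ∫ y, ‖y‖ ^ p ∂γ := by
    rw [← Real.norm_eq_abs]
    refine (norm_integral_le_of_norm_le_const (C := w * ∫ y, ‖y‖ ^ p ∂γ)
      (ae_of_all _ fun ω => ?_)).trans (by simp)
    rw [Real.norm_eq_abs, hF']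
    exact hT.abs_integral_gaussian_le hp hp3 hS hγ _
  have i3 : Integrable (fun ω => F' (partialSum d k ω) - F (partialSum d k ω)) P := hI.sub i1
  have i4 : ∀ i j, Integrable (fun ω => H (partialSum d k ω) i j * S i j) P := fun i j =>
    (i2 i j).mul_const _
  have i5 : ∀ i, Integrable (fun ω => ∑ j, H (partialSum d k ω) i j * S i j) P := fun i =>
    integrable_finsetSum _ fun j _ => i4 i j
  have e2 : ∫ ω, ∑ i, ∑ j, H (partialSum d k ω) i j * S i j ∂P
      = ∑ i, ∑ j, ∫ ω, H (partialSum d k ω) i j * S i j ∂P := by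
    rw [integral_finsetSum _ fun i _ => i5 i]
    exact Finset.sum_congr rfl fun i _ => integral_finsetSum _ fun j _ => i4 i j
  rw [integral_sub i3 ((integrable_finsetSum _ fun i _ => i5 i).const_mul _), integral_sub hI i1,
    integral_const_mul, e2] at h2
  have h3 : ∫ ω, ‖d (k + 1) ω‖ ^ p ∂P = ∫ ω, ‖d 0 ω‖ ^ p ∂P :=
    h.integral_comp_eq (k + 1) (f := fun x => ‖x‖ ^ p) (by fun_prop)
  have h4 : ∀ i j, ∫ ω, H (partialSum d k ω) i j * centeredProd S i j (d (k + 1) ω) ∂P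
      = ∫ ω, H (partialSum d k ω) i j * (d (k + 1) ω i * d (k + 1) ω j) ∂P
        - ∫ ω, H (partialSum d k ω) i j * S i j ∂P := fun i j => by
    simp only [centeredProd, mul_sub]
    rw [integral_sub (iH i j) ((i2 i j).mul_const _)]
  simp only [h4, Finset.sum_sub_distrib]
  simp only [← partialSum_succ] at h1
  rw [h3] at h1
  rw [abs_le] at h1 h2 ⊢
  constructor <;> linarith [h1.1, h1.2, h2.1, h2.2]

end StationaryMDS

end LindebergStep

section TaylorFlow

variable {D : ℕ}

/-- Functions `F_0, …, F_n` linked by the Gaussian semigroup of `γ`, with Taylor expansions. -/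
structure TaylorFlow (p : ℝ) (γ : Measure (EuclideanSpace ℝ (Fin D))) (n : ℕ) (w : ℕ → ℝ)
    (F : ℕ → EuclideanSpace ℝ (Fin D) → ℝ) (G : ℕ → EuclideanSpace ℝ (Fin D) → Fin D → ℝ)
    (H : ℕ → EuclideanSpace ℝ (Fin D) → Fin D → Fin D → ℝ) : Prop where
  taylor : ∀ k ≤ n, HasTaylor p (w k) (F k) (G k) (H k)
  semigroup : ∀ l k, l ≤ k → k ≤ n → ∀ x, F l x = ∫ y, F k (x + √((k : ℝ) - l) • y) ∂γ
  mono : ∀ l k, l ≤ k → k ≤ n → w l ≤ w k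

/-- The constant controlling the increments of the Hessians of a flow. -/
def flowConst (p : ℝ) (γ : Measure (EuclideanSpace ℝ (Fin D))) : ℝ :=
  243 * (1 + ∫ y, ‖y‖ ^ (p - 2) ∂γ)

lemma flowConst_nonneg (p : ℝ) (γ : Measure (EuclideanSpace ℝ (Fin D))) : 0 ≤ flowConst p γ := by
  have : 0 ≤ ∫ y, ‖y‖ ^ (p - 2) ∂γ := integral_nonneg fun y => by positivity
  unfold flowConst
  positivity

lemma mul_add_le_flow_mul {w T m X : ℝ} (hw : 0 ≤ w) (hT : 0 ≤ T) (hm : 0 ≤ m) (hX : 0 ≤ X) :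
    243 * w * (X + T * m) ≤ 243 * (1 + m) * w * (X + T) := by
  have h1 : 0 ≤ w * (m * X) := by positivity
  have h2 : 0 ≤ w * T := by positivity
  linarith

namespace TaylorFlow

variable {p : ℝ} {γ : Measure (EuclideanSpace ℝ (Fin D))} {n : ℕ} {w : ℕ → ℝ}
  {F : ℕ → EuclideanSpace ℝ (Fin D) → ℝ} {G : ℕ → EuclideanSpace ℝ (Fin D) → Fin D → ℝ}
  {H : ℕ → EuclideanSpace ℝ (Fin D) → Fin D → Fin D → ℝ}

lemma succ_eq (hF : TaylorFlow p γ n w F G H) {k : ℕ} (hk : k < n) (x : EuclideanSpace ℝ (Fin D)) :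
    F k x = ∫ y, F (k + 1) (x + y) ∂γ := by
  simpa using hF.semigroup k (k + 1) (by lia) hk x

lemma abs_hessian_sub_le [IsGaussian γ] (hF : TaylorFlow p γ n w F G H) (hp : 2 < p) (hp3 : p ≤ 3)
    {l k : ℕ} (hlk : l ≤ k) (hk : k ≤ n) (x y : EuclideanSpace ℝ (Fin D)) (i j : Fin D) :
    |H k x i j - H l y i j|
      ≤ flowConst p γ * w k * (‖x - y‖ ^ (p - 2) + ((k : ℝ) - l) ^ ((p - 2) / 2)) := by
  set s : ℝ := √((k : ℝ) - l) with hs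
  have hkl : (0 : ℝ) ≤ (k : ℝ) - l := sub_nonneg.2 (by exact_mod_cast hlk)
  have hT := hF.taylor k hk
  have hw := hT.nonneg
  have hav := hT.average hp hp3 γ s
  have hFl : F l = fun x => ∫ y, F k (x + s • y) ∂γ := funext (hF.semigroup l k hlk hk)
  have hT' := hF.taylor l (hlk.trans hk)
  rw [hFl] at hT'
  rw [hT'.hessian_unique hav hp]
  have hZ : MemLp (fun z => y + s • z) (ENNReal.ofReal p) γ :=
    (memLp_const y).add ((IsGaussian.memLp_id γ _ ENNReal.ofReal_ne_top).const_smul s)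
  have i1 := (hT.integrable_comp hp hp3 hZ).2.2 i j
  have hz : MemLp (fun z : EuclideanSpace ℝ (Fin D) => z) (ENNReal.ofReal p) γ :=
    IsGaussian.memLp_id γ _ ENNReal.ofReal_ne_top
  have i2 := hz.integrable_norm_rpow_of_le (q := p - 2) (by linarith) (by linarith)
  set T : ℝ := ((k : ℝ) - l) ^ ((p - 2) / 2) with hTd
  have hT0 : 0 ≤ T := by positivity
  have hsT : s ^ (p - 2) = T := by
    rw [hs, Real.sqrt_eq_rpow, ← Real.rpow_mul hkl, hTd]
    congr 1
    ring
  have e1 : H k x i j - ∫ z, H k (y + s • z) i j ∂γ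
      = ∫ z, (H k x i j - H k (y + s • z) i j) ∂γ := by
    rw [integral_sub (integrable_const _) i1]
    simp
  have e2 : ∀ z, ‖H k x i j - H k (y + s • z) i j‖
      ≤ 243 * w k * (‖x - y‖ ^ (p - 2) + T * ‖z‖ ^ (p - 2)) := fun z => by
    refine (hT.abs_hessian_sub_le hp hp3 x (y + s • z) i j).trans ?_
    gcongr
    have h1 : ‖x - (y + s • z)‖ ≤ ‖x - y‖ + s * ‖z‖ := by
      rw [← sub_sub]
      refine (norm_sub_le _ _).trans ?_
      rw [norm_smul, Real.norm_of_nonneg (Real.sqrt_nonneg _)]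
    calc _ ≤ (‖x - y‖ + s * ‖z‖) ^ (p - 2) := by
          have : 0 ≤ p - 2 := by linarith
          gcongr
      _ ≤ ‖x - y‖ ^ (p - 2) + (s * ‖z‖) ^ (p - 2) :=
          Real.rpow_add_le_add_rpow (norm_nonneg _) (by positivity) (by linarith) (by linarith)
      _ = _ := by rw [Real.mul_rpow (Real.sqrt_nonneg _) (norm_nonneg _), hsT]
  rw [e1, ← Real.norm_eq_abs]
  refine (norm_integral_le_of_norm_le (((integrable_const _).add (i2.const_mul T)).const_mul _)
    (ae_of_all _ e2)).trans ?_
  rw [integral_const_mul, integral_add' (integrable_const _) (i2.const_mul T), integral_const_mul]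
  simp only [integral_const, probReal_univ, one_smul]
  have hm : 0 ≤ ∫ z, ‖z‖ ^ (p - 2) ∂γ := integral_nonneg fun z => by positivity
  have hx : 0 ≤ ‖x - y‖ ^ (p - 2) := by positivity
  exact mul_add_le_flow_mul hw hT0 hm hx

end TaylorFlow

lemma sum_block_le {w : ℕ → ℝ} {n T : ℕ} (hw : ∀ l k, l ≤ k → k ≤ n → w l ≤ w k) {Q : ℕ}
    (hQ : T * Q ≤ n) :
    ∑ q ∈ Finset.range Q, (T : ℝ) * w (n - T * (q + 1) + 1)
      ≤ ∑ k ∈ Finset.Ico (n - T * Q) n, w (k + 1) := by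
  induction Q with
  | zero => simp
  | succ Q ih =>
    rw [Finset.sum_range_succ]
    have h1 : T * (Q + 1) = T * Q + T := by ring
    rw [← Finset.sum_Ico_consecutive (fun k => w (k + 1)) (m := n - T * (Q + 1))
      (n := n - T * Q) (k := n) (by lia) (by lia), add_comm]
    refine add_le_add ?_ (ih (by lia))
    have := Finset.card_nsmul_le_sum (Finset.Ico (n - T * (Q + 1)) (n - T * Q))
      (fun k => w (k + 1)) (w (n - T * (Q + 1) + 1)) fun k hk => by
        have := Finset.mem_Ico.1 hk
        exact hw _ _ (by lia) (by lia)
    rw [Nat.card_Ico, show n - T * Q - (n - T * (Q + 1)) = T by lia, nsmul_eq_mul] at this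
    exact this

end TaylorFlow

section BlockEstimate

variable {Ω : Type*} [mΩ : MeasurableSpace Ω] {D : ℕ}

/-- The size of the conditional covariance defects seen on a block of length `R`. -/
def blockRate (P : Measure Ω) (p : ℝ) (ℱ : ℤ → MeasurableSpace Ω)
    (d : ℤ → Ω → EuclideanSpace ℝ (Fin D)) (K : ℝ) (R : ℕ) : ℝ :=
  (R : ℝ) ^ ((p - 2) / 2) * ((R : ℝ)⁻¹ * ∑ m ∈ Finset.range R, envDev P p ℱ d (m + 1))
    + (K * R) ^ ((p - 2) / p) * ((R : ℝ)⁻¹ * ∑ m ∈ Finset.range R, lpDev P p ℱ d (m + 1))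

lemma blockRate_nonneg (P : Measure Ω) (p : ℝ) (ℱ : ℤ → MeasurableSpace Ω)
    (d : ℤ → Ω → EuclideanSpace ℝ (Fin D)) {K : ℝ} (hK : 0 ≤ K) (R : ℕ) :
    0 ≤ blockRate P p ℱ d K R := by
  have h1 : 0 ≤ ∑ m ∈ Finset.range R, envDev P p ℱ d (m + 1) :=
    Finset.sum_nonneg fun m _ => envDev_nonneg P p ℱ d _
  have h2 : 0 ≤ ∑ m ∈ Finset.range R, lpDev P p ℱ d (m + 1) :=
    Finset.sum_nonneg fun m _ => lpDev_nonneg P p ℱ d _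
  unfold blockRate
  positivity

/-- Correlations between functionals of the past and the products of the next `R` differences are
controlled by `blockRate`. -/
def BlockEstimate (P : Measure Ω) (p : ℝ) (ℱ : ℤ → MeasurableSpace Ω)
    (d : ℤ → Ω → EuclideanSpace ℝ (Fin D)) (A c C : ℝ) : Prop :=
  ∀ (K : ℝ) (r R : ℕ), 0 < K → 0 < R → r ≤ R → ExcessBound P p d A c K r →
    ∀ ζ : (ℕ → EuclideanSpace ℝ (Fin D)) → ℝ, Measurable ζ →
    (∀ x, |ζ x| ≤ ‖∑ j ∈ Finset.range r, x j‖ ^ (p - 2) + (R : ℝ) ^ ((p - 2) / 2)) →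
    ∀ (b : ℤ) (i j : Fin D),
    |∑ k ∈ Finset.range R, ∫ ω, ζ (past d b ω)
        * centeredProd (covMat P d) i j (d (b + (k + 1)) ω) ∂P| ≤ C * blockRate P p ℱ d K R

variable {P : Measure Ω} {p A c C K W : ℝ} {ℱ : ℤ → MeasurableSpace Ω}
  {d : ℤ → Ω → EuclideanSpace ℝ (Fin D)}

lemma BlockEstimate.mul_left (h : BlockEstimate P p ℱ d A c C) {r R : ℕ} (hK : 0 < K) (hR : 0 < R)
    (hr : r ≤ R) (hE : ExcessBound P p d A c K r) (hW : 0 ≤ W)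
    {ζ : (ℕ → EuclideanSpace ℝ (Fin D)) → ℝ} (hζ : Measurable ζ)
    (hb : ∀ x, |ζ x| ≤ W * (‖∑ j ∈ Finset.range r, x j‖ ^ (p - 2) + (R : ℝ) ^ ((p - 2) / 2)))
    (b : ℤ) (i j : Fin D) :
    |∑ k ∈ Finset.range R, ∫ ω, ζ (past d b ω)
        * centeredProd (covMat P d) i j (d (b + (k + 1)) ω) ∂P|
      ≤ W * (C * blockRate P p ℱ d K R) := by
  rcases hW.eq_or_lt with rfl | hW
  · have hζ0 : ∀ x, ζ x = 0 := fun x => by simpa using hb x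
    simp [hζ0]
  · have h1 := h K r R hK hR hr hE (fun x => W⁻¹ * ζ x) (hζ.const_mul _) (fun x => by
      rw [abs_mul, abs_of_pos (inv_pos.2 hW), inv_mul_le_iff₀ hW]
      exact hb x) b i j
    simp only [mul_assoc, integral_const_mul] at h1
    rw [← Finset.mul_sum, abs_mul, abs_of_pos (inv_pos.2 hW), inv_mul_le_iff₀ hW] at h1
    exact h1

lemma exists_sum_blockRate_le (hp : 2 < p)
    (hs1 : Summable fun m : ℕ => ((m : ℝ) + 1) ^ (-(3 - p / 2)) * envDev P p ℱ d (m + 1))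
    (hs2 : Summable fun m : ℕ => ((m : ℝ) + 1) ^ (-(1 + 2 / p)) * lpDev P p ℱ d (m + 1))
    (hp3 : p ≤ 3) :
    ∃ B : ℝ, 0 ≤ B ∧ ∀ K N, 0 ≤ K → ∑ L ∈ Finset.range N,
      ((2 : ℝ) ^ L)⁻¹ * blockRate P p ℱ d K (2 ^ L) ≤ B * (1 + K ^ ((p - 2) / p)) := by
  obtain ⟨B₁, hB₁, h1⟩ := exists_sum_dyadic_average_le (envDev_nonneg P p ℱ d)
    (by linarith : 0 < 3 - p / 2) hs1
  obtain ⟨B₂, hB₂, h2⟩ := exists_sum_dyadic_average_le (lpDev_nonneg P p ℱ d)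
    (by positivity : 0 < 1 + 2 / p) hs2
  refine ⟨B₁ + B₂, by positivity, fun K N hK => ?_⟩
  have hK' : 0 ≤ K ^ ((p - 2) / p) := by positivity
  have e : ∀ L : ℕ, ((2 : ℝ) ^ L)⁻¹ * blockRate P p ℱ d K (2 ^ L)
      = ((2 : ℝ) ^ L) ^ (-(3 - p / 2)) * ∑ m ∈ Finset.range (2 ^ L), envDev P p ℱ d (m + 1)
        + K ^ ((p - 2) / p) * (((2 : ℝ) ^ L) ^ (-(1 + 2 / p))
          * ∑ m ∈ Finset.range (2 ^ L), lpDev P p ℱ d (m + 1)) := fun L => by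
    have hT : (0 : ℝ) < 2 ^ L := by positivity
    have e1 : ((2 : ℝ) ^ L) ^ (-(3 - p / 2))
        = ((2 : ℝ) ^ L)⁻¹ * (((2 : ℝ) ^ L) ^ ((p - 2) / 2) * ((2 : ℝ) ^ L)⁻¹) := by
      rw [← Real.rpow_neg_one, ← Real.rpow_add hT, ← Real.rpow_add hT]
      congr 1
      ring
    have e2 : ((2 : ℝ) ^ L) ^ (-(1 + 2 / p))
        = ((2 : ℝ) ^ L)⁻¹ * (((2 : ℝ) ^ L) ^ ((p - 2) / p) * ((2 : ℝ) ^ L)⁻¹) := by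
      rw [← Real.rpow_neg_one, ← Real.rpow_add hT, ← Real.rpow_add hT]
      congr 1
      field_simp
      ring
    rw [blockRate, e1, e2, Nat.cast_pow, Nat.cast_ofNat, Real.mul_rpow hK hT.le]
    ring
  simp only [e]
  rw [Finset.sum_add_distrib, ← Finset.mul_sum]
  have h3 := mul_le_mul_of_nonneg_left (h2 N) hK'
  nlinarith [h1 N, mul_nonneg hB₁ hK']

end BlockEstimate

section SecondOrder

variable {Ω : Type*} [mΩ : MeasurableSpace Ω] {D : ℕ} {P : Measure Ω} {p A c C K : ℝ}
  {ℱ : ℤ → MeasurableSpace Ω} {d : ℤ → Ω → EuclideanSpace ℝ (Fin D)}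
  {γ : Measure (EuclideanSpace ℝ (Fin D))} {n : ℕ} {w : ℕ → ℝ}
  {F : ℕ → EuclideanSpace ℝ (Fin D) → ℝ} {G : ℕ → EuclideanSpace ℝ (Fin D) → Fin D → ℝ}
  {H : ℕ → EuclideanSpace ℝ (Fin D) → Fin D → Fin D → ℝ}

/-- The correlation between the Hessian of a flow at time `l` and the product of coordinates of
`d_{k+1}`. -/
def hessianTerm (P : Measure Ω) (d : ℤ → Ω → EuclideanSpace ℝ (Fin D))
    (H : ℕ → EuclideanSpace ℝ (Fin D) → Fin D → Fin D → ℝ) (i j : Fin D) (l k : ℕ) : ℝ :=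
  ∫ ω, H (l + 1) (partialSum d l ω) i j * centeredProd (covMat P d) i j (d ((k : ℤ) + 1) ω) ∂P

omit mΩ in
lemma partialSum_add_eq (d : ℤ → Ω → EuclideanSpace ℝ (Fin D)) (l r : ℕ) (ω : Ω) :
    partialSum d l ω = ∑ j ∈ Finset.range l, past d ((l + r : ℕ) : ℤ) ω (r + j) := by
  rw [partialSum_eq_sum_past]
  refine Finset.sum_congr rfl fun j _ => ?_
  rw [past, past]
  congr 1
  push_cast
  ring

variable [IsProbabilityMeasure P]

lemma StationaryMDS.abs_sum_hessianTerm_sub_le [IsGaussian γ] (h : StationaryMDS P p ℱ d)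
    (hp : 2 < p) (hp3 : p ≤ 3) (hB : BlockEstimate P p ℱ d A c C)
    (hF : TaylorFlow p γ n w F G H) {l r R : ℕ} (hK : 0 < K) (hR : 0 < R) (hr : r ≤ R)
    (hE : ExcessBound P p d A c K r) (hn : l + r + 1 ≤ n) (i j : Fin D) :
    |∑ m ∈ Finset.range R, (hessianTerm P d H i j (l + r) (l + r + m)
        - hessianTerm P d H i j l (l + r + m))|
      ≤ flowConst p γ * w (l + r + 1) * (C * blockRate P p ℱ d K R) := by
  have hTk := hF.taylor (l + r + 1) hn
  have hTl := hF.taylor (l + 1) (by lia)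
  set ζ : (ℕ → EuclideanSpace ℝ (Fin D)) → ℝ := fun x =>
    H (l + r + 1) (∑ j ∈ Finset.range (l + r), x j) i j
      - H (l + 1) (∑ j ∈ Finset.range l, x (r + j)) i j with hζ
  have hζm : Measurable ζ :=
    (((measurable_pi_iff.1 (measurable_pi_iff.1 hTk.measH i) j)).comp (by fun_prop)).sub
      (((measurable_pi_iff.1 (measurable_pi_iff.1 hTl.measH i) j)).comp (by fun_prop))
  have hζb : ∀ x, |ζ x| ≤ flowConst p γ * w (l + r + 1)
      * (‖∑ j ∈ Finset.range r, x j‖ ^ (p - 2) + (R : ℝ) ^ ((p - 2) / 2)) := fun x => by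
    have h1 := hF.abs_hessian_sub_le hp hp3 (l := l + 1) (k := l + r + 1) (by lia) hn
      (∑ j ∈ Finset.range (l + r), x j) (∑ j ∈ Finset.range l, x (r + j)) i j
    refine h1.trans ?_
    have h2 : ∑ j ∈ Finset.range (l + r), x j - ∑ j ∈ Finset.range l, x (r + j)
        = ∑ j ∈ Finset.range r, x j := by
      rw [add_comm l r, Finset.sum_range_add, add_sub_cancel_right]
    have h3 : (((l + r + 1 : ℕ) : ℝ) - ((l + 1 : ℕ) : ℝ)) = r := by push_cast; ring
    rw [h2, h3]
    have h4 : (r : ℝ) ^ ((p - 2) / 2) ≤ (R : ℝ) ^ ((p - 2) / 2) :=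
      Real.rpow_le_rpow (by positivity) (by exact_mod_cast hr) (by linarith)
    have h5 : 0 ≤ flowConst p γ * w (l + r + 1) := mul_nonneg (flowConst_nonneg p γ) hTk.nonneg
    gcongr
  have hmain := hB.mul_left hK hR hr hE (mul_nonneg (flowConst_nonneg p γ) hTk.nonneg) hζm hζb
    ((l + r : ℕ) : ℤ) i j
  convert hmain using 3 with m hm
  have i1 := h.integrable_hessian_mul_centeredProd hTk hp hp3 (h.memLp_partialSum (l + r))
    (covMat P d) ((l + r + m : ℕ) + 1) i j i j
  have i2 := h.integrable_hessian_mul_centeredProd hTl hp hp3 (h.memLp_partialSum l)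
    (covMat P d) ((l + r + m : ℕ) + 1) i j i j
  rw [hessianTerm, hessianTerm, ← integral_sub i1 i2]
  refine integral_congr_ae (ae_of_all _ fun ω => ?_)
  simp only [hζ]
  rw [← partialSum_add_eq, ← partialSum_eq_sum_past]
  rw [show (((l + r : ℕ) : ℤ) + ((m : ℤ) + 1)) = ((l + r + m : ℕ) : ℤ) + 1 by push_cast; ring]
  ring

lemma StationaryMDS.hessianTerm_zero (h : StationaryMDS P p ℱ d) (hp : 2 < p) (i j : Fin D)
    (k : ℕ) : hessianTerm P d H i j 0 k = 0 := by
  have h1 : ∀ ω, partialSum d 0 ω = 0 := fun ω => by simp [partialSum]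
  have h2 := h.integral_mul_self ((k : ℤ) + 1) i j
  simp only [hessianTerm, h1]
  rw [integral_const_mul]
  simp only [centeredProd]
  rw [integral_sub (h.integrable_mul_coord hp _ _ i j) (integrable_const _), h2]
  simp

end SecondOrder

section Lindeberg

variable {Ω : Type*} [mΩ : MeasurableSpace Ω] {D : ℕ} {P : Measure Ω} [IsProbabilityMeasure P]
  {p A c C K B : ℝ} {ℱ : ℤ → MeasurableSpace Ω} {d : ℤ → Ω → EuclideanSpace ℝ (Fin D)}
  {γ : Measure (EuclideanSpace ℝ (Fin D))} {n : ℕ} {w : ℕ → ℝ}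
  {F : ℕ → EuclideanSpace ℝ (Fin D) → ℝ} {G : ℕ → EuclideanSpace ℝ (Fin D) → Fin D → ℝ}
  {H : ℕ → EuclideanSpace ℝ (Fin D) → Fin D → Fin D → ℝ}

namespace StationaryMDS

variable (h : StationaryMDS P p ℱ d)
include h

lemma abs_sum_hessianTerm_le_dyadic [IsGaussian γ] (hp : 2 < p) (hp3 : p ≤ 3)
    (hB : BlockEstimate P p ℱ d A c C) (hC : 0 ≤ C) (hF : TaylorFlow p γ n w F G H) (hK : 0 < K)
    (hE : ∀ r < n, ExcessBound P p d A c K r) (hn : 0 < n) (i j : Fin D) :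
    |∑ k ∈ Finset.range n, hessianTerm P d H i j k k|
      ≤ ∑ L ∈ Finset.range n, ∑ q ∈ Finset.range (n / 2 ^ L),
        flowConst p γ * w (n - 2 ^ L * (q + 1) + 1) * (C * blockRate P p ℱ d K (2 ^ L)) := by
  have hfc := flowConst_nonneg p γ
  have hw : ∀ k ≤ n, 0 ≤ w k := fun k hk => (hF.taylor k hk).nonneg
  have hmain := abs_sum_range_le_dyadic
    (a := fun L q => ∑ m ∈ Finset.range (2 ^ L),
      hessianTerm P d H i j (n - 2 ^ L * (q + 1)) (n - 2 ^ L * (q + 1) + m))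
    (β := fun L q => flowConst p γ * w (n - 2 ^ L * (q + 1) + 1)
      * (C * blockRate P p ℱ d K (2 ^ L))) (n := n) ?_ ?_ ?_ (Nat.lt_two_pow_self (n := n))
  · refine le_trans (le_of_eq ?_) hmain
    rw [← Finset.sum_range_reflect]
    congr 1
    refine Finset.sum_congr rfl fun q _ => ?_
    simp [Nat.sub_sub, add_comm]
  · intro L q
    have h1 := blockRate_nonneg P p ℱ d hK.le (2 ^ L)
    have h2 : 0 < 2 ^ L * (q + 1) := by positivity
    have h3 := hw (n - 2 ^ L * (q + 1) + 1) (by lia)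
    positivity
  · intro L q hq
    have hT : 0 < 2 ^ L := by positivity
    have h1 : (2 * q + 2) * 2 ^ L ≤ n := (Nat.le_div_iff_mul_le hT).1 hq
    generalize hTd : 2 ^ L = T at *
    have e1 : T * (2 * q + 1 + 1) = 2 * (T * q) + 2 * T := by ring
    have e2 : T * (2 * q + 1) = 2 * (T * q) + T := by ring
    have e3 : 2 ^ (L + 1) * (q + 1) = 2 * (T * q) + 2 * T := by rw [pow_succ, hTd]; ring
    have e4 : (2 * q + 2) * T = 2 * (T * q) + 2 * T := by ring
    simp only [e1, e2, e3]
    obtain ⟨l, hl⟩ : ∃ l, n - (2 * (T * q) + 2 * T) = l := ⟨_, rfl⟩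
    have hl' : n - (2 * (T * q) + T) = l + T := by lia
    rw [hl, hl', show 2 ^ (L + 1) = T + T by rw [pow_succ, hTd]; ring, Finset.sum_range_add]
    have h2 := h.abs_sum_hessianTerm_sub_le hp hp3 hB hF (l := l) (r := T) (R := T) hK hT le_rfl
      (hE T (by lia)) (by lia) i j
    rw [Finset.sum_sub_distrib] at h2
    simp only [← add_assoc]
    rwa [add_comm (∑ m ∈ Finset.range T, hessianTerm P d H i j l (l + m)),
      add_sub_add_right_eq_sub]
  · intro L q hq
    have hT : 0 < 2 ^ L := by positivity
    have h1 : n < (2 * q + 2) * 2 ^ L := by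
      have := (Nat.div_lt_iff_lt_mul hT).1 (Nat.lt_succ_self (n / 2 ^ L))
      rwa [← hq] at this
    have h1' : (2 * q + 1) * 2 ^ L ≤ n := (Nat.le_div_iff_mul_le hT).1 hq.le
    generalize hTd : 2 ^ L = T at *
    have e2 : T * (2 * q + 1) = 2 * (T * q) + T := by ring
    have e3 : (2 * q + 1) * T = 2 * (T * q) + T := by ring
    have e4 : (2 * q + 2) * T = 2 * (T * q) + 2 * T := by ring
    simp only [e2]
    obtain ⟨r, hr⟩ : ∃ r, n - (2 * (T * q) + T) = r := ⟨_, rfl⟩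
    rw [hr]
    have h2 := h.abs_sum_hessianTerm_sub_le hp hp3 hB hF (l := 0) (r := r) (R := T) hK hT (by lia)
      (hE r (by lia)) (by lia) i j
    simpa only [zero_add, h.hessianTerm_zero hp, sub_zero] using h2

lemma abs_sum_hessianTerm_le [IsGaussian γ] (hp : 2 < p) (hp3 : p ≤ 3)
    (hB : BlockEstimate P p ℱ d A c C) (hC : 0 ≤ C)
    (hR : ∀ K N, 0 ≤ K → ∑ L ∈ Finset.range N,
      ((2 : ℝ) ^ L)⁻¹ * blockRate P p ℱ d K (2 ^ L) ≤ B * (1 + K ^ ((p - 2) / p)))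
    (hF : TaylorFlow p γ n w F G H) (hK : 0 < K)
    (hE : ∀ r < n, ExcessBound P p d A c K r) (hn : 0 < n) (i j : Fin D) :
    |∑ k ∈ Finset.range n, hessianTerm P d H i j k k|
      ≤ flowConst p γ * C * B * ((∑ k ∈ Finset.range n, w (k + 1)) * (1 + K ^ ((p - 2) / p))) := by
  refine (h.abs_sum_hessianTerm_le_dyadic hp hp3 hB hC hF hK hE hn i j).trans ?_
  have hfc := flowConst_nonneg p γ
  have hw : ∀ k ≤ n, 0 ≤ w k := fun k hk => (hF.taylor k hk).nonneg
  set s := ∑ k ∈ Finset.range n, w (k + 1) with hs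
  have hs0 : 0 ≤ s := Finset.sum_nonneg fun k hk => hw _ (by have := Finset.mem_range.1 hk; lia)
  have h1 : ∀ L, ∑ q ∈ Finset.range (n / 2 ^ L), w (n - 2 ^ L * (q + 1) + 1)
      ≤ ((2 : ℝ) ^ L)⁻¹ * s := fun L => by
    have hT : (0 : ℝ) < 2 ^ L := by positivity
    have h2 := sum_block_le hF.mono (T := 2 ^ L) (Q := n / 2 ^ L) (Nat.mul_div_le n _)
    rw [← Finset.mul_sum, Nat.cast_pow, Nat.cast_ofNat] at h2
    rw [le_inv_mul_iff₀ hT]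
    refine h2.trans (Finset.sum_le_sum_of_subset_of_nonneg ?_ fun k hk _ => ?_)
    · intro k hk
      exact Finset.mem_range.2 (Finset.mem_Ico.1 hk).2
    · exact hw _ (by have := Finset.mem_range.1 hk; lia)
  calc _ = ∑ L ∈ Finset.range n, (flowConst p γ * C) * (blockRate P p ℱ d K (2 ^ L)
        * ∑ q ∈ Finset.range (n / 2 ^ L), w (n - 2 ^ L * (q + 1) + 1)) := by
        refine Finset.sum_congr rfl fun L _ => ?_
        rw [Finset.mul_sum, Finset.mul_sum]
        exact Finset.sum_congr rfl fun q _ => by ring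
    _ ≤ ∑ L ∈ Finset.range n, (flowConst p γ * C) * (blockRate P p ℱ d K (2 ^ L)
        * (((2 : ℝ) ^ L)⁻¹ * s)) := by
        refine Finset.sum_le_sum fun L _ => ?_
        have := blockRate_nonneg P p ℱ d hK.le (2 ^ L)
        gcongr
        exact h1 L
    _ = (flowConst p γ * C * s) * ∑ L ∈ Finset.range n,
        ((2 : ℝ) ^ L)⁻¹ * blockRate P p ℱ d K (2 ^ L) := by
        rw [Finset.mul_sum]
        exact Finset.sum_congr rfl fun L _ => by ring
    _ ≤ (flowConst p γ * C * s) * (B * (1 + K ^ ((p - 2) / p))) := by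
        gcongr
        exact hR K n hK.le
    _ = _ := by ring

lemma abs_integral_flow_sub_le (hp : 2 < p) (hp3 : p ≤ 3)
    {S : Matrix (Fin D) (Fin D) ℝ} (hS : S.PosSemidef) (hSd : ∀ i j, S i j = covMat P d i j)
    (hγ : γ = multivariateGaussian 0 S)
    (hB : BlockEstimate P p ℱ d A c C) (hC : 0 ≤ C)
    (hR : ∀ K N, 0 ≤ K → ∑ L ∈ Finset.range N,
      ((2 : ℝ) ^ L)⁻¹ * blockRate P p ℱ d K (2 ^ L) ≤ B * (1 + K ^ ((p - 2) / p)))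
    (hF : TaylorFlow p γ n w F G H) (hK : 0 < K)
    (hE : ∀ r < n, ExcessBound P p d A c K r) :
    |∫ ω, F n (partialSum d n ω) ∂P - F 0 0|
      ≤ ((∫ ω, ‖d 0 ω‖ ^ p ∂P + ∫ y, ‖y‖ ^ p ∂γ) + D * D * (flowConst p γ * C * B))
        * ((∑ k ∈ Finset.range n, w (k + 1)) * (1 + K ^ ((p - 2) / p))) := by
  have hG : IsGaussian γ := hγ ▸ inferInstance
  have hw : ∀ k ≤ n, 0 ≤ w k := fun k hk => (hF.taylor k hk).nonneg
  set m := ∫ ω, ‖d 0 ω‖ ^ p ∂P + ∫ y, ‖y‖ ^ p ∂γ with hm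
  have hm0 : 0 ≤ m := add_nonneg (integral_nonneg fun ω => by positivity)
    (integral_nonneg fun ω => by positivity)
  set s := ∑ k ∈ Finset.range n, w (k + 1) with hs
  have hs0 : 0 ≤ s := Finset.sum_nonneg fun k hk => hw _ (by have := Finset.mem_range.1 hk; lia)
  have hκ : 0 ≤ K ^ ((p - 2) / p) := by positivity
  rcases Nat.eq_zero_or_pos n with rfl | hn
  · simp [hs, partialSum]
  set a : ℕ → ℝ := fun k => ∫ ω, F k (partialSum d k ω) ∂P with ha
  set b : ℕ → ℝ := fun k => ∑ i, ∑ j, hessianTerm P d H i j k k with hb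
  have hstep : ∀ k ∈ Finset.range n, |a (k + 1) - a k - 1 / 2 * b k| ≤ w (k + 1) * m := by
    intro k hk
    have hk' := Finset.mem_range.1 hk
    have hT := hF.taylor (k + 1) hk'
    have hI := ((hF.taylor k hk'.le).integrable_comp hp hp3 (h.memLp_partialSum k)).1
    have := h.abs_lindeberg_step_le hT hp hp3 hS hγ (fun x => hF.succ_eq hk' x) k hI
    have hSd' : (fun i j => S i j) = covMat P d := by
      ext i j
      exact hSd i j
    simpa only [hb, ha, hessianTerm, ← hSd'] using this
  have h0 : a 0 = F 0 0 := by simp [ha, partialSum]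
  have h1 : a n - F 0 0 = ∑ k ∈ Finset.range n, (a (k + 1) - a k - 1 / 2 * b k)
      + 1 / 2 * ∑ k ∈ Finset.range n, b k := by
    rw [Finset.sum_sub_distrib, Finset.sum_range_sub, h0, Finset.mul_sum]
    ring
  have h2 : |∑ k ∈ Finset.range n, (a (k + 1) - a k - 1 / 2 * b k)| ≤ s * m := by
    refine (Finset.abs_sum_le_sum_abs _ _).trans ((Finset.sum_le_sum hstep).trans_eq ?_)
    rw [hs, Finset.sum_mul]
  have h3 : |∑ k ∈ Finset.range n, b k|
      ≤ D * D * (flowConst p γ * C * B * (s * (1 + K ^ ((p - 2) / p)))) := by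
    have e : ∑ k ∈ Finset.range n, b k
        = ∑ i, ∑ j, ∑ k ∈ Finset.range n, hessianTerm P d H i j k k := by
      simp only [hb]
      rw [Finset.sum_comm]
      exact Finset.sum_congr rfl fun i _ => Finset.sum_comm
    rw [e]
    refine (Finset.abs_sum_le_sum_abs _ _).trans ?_
    refine (Finset.sum_le_sum fun i _ => (Finset.abs_sum_le_sum_abs _ _).trans
      (Finset.sum_le_sum fun j _ =>
        h.abs_sum_hessianTerm_le hp hp3 hB hC hR hF hK hE hn i j)).trans_eq ?_
    simp only [Finset.sum_const, Finset.card_univ, Fintype.card_fin, nsmul_eq_mul]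
    rw [hs]
    ring
  have h4 : s * m ≤ m * (s * (1 + K ^ ((p - 2) / p))) := by
    nlinarith [mul_nonneg (mul_nonneg hm0 hs0) hκ]
  calc |a n - F 0 0| ≤ s * m + 1 / 2 * |∑ k ∈ Finset.range n, b k| := by
        rw [h1]
        refine (abs_add_le _ _).trans (add_le_add h2 ?_)
        rw [abs_mul, abs_of_pos (by norm_num : (0 : ℝ) < 1 / 2)]
    _ ≤ _ := by
        have := abs_nonneg (∑ k ∈ Finset.range n, b k)
        rw [add_mul]
        linarith

end StationaryMDS

end Lindeberg

section Excess

variable {Ω : Type*} [mΩ : MeasurableSpace Ω] {D : ℕ} {P : Measure Ω} [IsProbabilityMeasure P]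
  {p : ℝ} {ℱ : ℤ → MeasurableSpace Ω} {d : ℤ → Ω → EuclideanSpace ℝ (Fin D)}
  {γ : Measure (EuclideanSpace ℝ (Fin D))} {S : Matrix (Fin D) (Fin D) ℝ}

lemma integral_integral_sqrt_sub (hS : S.PosSemidef) (hγ : γ = multivariateGaussian 0 S)
    {f : EuclideanSpace ℝ (Fin D) → ℝ} (hf : Measurable f) {K q : ℝ} (hq : 0 ≤ q)
    (hK : ∀ x, |f x| ≤ K * (1 + ‖x‖) ^ q) {a b c : ℝ} (hab : a ≤ b) (hbc : b ≤ c)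
    (x : EuclideanSpace ℝ (Fin D)) :
    ∫ y, f (x + √(c - a) • y) ∂γ = ∫ y, ∫ z, f (x + √(b - a) • y + √(c - b) • z) ∂γ ∂γ := by
  refine (integral_integral_multivariateGaussian hS hγ ?_ hf hq hK x).symm
  rw [Real.sq_sqrt (by linarith), Real.sq_sqrt (by linarith), Real.sq_sqrt (by linarith)]
  ring

lemma HasTaylor.exists_taylorFlow (hS : S.PosSemidef) (hγ : γ = multivariateGaussian 0 S)
    {w : ℝ} {f : EuclideanSpace ℝ (Fin D) → ℝ} {g : EuclideanSpace ℝ (Fin D) → Fin D → ℝ}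
    {h : EuclideanSpace ℝ (Fin D) → Fin D → Fin D → ℝ} (hT : HasTaylor p w f g h) (hp : 2 < p)
    (hp3 : p ≤ 3) (n : ℕ) :
    ∃ G H, TaylorFlow p γ n (fun _ => w)
      (fun k x => ∫ y, f (x + √((n : ℝ) - k) • y) ∂γ) G H := by
  have hG : IsGaussian γ := hγ ▸ inferInstance
  obtain ⟨K, -, hK, -⟩ := hT.exists_growth hp hp3
  refine ⟨_, _, fun k _ => hT.average hp hp3 γ (√((n : ℝ) - k)), fun l k hlk hk x => ?_,
    fun _ _ _ _ => le_rfl⟩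
  exact integral_integral_sqrt_sub hS hγ hT.measF (by linarith) hK (by exact_mod_cast hlk)
    (by exact_mod_cast hk) x

lemma exists_mul_one_add_rpow_le {θ : ℝ} (hθ : θ ≤ 1 / 2) {C : ℝ} :
    ∃ K : ℝ, 0 < K ∧ C * (1 + K ^ θ) ≤ K := by
  set m := max 1 (2 * |C|) with hm
  have hm1 : 1 ≤ m := le_max_left _ _
  have h2 : 2 * |C| ≤ m := le_max_right _ _
  refine ⟨m ^ 2, by positivity, ?_⟩
  have h3 : (m ^ 2) ^ θ ≤ m := by
    calc (m ^ 2) ^ θ ≤ (m ^ 2) ^ (1 / 2 : ℝ) :=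
          Real.rpow_le_rpow_of_exponent_le (one_le_pow₀ hm1) hθ
      _ = m := by rw [← Real.sqrt_eq_rpow, Real.sqrt_sq (by linarith)]
  have h4 : 0 ≤ (m ^ 2) ^ θ := by positivity
  calc C * (1 + (m ^ 2) ^ θ) ≤ |C| * (1 + (m ^ 2) ^ θ) := by
        gcongr
        exact le_abs_self C
    _ ≤ |C| * (m + m) := by gcongr
    _ ≤ m ^ 2 := by nlinarith

lemma StationaryMDS.exists_forall_excessBound (h : StationaryMDS P p ℱ d) (hp : 2 < p)
    (hp3 : p ≤ 3) (hS : S.PosSemidef) (hSd : ∀ i j, S i j = covMat P d i j)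
    (hγ : γ = multivariateGaussian 0 S) {A c C B : ℝ} (hB : BlockEstimate P p ℱ d A c C)
    (hC : 0 ≤ C)
    (hR : ∀ K N, 0 ≤ K → ∑ L ∈ Finset.range N,
      ((2 : ℝ) ^ L)⁻¹ * blockRate P p ℱ d K (2 ^ L) ≤ B * (1 + K ^ ((p - 2) / p)))
    (hA : ∀ (i : Fin D) (R t : ℝ), 0 < R → 0 ≤ t →
      ∫ y, max (|√R * y i| - t) 0 ^ p ∂γ ≤ A * (R ^ (p / 2) * Real.exp (-c * t ^ 2 / R))) :
    ∃ K, 0 < K ∧ ∀ n, ExcessBound P p d A c K n := by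
  set C' := (∫ ω, ‖d 0 ω‖ ^ p ∂P + ∫ y, ‖y‖ ^ p ∂γ) + D * D * (flowConst p γ * C * B) with hC'
  obtain ⟨K, hK, hKC⟩ := exists_mul_one_add_rpow_le (θ := (p - 2) / p)
    (by rw [div_le_div_iff₀ (by linarith) (by norm_num)]; linarith)
    (C := C' * (2 * (p * (p - 1))))
  refine ⟨K, hK, fun n => ?_⟩
  induction n using Nat.strong_induction_on with
  | _ n ih =>
  intro i t ht
  rcases Nat.eq_zero_or_pos n with rfl | hn
  · have h1 : ∀ ω, max (|partialSum d 0 ω i| - t) 0 ^ p = 0 := fun ω => by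
      simp [partialSum, ht, Real.zero_rpow (by linarith : p ≠ 0)]
    simp [h1, Real.zero_rpow (by linarith : p / 2 ≠ 0)]
  · have hn' : (0 : ℝ) < n := by exact_mod_cast hn
    obtain ⟨g, H, hT⟩ := exists_hasTaylor_excess hp hp3 ht i
    obtain ⟨G, H', hF⟩ := hT.exists_taylorFlow hS hγ hp hp3 n
    have hG : IsGaussian γ := hγ ▸ inferInstance
    have h1 := h.abs_integral_flow_sub_le hp hp3 hS hSd hγ hB hC hR hF hK ih
    have h2 := hA i n t hn' ht
    simp only [sub_self, Real.sqrt_zero, zero_smul, add_zero, integral_const, probReal_univ,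
      one_mul, Nat.cast_zero, sub_zero, zero_add, PiLp.smul_apply, smul_eq_mul, Finset.sum_const,
      Finset.card_range, nsmul_eq_mul] at h1
    have h3 : C' * (n * (2 * (p * (p - 1))) * (1 + K ^ ((p - 2) / p))) ≤ K * n := by
      calc _ = n * (C' * (2 * (p * (p - 1))) * (1 + K ^ ((p - 2) / p))) := by ring
        _ ≤ n * K := by gcongr
        _ = K * n := mul_comm _ _
    linarith [(abs_le.1 h1).2]

theorem StationaryMDS.exists_abs_integral_flow_sub_le (h : StationaryMDS P p ℱ d) (hp : 2 < p)
    (hp3 : p ≤ 3) (he : ∀ n i j, envNorm P p (condDev P ℱ d (n + 1) i j) ≠ ⊤)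
    (hl : ∀ n i j, eLpNorm (condDev P ℱ d (n + 1) i j) (ENNReal.ofReal (p / 2)) P ≠ ⊤)
    (hs1 : Summable fun m : ℕ => ((m : ℝ) + 1) ^ (-(3 - p / 2)) * envDev P p ℱ d (m + 1))
    (hs2 : Summable fun m : ℕ => ((m : ℝ) + 1) ^ (-(1 + 2 / p)) * lpDev P p ℱ d (m + 1))
    (hS : S.PosSemidef) (hSd : ∀ i j, S i j = covMat P d i j)
    (hγ : γ = multivariateGaussian 0 S) :
    ∃ C, 0 ≤ C ∧ ∀ n w F G H, TaylorFlow p γ n w F G H →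
      |∫ ω, F n (partialSum d n ω) ∂P - F 0 0| ≤ C * ∑ k ∈ Finset.range n, w (k + 1) := by
  have hG : IsGaussian γ := hγ ▸ inferInstance
  obtain ⟨c, A, hc, hA, hcA⟩ := exists_integral_excess_le γ (by linarith : 0 < p)
  obtain ⟨C, hC, hB'⟩ := exists_abs_sum_integral_comp_past_le (Ω := Ω) D hp hp3 hc hA
  have hB : BlockEstimate P p ℱ d A c C := hB' P ℱ d h he hl
  obtain ⟨B, hB0, hR⟩ := exists_sum_blockRate_le hp hs1 hs2 hp3
  obtain ⟨K, hK, hE⟩ := h.exists_forall_excessBound hp hp3 hS hSd hγ hB hC hR hcA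
  refine ⟨((∫ ω, ‖d 0 ω‖ ^ p ∂P + ∫ y, ‖y‖ ^ p ∂γ) + D * D * (flowConst p γ * C * B))
    * (1 + K ^ ((p - 2) / p)), ?_, fun n w F G H hF => ?_⟩
  · have h1 : 0 ≤ ∫ ω, ‖d 0 ω‖ ^ p ∂P := integral_nonneg fun ω => by positivity
    have h2 : 0 ≤ ∫ y, ‖y‖ ^ p ∂γ := integral_nonneg fun ω => by positivity
    have h3 := flowConst_nonneg p γ
    positivity
  · refine (h.abs_integral_flow_sub_le hp hp3 hS hSd hγ hB hC hR hF hK fun r _ => hE r).trans_eq ?_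
    ring

end Excess

section LipschitzFlow

variable {Ω : Type*} [mΩ : MeasurableSpace Ω] {D : ℕ} {P : Measure Ω} {p : ℝ}
  {ℱ : ℤ → MeasurableSpace Ω} {d : ℤ → Ω → EuclideanSpace ℝ (Fin D)}
  {γ : Measure (EuclideanSpace ℝ (Fin D))} {S : Matrix (Fin D) (Fin D) ℝ}
  {A L : EuclideanSpace ℝ (Fin D) →L[ℝ] EuclideanSpace ℝ (Fin D)}

lemma exists_generalizedInverse {E : Type*} [NormedAddCommGroup E] [NormedSpace ℝ E]
    [FiniteDimensional ℝ E] (A : E →L[ℝ] E) : ∃ L : E →L[ℝ] E, ∀ x, A (L (A x)) = A x := by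
  obtain ⟨g, hg⟩ := A.toLinearMap.rangeRestrict.exists_rightInverse_of_surjective
    A.toLinearMap.range_rangeRestrict
  obtain ⟨g', hg'⟩ := g.exists_extend
  refine ⟨LinearMap.toContinuousLinearMap g', fun x => ?_⟩
  have h1 := LinearMap.congr_fun hg (A.toLinearMap.rangeRestrict x)
  have h2 := LinearMap.congr_fun hg' (A.toLinearMap.rangeRestrict x)
  have h3 := congrArg Subtype.val h1
  simp only [LinearMap.comp_apply, LinearMap.id_apply] at h2 h3
  rw [← h2] at h3
  exact h3

lemma integral_inner_sq_eq [IsFiniteMeasure P] {X : Ω → EuclideanSpace ℝ (Fin D)}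
    (hX : MemLp X 2 P) (u : EuclideanSpace ℝ (Fin D)) :
    ∫ ω, inner ℝ (X ω) u ^ 2 ∂P = ∑ i, ∑ j, (∫ ω, X ω i * X ω j ∂P) * (u i * u j) := by
  have hX' : ∀ i, MemLp (fun ω => X ω i) 2 P := fun i => by
    have hc : Continuous fun x : EuclideanSpace ℝ (Fin D) => x i := by fun_prop
    exact hX.mono (hc.comp_aestronglyMeasurable hX.1)
      (ae_of_all _ fun ω => by simpa using PiLp.norm_apply_le (X ω) i)
  have hI : ∀ i j, Integrable (fun ω => X ω i * X ω j * (u i * u j)) P := fun i j =>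
    ((hX' i).integrable_mul (hX' j)).mul_const _
  have e : ∀ ω, inner ℝ (X ω) u ^ 2 = ∑ i, ∑ j, X ω i * X ω j * (u i * u j) := fun ω => by
    rw [PiLp.inner_apply, sq, Finset.sum_mul_sum]
    refine Finset.sum_congr rfl fun i _ => Finset.sum_congr rfl fun j _ => ?_
    simp
    ring
  simp only [e]
  rw [integral_finsetSum _ fun i _ => integrable_finsetSum _ fun j _ => hI i j]
  refine Finset.sum_congr rfl fun i _ => ?_
  rw [integral_finsetSum _ fun j _ => hI i j]
  exact Finset.sum_congr rfl fun j _ => integral_mul_const _ _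

lemma ae_apply_apply_eq [IsFiniteMeasure P] {X : Ω → EuclideanSpace ℝ (Fin D)} (hX : MemLp X 2 P)
    (hA : ∀ u v, inner ℝ (A u) v = inner ℝ u (A v))
    (hA2 : ∀ u, ‖A u‖ ^ 2 = ∑ i, ∑ j, (∫ ω, X ω i * X ω j ∂P) * (u i * u j))
    (hL : ∀ x, A (L (A x)) = A x) : ∀ᵐ ω ∂P, A (L (X ω)) = X ω := by
  set B := A ∘L L - ContinuousLinearMap.id ℝ _ with hB
  set e : Fin D → EuclideanSpace ℝ (Fin D) := fun i => EuclideanSpace.single i 1 with he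
  have hker : ∀ i, A (B.adjoint (e i)) = 0 := fun i => by
    refine ext_inner_right ℝ fun v => ?_
    rw [hA, ContinuousLinearMap.adjoint_inner_left, inner_zero_left]
    simp [hB, hL]
  have hz : ∀ i, ∀ᵐ ω ∂P, inner ℝ (X ω) (B.adjoint (e i)) = 0 := fun i => by
    have h1 := integral_inner_sq_eq hX (B.adjoint (e i))
    rw [← hA2, hker, norm_zero, zero_pow two_ne_zero] at h1
    have h2 : Integrable (fun ω => inner ℝ (X ω) (B.adjoint (e i)) ^ 2) P :=
      (hX.inner_const (B.adjoint (e i))).integrable_sq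
    have h3 := (integral_eq_zero_iff_of_nonneg (fun ω => sq_nonneg _) h2).1 h1
    filter_upwards [h3] with ω hω
    simpa using hω
  filter_upwards [ae_all_iff.2 hz] with ω hω
  have hBX : B (X ω) = 0 := by
    ext i
    have := hω i
    rw [ContinuousLinearMap.adjoint_inner_right] at this
    simpa [he, EuclideanSpace.inner_single_right] using this
  simpa [hB, sub_eq_zero] using hBX

lemma LipschitzWith.abs_le_mul_one_add_norm {g : EuclideanSpace ℝ (Fin D) → ℝ}
    (hg : LipschitzWith 1 g) (x : EuclideanSpace ℝ (Fin D)) :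
    |g x| ≤ (|g 0| + 1) * (1 + ‖x‖) ^ (1 : ℝ) := by
  have h1 := hg.dist_le_mul x 0
  rw [Real.dist_eq, dist_zero_right, NNReal.coe_one, one_mul] at h1
  have h2 : |g x| ≤ |g 0| + ‖x‖ := by
    have := abs_sub_abs_le_abs_sub (g x) (g 0)
    linarith
  rw [Real.rpow_one]
  nlinarith [abs_nonneg (g 0), norm_nonneg x, mul_nonneg (abs_nonneg (g 0)) (norm_nonneg x)]

lemma exists_taylorFlow_lipschitz (hp : 2 < p) (hp3 : p ≤ 3) (hS : S.PosSemidef)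
    (hγ : γ = multivariateGaussian 0 S)
    (hγA : γ = (stdGaussian (EuclideanSpace ℝ (Fin D))).map A)
    (hL : ∀ x, A (L (A x)) = A x) :
    ∃ C : ℝ, 0 ≤ C ∧ ∀ g : EuclideanSpace ℝ (Fin D) → ℝ, LipschitzWith 1 g → ∀ n : ℕ,
      ∃ G H, TaylorFlow p γ n (fun k => C * √((n : ℝ) + 1 - k) ^ (1 - p))
        (fun k x => ∫ y, g (A (L x) + √((n : ℝ) + 1 - k) • y) ∂γ) G H := by
  obtain ⟨C, hC, h⟩ := exists_hasTaylor_smoothing (D := D) hp hp3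
  refine ⟨‖A‖ * C * ‖L‖ ^ p, by positivity, fun g hg n => ?_⟩
  have hφ : LipschitzWith ‖A‖₊ (g ∘ A) := by simpa using hg.comp A.lipschitz
  have hpos : ∀ k ≤ n, (0 : ℝ) < n + 1 - k := fun k hk => by
    have : (k : ℝ) ≤ n := by exact_mod_cast hk
    linarith
  have hgm : Measurable g := hg.continuous.measurable
  have key : ∀ k ≤ n, ∃ G H, HasTaylor p (‖A‖ * C * ‖L‖ ^ p * √((n : ℝ) + 1 - k) ^ (1 - p))
      (fun x => ∫ y, g (A (L x) + √((n : ℝ) + 1 - k) • y) ∂γ) G H := fun k hk => by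
    obtain ⟨G, H, hT⟩ := h _ _ hφ L (√((n : ℝ) + 1 - k)) (Real.sqrt_pos.2 (hpos k hk))
    rw [coe_nnnorm] at hT
    refine ⟨G, H, ?_⟩
    convert hT using 2 with x
    rw [hγA, integral_map A.continuous.aemeasurable
      (by exact (hgm.comp (by fun_prop)).aestronglyMeasurable)]
    simp
  choose! G H hGH using key
  refine ⟨G, H, hGH, fun l k hlk hk x => ?_, fun l k hlk hk => ?_⟩
  · have hlk' : (l : ℝ) ≤ k := by exact_mod_cast hlk
    rw [integral_integral_sqrt_sub hS hγ hgm zero_le_one hg.abs_le_mul_one_add_norm hlk'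
      (by linarith [hpos k hk])]
    have hae : ∀ᵐ y ∂γ, A (L y) = y := by
      rw [hγA, ae_map_iff A.continuous.aemeasurable
        (measurableSet_eq_fun (by fun_prop) (by fun_prop))]
      exact ae_of_all _ hL
    refine integral_congr_ae ?_
    filter_upwards [hae] with y hy
    simp only [map_add, map_smul, hy]
  · have hlk' : (l : ℝ) ≤ k := by exact_mod_cast hlk
    have h1 : √((n : ℝ) + 1 - k) ≤ √((n : ℝ) + 1 - l) := Real.sqrt_le_sqrt (by linarith)
    have h2 := Real.rpow_le_rpow_of_nonpos (Real.sqrt_pos.2 (hpos k hk)) h1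
      (by linarith : 1 - p ≤ 0)
    gcongr

lemma LipschitzWith.abs_integral_sub_le {X Y : Ω → EuclideanSpace ℝ (Fin D)}
    [IsProbabilityMeasure P] {g : EuclideanSpace ℝ (Fin D) → ℝ} (hg : LipschitzWith 1 g)
    (hX : Integrable X P) (hY : Integrable Y P) :
    |∫ ω, g (X ω) ∂P - ∫ ω, g (Y ω) ∂P| ≤ ∫ ω, ‖X ω - Y ω‖ ∂P := by
  have hI : ∀ {X : Ω → EuclideanSpace ℝ (Fin D)}, Integrable X P →
      Integrable (fun ω => g (X ω)) P := fun {X} hX => by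
    refine ((((integrable_const (1 : ℝ)).add hX.norm).const_mul (|g 0| + 1))).mono'
      (hg.continuous.comp_aestronglyMeasurable hX.1) (ae_of_all _ fun ω => ?_)
    simpa using hg.abs_le_mul_one_add_norm (X ω)
  rw [← integral_sub (hI hX) (hI hY), ← Real.norm_eq_abs]
  refine norm_integral_le_of_norm_le (hX.sub hY).norm (ae_of_all _ fun ω => ?_)
  have h1 := hg.dist_le_mul (X ω) (Y ω)
  rw [dist_eq_norm, dist_eq_norm, NNReal.coe_one, one_mul] at h1
  exact h1

end LipschitzFlow

section LipschitzComparison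

variable {Ω : Type*} [mΩ : MeasurableSpace Ω] {D : ℕ} {P : Measure Ω} [IsProbabilityMeasure P]
  {p : ℝ} {ℱ : ℤ → MeasurableSpace Ω} {d : ℤ → Ω → EuclideanSpace ℝ (Fin D)}
  {γ : Measure (EuclideanSpace ℝ (Fin D))} {S : Matrix (Fin D) (Fin D) ℝ}
  {A L : EuclideanSpace ℝ (Fin D) →L[ℝ] EuclideanSpace ℝ (Fin D)}

lemma StationaryMDS.ae_apply_apply_partialSum_eq (h : StationaryMDS P p ℱ d) (hp : 2 < p)
    (hA : ∀ u v, inner ℝ (A u) v = inner ℝ u (A v))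
    (hA2 : ∀ u, ‖A u‖ ^ 2 = ∑ i, ∑ j, covMat P d i j * (u i * u j))
    (hL : ∀ x, A (L (A x)) = A x) (n : ℕ) :
    ∀ᵐ ω ∂P, A (L (partialSum d n ω)) = partialSum d n ω := by
  have h1 : ∀ k : ℤ, ∀ᵐ ω ∂P, A (L (d k ω)) = d k ω := fun k => by
    refine ae_apply_apply_eq ((h.memLp k).mono_exponent ?_) hA (fun u => ?_) hL
    · rw [show (2 : ℝ≥0∞) = ENNReal.ofReal 2 by simp]
      exact ENNReal.ofReal_le_ofReal hp.le
    · simp only [h.integral_mul_self k]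
      exact hA2 u
  filter_upwards [ae_all_iff.2 h1] with ω hω
  simp only [partialSum, map_sum, hω]

lemma abs_sqrt_add_one_sub_sqrt_le (n : ℕ) : |√((n : ℝ) + 1) - √(n : ℝ)| ≤ 1 := by
  have h1 : √(n : ℝ) ≤ √((n : ℝ) + 1) := Real.sqrt_le_sqrt (by linarith)
  have h2 : √((n : ℝ) + 1) ≤ √(n : ℝ) + √1 := by
    refine Real.sqrt_le_iff.2 ⟨by positivity, ?_⟩
    have h3 := Real.sq_sqrt (Nat.cast_nonneg (α := ℝ) n)
    have h4 := Real.sqrt_nonneg (n : ℝ)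
    rw [Real.sqrt_one]
    nlinarith
  rw [Real.sqrt_one] at h2
  rw [abs_le]
  constructor <;> linarith

lemma sum_sqrt_sub_rpow_eq (n : ℕ) (p : ℝ) :
    ∑ k ∈ Finset.range n, √((n : ℝ) + 1 - ((k + 1 : ℕ) : ℝ)) ^ (1 - p)
      = ∑ k ∈ Finset.range n, ((k : ℝ) + 1) ^ ((1 - p) / 2) := by
  rw [← Finset.sum_range_reflect]
  refine Finset.sum_congr rfl fun k hk => ?_
  have hk' := Finset.mem_range.1 hk
  have h1 : (n : ℝ) + 1 - ((n - 1 - k + 1 : ℕ) : ℝ) = k + 1 := by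
    have h2 : n - 1 - k + 1 + k = n := by lia
    have h3 : ((n - 1 - k + 1 : ℕ) : ℝ) + k = n := by exact_mod_cast h2
    linarith
  rw [h1, Real.sqrt_eq_rpow, ← Real.rpow_mul (by positivity)]
  congr 1
  ring

theorem StationaryMDS.exists_abs_integral_lipschitz_sub_le (h : StationaryMDS P p ℱ d) (hp : 2 < p)
    (hp3 : p ≤ 3) (he : ∀ n i j, envNorm P p (condDev P ℱ d (n + 1) i j) ≠ ⊤)
    (hl : ∀ n i j, eLpNorm (condDev P ℱ d (n + 1) i j) (ENNReal.ofReal (p / 2)) P ≠ ⊤)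
    (hs1 : Summable fun m : ℕ => ((m : ℝ) + 1) ^ (-(3 - p / 2)) * envDev P p ℱ d (m + 1))
    (hs2 : Summable fun m : ℕ => ((m : ℝ) + 1) ^ (-(1 + 2 / p)) * lpDev P p ℱ d (m + 1))
    (hS : S.PosSemidef) (hSd : ∀ i j, S i j = covMat P d i j)
    (hγ : γ = multivariateGaussian 0 S) :
    ∃ C : ℝ, 0 ≤ C ∧ ∀ g : EuclideanSpace ℝ (Fin D) → ℝ, LipschitzWith 1 g → ∀ n : ℕ,
      |∫ ω, g (partialSum d n ω) ∂P - ∫ y, g (√(n : ℝ) • y) ∂γ|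
        ≤ C * (1 + ∑ k ∈ Finset.range n, ((k : ℝ) + 1) ^ ((1 - p) / 2)) := by
  have hG : IsGaussian γ := hγ ▸ inferInstance
  obtain ⟨A, hA, hA2, hAγ⟩ := exists_sqrt_of_posSemidef hS
  simp only [hSd] at hA2
  obtain ⟨L, hL⟩ := exists_generalizedInverse A
  obtain ⟨C₁, hC₁, hflow⟩ := exists_taylorFlow_lipschitz hp hp3 hS hγ (hγ.trans hAγ) hL
  obtain ⟨C₂, hC₂, hmain⟩ := h.exists_abs_integral_flow_sub_le hp hp3 he hl hs1 hs2 hS hSd hγ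
  have hid : Integrable (fun y : EuclideanSpace ℝ (Fin D) => y) γ := IsGaussian.integrable_id
  set m := ∫ y, ‖y‖ ∂γ with hm
  have hm0 : 0 ≤ m := integral_nonneg fun y => norm_nonneg y
  refine ⟨2 * m + C₂ * C₁, by positivity, fun g hg n => ?_⟩
  obtain ⟨G, H, hF⟩ := hflow g hg n
  have h1 := hmain n _ _ _ _ hF
  rw [← Finset.mul_sum, sum_sqrt_sub_rpow_eq] at h1
  simp only [add_sub_cancel_left, Real.sqrt_one, one_smul, Nat.cast_zero, sub_zero, map_zero,
    zero_add] at h1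
  have hMI : Integrable (partialSum d n) P := (h.memLp_partialSum n).integrable (by
    rw [← ENNReal.ofReal_one]
    exact ENNReal.ofReal_le_ofReal (by linarith))
  have hshift : ∀ x, |g x - ∫ y, g (x + y) ∂γ| ≤ m := fun x => by
    have := hg.abs_integral_sub_le (P := γ) (integrable_const x) ((integrable_const x).add hid)
    simpa using this
  have hFI : Integrable (fun ω => ∫ y, g (A (L (partialSum d n ω)) + y) ∂γ) P := by
    have := ((hF.taylor n le_rfl).integrable_comp hp hp3 (h.memLp_partialSum n)).1
    simpa only [add_sub_cancel_left, Real.sqrt_one, one_smul] using this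
  have hgI : Integrable (fun ω => g (partialSum d n ω)) P := by
    refine ((((integrable_const (1 : ℝ)).add hMI.norm).const_mul (|g 0| + 1))).mono'
      (hg.continuous.comp_aestronglyMeasurable hMI.1) (ae_of_all _ fun ω => ?_)
    simpa using hg.abs_le_mul_one_add_norm (partialSum d n ω)
  have h2 : |∫ ω, g (partialSum d n ω) ∂P
      - ∫ ω, ∫ y, g (A (L (partialSum d n ω)) + y) ∂γ ∂P| ≤ m := by
    rw [← integral_sub hgI hFI, ← Real.norm_eq_abs]
    refine (norm_integral_le_of_norm_le_const (C := m) ?_).trans_eq (by simp)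
    filter_upwards [h.ae_apply_apply_partialSum_eq hp hA hA2 hL n] with ω hω
    rw [hω]
    exact hshift _
  have h3 : |∫ y, g (√((n : ℝ) + 1) • y) ∂γ - ∫ y, g (√(n : ℝ) • y) ∂γ| ≤ m := by
    have i1 : ∀ a : ℝ, Integrable (fun y : EuclideanSpace ℝ (Fin D) => a • y) γ :=
      fun a => hid.smul a
    refine (hg.abs_integral_sub_le (i1 _) (i1 _)).trans ?_
    refine integral_mono ((i1 _).sub (i1 _)).norm hid.norm fun y => ?_
    rw [← sub_smul, norm_smul, Real.norm_eq_abs]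
    exact mul_le_of_le_one_left (norm_nonneg _) (abs_sqrt_add_one_sub_sqrt_le n)
  set s := ∑ k ∈ Finset.range n, ((k : ℝ) + 1) ^ ((1 - p) / 2) with hs
  have hs0 : 0 ≤ s := Finset.sum_nonneg fun k _ => by positivity
  have h4 := mul_nonneg hm0 hs0
  have h5 := mul_nonneg hC₂ hC₁
  rw [abs_le] at *
  constructor <;> nlinarith

end LipschitzComparison

section Rates

lemma sum_rpow_le_rpow {θ : ℝ} (h0 : 0 ≤ θ) (h1 : θ < 1) (n : ℕ) :
    ∑ k ∈ Finset.range n, ((k : ℝ) + 1) ^ (-θ) ≤ (1 - θ)⁻¹ * (n : ℝ) ^ (1 - θ) := by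
  have h1' : 0 < 1 - θ := by linarith
  induction n with
  | zero => simp [Real.zero_rpow h1'.ne']
  | succ n ih =>
    rw [Finset.sum_range_succ]
    refine (add_le_add_left ih _).trans ?_
    have hn : (0 : ℝ) < n + 1 := by positivity
    have hb := rpow_one_add_le_one_add_mul_self (s := -((n : ℝ) + 1)⁻¹) (p := 1 - θ)
      (by
        rw [neg_le_neg_iff]
        exact inv_le_one_of_one_le₀ (by linarith [Nat.cast_nonneg (α := ℝ) n]))
      h1'.le (by linarith)
    have e1 : 1 + -((n : ℝ) + 1)⁻¹ = n / (n + 1) := by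
      field_simp
      ring
    rw [e1, Real.div_rpow (by positivity) hn.le, div_le_iff₀ (by positivity)] at hb
    have e2 : ((n : ℝ) + 1) ^ (1 - θ) = ((n : ℝ) + 1) ^ (-θ) * (n + 1) := by
      rw [← Real.rpow_add_one hn.ne']
      congr 1
      ring
    have e3 : (1 + (1 - θ) * -((n : ℝ) + 1)⁻¹) * ((n : ℝ) + 1) ^ (1 - θ)
        = ((n : ℝ) + 1) ^ (1 - θ) - (1 - θ) * ((n : ℝ) + 1) ^ (-θ) := by
      rw [e2]
      field_simp
      ring
    rw [e3] at hb
    rw [Nat.cast_succ, le_inv_mul_iff₀ h1', mul_add, mul_inv_cancel_left₀ h1'.ne']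
    linarith

lemma sum_rpow_neg_one_le_one_add_log (n : ℕ) :
    ∑ k ∈ Finset.range n, ((k : ℝ) + 1) ^ (-1 : ℝ) ≤ 1 + Real.log n := by
  refine le_trans (le_of_eq ?_) (harmonic_le_one_add_log n)
  simp [harmonic, Real.rpow_neg_one]

end Rates

section CLT

lemma summable_mul_sum_sum_toReal {ι : Type*} [Fintype ι] {c : ℕ → ℝ} (hc : ∀ n, 0 < c n)
    {f : ℕ → ι → ι → ℝ≥0∞} (hf : ∀ i j, ∑' n, ENNReal.ofReal (c n) * f n i j < ⊤) :
    (∀ n i j, f n i j ≠ ⊤) ∧ Summable fun n => c n * ∑ i, ∑ j, (f n i j).toReal := by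
  refine ⟨fun n i j htop => ?_, ?_⟩
  · refine ENNReal.ne_top_of_tsum_ne_top (hf i j).ne n ?_
    rw [htop, ENNReal.mul_top (by simpa using hc n)]
  · simp only [Finset.mul_sum]
    refine summable_sum fun i _ => summable_sum fun j _ => ?_
    refine (ENNReal.summable_toReal (hf i j).ne).congr fun n => ?_
    rw [ENNReal.toReal_mul, ENNReal.toReal_ofReal (hc n).le]

variable {Ω : Type*} [mΩ : MeasurableSpace Ω] {D : ℕ} {P : Measure Ω}

lemma posSemidef_covMat [IsFiniteMeasure P] {d : ℤ → Ω → EuclideanSpace ℝ (Fin D)}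
    (hd : MemLp (d 0) 2 P) : (Matrix.of (covMat P d)).PosSemidef := by
  refine .of_dotProduct_mulVec_nonneg ?_ fun x => ?_
  · ext i j
    simp [covMat, mul_comm]
  · have h1 := integral_inner_sq_eq hd (WithLp.toLp 2 x)
    have h2 : 0 ≤ ∫ ω, inner ℝ (d 0 ω) (WithLp.toLp 2 x) ^ 2 ∂P :=
      integral_nonneg fun ω => sq_nonneg _
    rw [h1] at h2
    refine h2.trans_eq ?_
    simp only [dotProduct, Matrix.mulVec, Finset.mul_sum]
    refine Finset.sum_congr rfl fun i _ => Finset.sum_congr rfl fun j _ => ?_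
    simp [covMat]
    ring

lemma W1dist_map_smul_le {X : Ω → EuclideanSpace ℝ (Fin D)} (hX : AEMeasurable X P)
    {γ : Measure (EuclideanSpace ℝ (Fin D))} {a b R : ℝ} (ha : 0 < a) (hb : 0 ≤ b)
    (hab : a * b = 1) (hR : 0 ≤ R)
    (h : ∀ g : EuclideanSpace ℝ (Fin D) → ℝ, LipschitzWith 1 g →
      |∫ ω, g (X ω) ∂P - ∫ y, g (b • y) ∂γ| ≤ R) :
    W1dist (P.map fun ω => a • X ω) γ ≤ a * R := by
  refine Real.iSup_le (fun ⟨g, hg⟩ => ?_) (by positivity)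
  have hg' : LipschitzWith 1 fun x => b * g (a • x) := by
    refine LipschitzWith.of_dist_le_mul fun x y => ?_
    have h1 := hg.dist_le_mul (a • x) (a • y)
    rw [NNReal.coe_one, one_mul, dist_smul₀, Real.norm_of_nonneg ha.le] at h1
    rw [NNReal.coe_one, one_mul, Real.dist_eq, ← mul_sub, abs_mul, abs_of_nonneg hb,
      ← Real.dist_eq]
    calc b * dist (g (a • x)) (g (a • y)) ≤ b * (a * dist x y) := by gcongr
      _ = a * b * dist x y := by ring
      _ = dist x y := by rw [hab, one_mul]
  have h2 := h _ hg'
  simp only [smul_smul, hab, one_smul, integral_const_mul] at h2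
  rw [← mul_sub, abs_mul, abs_of_nonneg hb] at h2
  have hae : AEStronglyMeasurable g (P.map fun ω => a • X ω) :=
    hg.continuous.aestronglyMeasurable
  have hmap : ∫ x, g x ∂(P.map fun ω => a • X ω) = ∫ ω, g (a • X ω) ∂P :=
    integral_map (hX.const_smul a) hae
  change ∫ x, g x ∂(P.map fun ω => a • X ω) - ∫ x, g x ∂γ ≤ a * R
  rw [hmap]
  set u := ∫ ω, g (a • X ω) ∂P - ∫ y, g y ∂γ with hu
  calc u ≤ |u| := le_abs_self u
    _ = a * (b * |u|) := by rw [← mul_assoc, hab, one_mul]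
    _ ≤ a * R := by gcongr

lemma exists_forall_rate_le {p C : ℝ} (hp : 2 < p) (hp3 : p ≤ 3) (hC : 0 ≤ C) {W : ℕ → ℝ}
    (hW : ∀ n, 1 ≤ n → W n ≤ (n : ℝ) ^ (-(1 : ℝ) / 2)
      * (C * (1 + ∑ k ∈ Finset.range n, ((k : ℝ) + 1) ^ ((1 - p) / 2)))) :
    ∃ C' > (0 : ℝ), (p < 3 → ∀ n : ℕ, 1 ≤ n → W n ≤ C' * (n : ℝ) ^ ((2 - p) / 2)) ∧
      (p = 3 → ∀ n : ℕ, 2 ≤ n → W n ≤ C' * (n : ℝ) ^ (-(1 : ℝ) / 2) * Real.log n) := by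
  rcases hp3.lt_or_eq with hp3 | rfl
  · set θ := (p - 1) / 2 with hθ
    have h0 : 0 < 1 - θ := by linarith
    refine ⟨C * (1 + (1 - θ)⁻¹) + 1, by positivity, fun _ n hn => ?_, fun h => absurd h hp3.ne⟩
    have hn' : (1 : ℝ) ≤ n := by exact_mod_cast hn
    have h1 := sum_rpow_le_rpow (θ := θ) (by linarith) (by linarith) n
    have h2 : 1 ≤ (n : ℝ) ^ (1 - θ) := Real.one_le_rpow hn' h0.le
    have e : (n : ℝ) ^ ((2 - p) / 2) = (n : ℝ) ^ (-(1 : ℝ) / 2) * (n : ℝ) ^ (1 - θ) := by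
      rw [← Real.rpow_add (by linarith)]
      congr 1
      rw [hθ]
      ring
    have hq : 0 ≤ (n : ℝ) ^ (-(1 : ℝ) / 2) := by positivity
    refine (hW n hn).trans ?_
    rw [show (1 - p) / 2 = -θ by rw [hθ]; ring]
    calc _ ≤ (n : ℝ) ^ (-(1 : ℝ) / 2)
          * (C * ((n : ℝ) ^ (1 - θ) + (1 - θ)⁻¹ * (n : ℝ) ^ (1 - θ))) := by gcongr
      _ = C * (1 + (1 - θ)⁻¹) * (n : ℝ) ^ ((2 - p) / 2) := by
          rw [e]
          ring
      _ ≤ (C * (1 + (1 - θ)⁻¹) + 1) * (n : ℝ) ^ ((2 - p) / 2) := by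
          gcongr
          linarith
  · have hl2 : 0 < Real.log 2 := Real.log_pos (by norm_num)
    refine ⟨C * (2 / Real.log 2 + 1) + 1, by positivity, fun h => absurd h (lt_irrefl _),
      fun _ n hn => ?_⟩
    have hn' : (2 : ℝ) ≤ n := by exact_mod_cast hn
    have h1 := sum_rpow_neg_one_le_one_add_log n
    have h2 : Real.log 2 ≤ Real.log n := Real.log_le_log (by norm_num) hn'
    have h3 : 2 ≤ 2 / Real.log 2 * Real.log n := by
      rw [div_mul_eq_mul_div, le_div_iff₀ hl2]
      gcongr
    have hq : 0 ≤ (n : ℝ) ^ (-(1 : ℝ) / 2) := by positivity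
    have hl : 0 ≤ Real.log n := hl2.le.trans h2
    have h4 : 1 + ∑ k ∈ Finset.range n, ((k : ℝ) + 1) ^ (-1 : ℝ)
        ≤ 2 / Real.log 2 * Real.log n + Real.log n := by linarith
    refine (hW n (by lia)).trans ?_
    rw [show ((1 : ℝ) - 3) / 2 = -1 by norm_num]
    calc _ ≤ (n : ℝ) ^ (-(1 : ℝ) / 2)
          * (C * (2 / Real.log 2 * Real.log n + Real.log n)) :=
          mul_le_mul_of_nonneg_left (mul_le_mul_of_nonneg_left h4 hC) hq
      _ = C * (2 / Real.log 2 + 1) * (n : ℝ) ^ (-(1 : ℝ) / 2) * Real.log n := by ring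
      _ ≤ (C * (2 / Real.log 2 + 1) + 1) * (n : ℝ) ^ (-(1 : ℝ) / 2) * Real.log n := by
          gcongr
          linarith

end CLT

/-- **Remark 2.6 (rates in the CLT in `W₁`).** -/
theorem clt_W1_martingale
    {Ω : Type*} [MeasurableSpace Ω] (P : Measure Ω) [IsProbabilityMeasure P]
    (D : ℕ) (p : ℝ) (hp : 2 < p) (hp3 : p ≤ 3)
    (ℱ : ℤ → MeasurableSpace Ω) (hmono : Monotone ℱ)
    (hle : ∀ n, ℱ n ≤ ‹MeasurableSpace Ω›)
    (d : ℤ → Ω → EuclideanSpace ℝ (Fin D))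
    (hadp : ∀ n, StronglyMeasurable[ℱ n] (d n))
    (hint : ∀ n, Integrable (d n) P)
    (hmds : ∀ n : ℤ, P[d n | ℱ (n - 1)] =ᵐ[P] 0)
    -- stationarity of the sequence
    (hstat : ∀ k : ℤ,
      Measure.map (fun ω => fun n : ℤ => d (n + k) ω) P
        = Measure.map (fun ω => fun n : ℤ => d n ω) P)
    -- moment of order `p`
    (hmom : MemLp (d 0) (ENNReal.ofReal p) P)
    -- condition (C1)
    (hC1 : ∀ i j : Fin D,
      ∑' n : ℕ, ENNReal.ofReal ((n + 1 : ℝ) ^ (-(3 - p / 2))) *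
        envNorm P p (fun ω =>
          (P[fun ω' => partialSum d (n + 1) ω' i * partialSum d (n + 1) ω' j | ℱ 0]) ω
            - ∫ ω', partialSum d (n + 1) ω' i * partialSum d (n + 1) ω' j ∂P) < ⊤)
    -- condition (C2)
    (hC2 : ∀ i j : Fin D,
      ∑' n : ℕ, ENNReal.ofReal ((n + 1 : ℝ) ^ (-(1 + 2 / p))) *
        eLpNorm (fun ω =>
          (P[fun ω' => partialSum d (n + 1) ω' i * partialSum d (n + 1) ω' j | ℱ 0]) ω
            - ∫ ω', partialSum d (n + 1) ω' i * partialSum d (n + 1) ω' j ∂P)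
          (ENNReal.ofReal (p / 2)) P < ⊤) :
    ∀ γ : Measure (EuclideanSpace ℝ (Fin D)),
      IsCenteredGaussianCov D (fun a b => ∫ ω, d 0 ω a * d 0 ω b ∂P) γ →
      ∃ C > (0 : ℝ),
        (p < 3 → ∀ n : ℕ, 1 ≤ n →
          W1dist
              (Measure.map (fun ω => ((n : ℝ) ^ (-(1 : ℝ) / 2)) • partialSum d n ω) P) γ
            ≤ C * (n : ℝ) ^ ((2 - p) / 2)) ∧
        (p = 3 → ∀ n : ℕ, 2 ≤ n →
          W1dist
              (Measure.map (fun ω => ((n : ℝ) ^ (-(1 : ℝ) / 2)) • partialSum d n ω) P) γ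
            ≤ C * (n : ℝ) ^ (-(1 : ℝ) / 2) * Real.log n) := by
  intro γ hγ
  have h : StationaryMDS P p ℱ d := ⟨hmono, hle, hadp, hint, hmds, hstat, hmom⟩
  have hS : (Matrix.of (covMat P d)).PosSemidef := posSemidef_covMat (hmom.mono_exponent (by
    rw [show (2 : ℝ≥0∞) = ENNReal.ofReal 2 by simp]
    exact ENNReal.ofReal_le_ofReal hp.le))
  obtain ⟨he, hs1⟩ := summable_mul_sum_sum_toReal (fun n : ℕ => by positivity)
    (f := fun n i j => envNorm P p (condDev P ℱ d (n + 1) i j)) hC1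
  obtain ⟨hl, hs2⟩ := summable_mul_sum_sum_toReal (fun n : ℕ => by positivity)
    (f := fun n i j => eLpNorm (condDev P ℱ d (n + 1) i j) (ENNReal.ofReal (p / 2)) P) hC2
  obtain ⟨C, hC, hmain⟩ := h.exists_abs_integral_lipschitz_sub_le hp hp3 he hl hs1 hs2 hS
    (fun _ _ => rfl) (IsCenteredGaussianCov.eq_multivariateGaussian hγ hS)
  refine exists_forall_rate_le hp hp3 hC fun n hn => ?_
  have hn' : (0 : ℝ) < n := by exact_mod_cast hn
  refine W1dist_map_smul_le (h.memLp_partialSum n).1.aemeasurable (by positivity)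
    (Real.sqrt_nonneg _) ?_ ?_ fun g hg => hmain g hg n
  · rw [Real.sqrt_eq_rpow, ← Real.rpow_add hn']
    norm_num
  · have : 0 ≤ ∑ k ∈ Finset.range n, ((k : ℝ) + 1) ^ ((1 - p) / 2) :=
      Finset.sum_nonneg fun k _ => by positivity
    positivity

end
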